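/- Let N ∈ {5,6,7,8,10,11,12,14,15,17,23}, let k be a positive even integer, and let (a_n) be complex numbers with a_n = O(n^C) for some C > 0 and a_1 = 1. Suppose F(s) = Σ_{n≥1} a_n n^{−s} satisfies a functional equation of degree 2, level N, weight k (Φ(s) = (√N/(2π))^s Γ(s) F(s) extends to an entire function, bounded in every vertical strip, with Φ(s) = ε(−1)^{k/2} Φ(k−s) for some ε ∈ {+1,−1}) and has an Euler product of degree 2, level N, weight k (for Re(s) large, F(s) = ∏_p F_p(s) with F_p(s) = (1 − a_p p^{−s} + p^{k−1−2s})^{−1} if p ∤ N, F_q(s) = (1 − q^{k/2−1−s})^{−1} if q | N, q² ∤ N, and F_q(s) = 1 if q² | N). Then f(z) = Σ_{n≥1} a_n e^{2πinz} is a cusp form of weight k for Γ₀(N): f is holomorphic on ℍ, f|_k γ = f for all γ ∈ Γ₀(N), and for every σ ∈ SL₂(ℤ) the function (f|_k σ)(z) tends to 0 as Im(z) → ∞. (Corollary 1; the cases N = 9 and N = 16, where the vanishing at the cusps can fail for sign −1, are excluded.) -/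

import Mathlib

open UpperHalfPlane Matrix Complex MatrixGroups Asymptotics Filter Topology
open scoped Manifold

set_option synthInstance.maxHeartbeats 1000000 in
/-- Action of a real 2×2 matrix with positive determinant on the upper
half-plane `ℍ` (junk value `z` if the determinant is not positive). -/
noncomputable def glAct (γ : Matrix (Fin 2) (Fin 2) ℝ) (z : ℍ) : ℍ :=
  if h : 0 < γ.det then
    (⟨Matrix.GeneralLinearGroup.mkOfDetNeZero γ h.ne', by
        simpa [Matrix.GeneralLinearGroup.mkOfDetNeZero] using h⟩ : GL(2, ℝ)⁺) • z
  else z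

/-- For an even integer `k`, the weight-`k` slash action
`(f ∣ₖ γ)(z) = (det γ)^(k/2) (cz+d)^(-k) f(γz)`. -/
noncomputable def slash (k : ℤ) (γ : Matrix (Fin 2) (Fin 2) ℝ) (f : ℍ → ℂ) : ℍ → ℂ :=
  fun z => (γ.det : ℂ) ^ (k / 2) * (γ 1 0 * (z : ℂ) + γ 1 1) ^ (-k) * f (glAct γ z)

/-- An element of `SL(2, ℤ)` as a real matrix. -/
def sl2ToReal (γ : Matrix.SpecialLinearGroup (Fin 2) ℤ) : Matrix (Fin 2) (Fin 2) ℝ :=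
  (γ : Matrix (Fin 2) (Fin 2) ℤ).map (Int.cast)

/-- The function `f(z) = Σ_{n ≥ 1} a_n e^{2πinz}` on the upper half-plane. -/
noncomputable def fourierSeries (a : ℕ → ℂ) : ℍ → ℂ :=
  fun z => ∑' n : ℕ, a (n + 1) *
    Complex.exp (2 * (Real.pi : ℂ) * Complex.I * ((n : ℂ) + 1) * (z : ℂ))

/-- The Dirichlet series `F(s) = Σ_{n ≥ 1} a_n n^{-s}`. -/
noncomputable def dirichletSeries (a : ℕ → ℂ) (s : ℂ) : ℂ :=
  ∑' n : ℕ, a (n + 1) / ((n : ℂ) + 1) ^ s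

/-- The action of the Hecke operator `T_p` in weight `k`:
`f|_k T_p = f|_k ((p,0),(0,1)) + Σ_{b=0}^{p-1} f|_k ((1,b),(0,p))`. -/
noncomputable def heckeT (k : ℤ) (p : ℕ) (f : ℍ → ℂ) : ℍ → ℂ :=
  fun z => slash k !![(p : ℝ), 0; 0, 1] f z +
    ∑ b ∈ Finset.range p, slash k !![1, (b : ℝ); 0, (p : ℝ)] f z

/-- The action of the Atkin–Lehner operator `U_q` in weight `k`:
`f|_k U_q = Σ_{b=0}^{q-1} f|_k ((q,b),(0,q))`. -/
noncomputable def atkinLehnerU (k : ℤ) (q : ℕ) (f : ℍ → ℂ) : ℍ → ℂ :=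
  fun z => ∑ b ∈ Finset.range q, slash k !![(q : ℝ), (b : ℝ); 0, (q : ℝ)] f z

/-- The local factor at the prime `p` of an Euler product of degree 2,
level `N`, and weight `k`. -/
noncomputable def localFactor (a : ℕ → ℂ) (N : ℕ) (k : ℤ) (p : ℕ) (s : ℂ) : ℂ :=
  if p ∣ N then
    (if p ^ 2 ∣ N then 1 else (1 - (p : ℂ) ^ ((k : ℂ) / 2 - 1 - s))⁻¹)
  else (1 - a p * (p : ℂ) ^ (-s) + (p : ℂ) ^ ((k : ℂ) - 1 - 2 * s))⁻¹

/-! ### The slash action -/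

section SlashBasics

lemma mul_div_add_eq {r : ℂ} (hr : r ≠ 0) (x y p : ℂ) : x * (p / r) + y = (x * p + y * r) / r := by
  field_simp

lemma bottom_row_ne_zero {γ : Matrix (Fin 2) (Fin 2) ℝ} (h : γ.det ≠ 0) (z : ℍ) :
    (γ 1 0 : ℂ) * (z : ℂ) + γ 1 1 ≠ 0 :=
  denom_ne_zero (Matrix.GeneralLinearGroup.mkOfDetNeZero γ h) z

lemma coe_glAct {γ : Matrix (Fin 2) (Fin 2) ℝ} (h : 0 < γ.det) (z : ℍ) :
    ((glAct γ z : ℍ) : ℂ) = (γ 0 0 * (z : ℂ) + γ 0 1) / (γ 1 0 * (z : ℂ) + γ 1 1) := by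
  rw [glAct, dif_pos h]
  have h' : 0 < (Matrix.GeneralLinearGroup.det
      (Matrix.GeneralLinearGroup.mkOfDetNeZero γ h.ne')).val := by
    simpa [Matrix.GeneralLinearGroup.mkOfDetNeZero] using h
  exact UpperHalfPlane.coe_smul_of_det_pos h' z

lemma glAct_mul {A B : Matrix (Fin 2) (Fin 2) ℝ} (hA : 0 < A.det) (hB : 0 < B.det) (z : ℍ) :
    glAct (A * B) z = glAct A (glAct B z) := by
  have hAB : 0 < (A * B).det := by rw [Matrix.det_mul]; positivity
  apply UpperHalfPlane.ext
  have h1 := bottom_row_ne_zero hB.ne' z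
  have h2 := bottom_row_ne_zero hA.ne' (glAct B z)
  have h3 := bottom_row_ne_zero hAB.ne' z
  rw [coe_glAct hAB, coe_glAct hA]
  rw [coe_glAct hB] at h2 ⊢
  simp only [Matrix.mul_apply, Fin.sum_univ_two] at h3 ⊢
  push_cast at h3 ⊢
  have h4 : ((A 1 0 : ℂ) * (((B 0 0 : ℂ) * z + B 0 1) / (B 1 0 * z + B 1 1)) + A 1 1)
      = ((A 1 0 * B 0 0 + A 1 1 * B 1 0 : ℂ) * z + (A 1 0 * B 0 1 + A 1 1 * B 1 1))
        / (B 1 0 * z + B 1 1) := by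
    rw [mul_div_add_eq h1]; congr 1; ring
  have h5 : ((A 0 0 : ℂ) * (((B 0 0 : ℂ) * z + B 0 1) / (B 1 0 * z + B 1 1)) + A 0 1)
      = ((A 0 0 * B 0 0 + A 0 1 * B 1 0 : ℂ) * z + (A 0 0 * B 0 1 + A 0 1 * B 1 1))
        / (B 1 0 * z + B 1 1) := by
    rw [mul_div_add_eq h1]; congr 1; ring
  rw [h4, h5, div_div_div_cancel_right₀ h1]

lemma slash_mul' (k : ℤ) {A B : Matrix (Fin 2) (Fin 2) ℝ} (hA : 0 < A.det) (hB : 0 < B.det)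
    (g : ℍ → ℂ) : slash k (A * B) g = slash k B (slash k A g) := by
  funext z
  have h1 := bottom_row_ne_zero hB.ne' z
  simp only [slash, glAct_mul hA hB, Matrix.det_mul]
  have h4 : (((A * B) 1 0 : ℝ) : ℂ) * (z : ℂ) + ((A * B) 1 1 : ℝ)
      = (A 1 0 * (glAct B z : ℂ) + A 1 1) * (B 1 0 * (z : ℂ) + B 1 1) := by
    rw [coe_glAct hB]
    simp only [Matrix.mul_apply, Fin.sum_univ_two]
    push_cast
    rw [mul_div_add_eq h1, div_mul_cancel₀ _ h1]; ring
  rw [h4, mul_zpow]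
  push_cast
  rw [mul_zpow]
  ring

lemma slash_scalar {k : ℤ} (hk : Even k) {c : ℝ} (hc : c ≠ 0) {A : Matrix (Fin 2) (Fin 2) ℝ}
    (hA : 0 < A.det) (g : ℍ → ℂ) : slash k (c • A) g = slash k A g := by
  have hdet : (c • A).det = c ^ 2 * A.det := by
    simp
  have hcA : 0 < (c • A).det := by rw [hdet]; positivity
  have hcc : (c : ℂ) ≠ 0 := by exact_mod_cast hc
  funext z
  have h0 := bottom_row_ne_zero hA.ne' z
  have h1 : glAct (c • A) z = glAct A z := by
    apply UpperHalfPlane.ext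
    rw [coe_glAct hcA, coe_glAct hA]
    simp only [Matrix.smul_apply, smul_eq_mul]
    push_cast
    rw [mul_assoc, mul_assoc, ← mul_add, ← mul_add, mul_div_mul_left _ _ hcc]
  simp only [slash, h1, hdet, Matrix.smul_apply, smul_eq_mul]
  push_cast
  rw [mul_assoc (c : ℂ), ← mul_add, mul_zpow, mul_zpow, ← zpow_natCast, ← _root_.zpow_mul]
  obtain ⟨m, rfl⟩ := hk
  have : ((2 : ℕ) : ℤ) * ((m + m) / 2) = m + m := by push_cast; omega
  rw [this, zpow_neg (c : ℂ)]
  have := zpow_ne_zero (m + m) hcc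
  field_simp

/-- The slash action of the matrix with integer entries `a, b; c, d`. -/
noncomputable def intSlash (k a b c d : ℤ) (g : ℍ → ℂ) : ℍ → ℂ :=
  slash k !![(a : ℝ), (b : ℝ); (c : ℝ), (d : ℝ)] g

variable {k : ℤ}

lemma det_int (a b c d : ℤ) :
    (!![(a : ℝ), (b : ℝ); (c : ℝ), (d : ℝ)]).det = ((a * d - b * c : ℤ) : ℝ) := by
  rw [Matrix.det_fin_two_of]; push_cast; ring

lemma intSlash_intSlash {a b c d a' b' c' d' : ℤ} (h : 0 < a * d - b * c)
    (h' : 0 < a' * d' - b' * c') (g : ℍ → ℂ) :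
    intSlash k a' b' c' d' (intSlash k a b c d g) =
      intSlash k (a * a' + b * c') (a * b' + b * d') (c * a' + d * c') (c * b' + d * d') g := by
  rw [intSlash, intSlash, intSlash, ← slash_mul' k (by rw [det_int]; exact_mod_cast h)
    (by rw [det_int]; exact_mod_cast h')]
  congr 1
  ext i j; fin_cases i <;> fin_cases j <;> simp [Matrix.mul_apply, Fin.sum_univ_two]

lemma intSlash_scale (hk : Even k) (m : ℤ) (hm : m ≠ 0) {a b c d : ℤ} (h : 0 < a * d - b * c)
    (g : ℍ → ℂ) :
    intSlash k (m * a) (m * b) (m * c) (m * d) g = intSlash k a b c d g := by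
  rw [intSlash, intSlash, ← slash_scalar hk (c := (m : ℝ)) (by exact_mod_cast hm)
    (A := !![(a : ℝ), (b : ℝ); (c : ℝ), (d : ℝ)]) (by rw [det_int]; exact_mod_cast h)]
  congr 1
  ext i j; fin_cases i <;> fin_cases j <;> simp

lemma intSlash_apply (a b c d : ℤ) (g : ℍ → ℂ) (z : ℍ) :
    intSlash k a b c d g z = ((a * d - b * c : ℤ) : ℂ) ^ (k / 2) * (c * (z : ℂ) + d) ^ (-k) *
      g (glAct !![(a : ℝ), (b : ℝ); (c : ℝ), (d : ℝ)] z) := by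
  simp [intSlash, slash]

lemma intSlash_one (g : ℍ → ℂ) : intSlash k 1 0 0 1 g = g := by
  funext z
  rw [intSlash_apply]
  have : glAct !![((1 : ℤ) : ℝ), ((0 : ℤ) : ℝ); ((0 : ℤ) : ℝ), ((1 : ℤ) : ℝ)] z = z := by
    apply UpperHalfPlane.ext
    rw [coe_glAct (by simp)]
    simp
  rw [this]; simp

lemma intSlash_add (a b c d : ℤ) (g h : ℍ → ℂ) :
    intSlash k a b c d (g + h) = intSlash k a b c d g + intSlash k a b c d h := by
  funext z; simp only [intSlash_apply, Pi.add_apply]; ring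

lemma intSlash_sub (a b c d : ℤ) (g h : ℍ → ℂ) :
    intSlash k a b c d (g - h) = intSlash k a b c d g - intSlash k a b c d h := by
  funext z; simp only [intSlash_apply, Pi.sub_apply]; ring

lemma intSlash_neg (a b c d : ℤ) (g : ℍ → ℂ) :
    intSlash k a b c d (-g) = -intSlash k a b c d g := by
  funext z; simp only [intSlash_apply, Pi.neg_apply]; ring

lemma intSlash_smul (a b c d : ℤ) (x : ℂ) (g : ℍ → ℂ) :
    intSlash k a b c d (x • g) = x • intSlash k a b c d g := by
  funext z; simp only [intSlash_apply, Pi.smul_apply, smul_eq_mul]; ring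

lemma slash_sl2ToReal (γ : SL(2, ℤ)) (g : ℍ → ℂ) :
    slash k (sl2ToReal γ) g = intSlash k (γ 0 0) (γ 0 1) (γ 1 0) (γ 1 1) g := by
  rw [intSlash]
  congr 1
  ext i j; fin_cases i <;> fin_cases j <;> rfl

lemma det_int_pos {a b c d : ℤ} (h : 0 < a * d - b * c) :
    0 < (!![(a : ℝ), (b : ℝ); (c : ℝ), (d : ℝ)]).det := by
  rw [det_int]; exact_mod_cast h

end SlashBasics

/-! ### Elliptic matrices of infinite order -/

section Elliptic

/-- If a root `j` of `X² - τ X + D` satisfies `j ^ (2 * n) = D ^ n` for some `n > 0`, then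
`D ∣ τ²`. -/
lemma dvd_sq_trace_of_pow_eq {τ D : ℤ} (hD : 0 < D) {j : ℂ} (hj : j ^ 2 - τ * j + D = 0)
    {n : ℕ} (hn : 0 < n) (h : j ^ (2 * n) = (D : ℂ) ^ n) : D ∣ τ ^ 2 := by
  have hDc : (D : ℂ) ≠ 0 := by exact_mod_cast hD.ne'
  have hj0 : j ≠ 0 := by
    rintro rfl
    simp at hj
    exact hD.ne' hj
  have hζ : (j ^ 2 / D) ^ n = 1 := by
    rw [div_pow, ← pow_mul, h, div_self (pow_ne_zero _ hDc)]
  have hζ' : ((j ^ 2 / D)⁻¹) ^ n = 1 := by rw [inv_pow, hζ, inv_one]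
  have i1 : IsIntegral ℤ (j ^ 2 / (D : ℂ)) :=
    IsIntegral.of_pow hn (by rw [hζ]; exact isIntegral_one)
  have i2 : IsIntegral ℤ ((j ^ 2 / (D : ℂ))⁻¹) :=
    IsIntegral.of_pow hn (by rw [hζ']; exact isIntegral_one)
  have i3 : IsIntegral ℤ (j ^ 2 / (D : ℂ) + (j ^ 2 / (D : ℂ))⁻¹ + ((2 : ℤ) : ℂ)) :=
    (i1.add i2).add (isIntegral_algebraMap (R := ℤ) (A := ℂ) (x := 2))
  have e : j ^ 2 / (D : ℂ) + (j ^ 2 / (D : ℂ))⁻¹ + ((2 : ℤ) : ℂ)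
      = algebraMap ℚ ℂ ((τ : ℚ) ^ 2 / D) := by
    have : (τ : ℂ) = (j ^ 2 + D) / j := by field_simp; linear_combination -hj
    simp only [map_div₀, map_pow, map_intCast, this]
    push_cast
    field_simp
    ring
  rw [e, isIntegral_algebraMap_iff (algebraMap ℚ ℂ).injective,
    IsIntegrallyClosed.isIntegral_iff] at i3
  obtain ⟨y, hy⟩ := i3
  refine ⟨y, ?_⟩
  have hDq : (D : ℚ) ≠ 0 := by exact_mod_cast hD.ne'
  have : (τ : ℚ) ^ 2 = D * y := by
    simp only [algebraMap_int_eq, eq_intCast] at hy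
    rw [hy]; field_simp
  exact_mod_cast this

lemma exists_fixed_point {a b c d : ℤ} (ht : (a + d) ^ 2 < 4 * (a * d - b * c)) :
    ∃ z₀ : ℍ, (c : ℂ) * (z₀ : ℂ) ^ 2 + (d - a) * z₀ - b = 0 := by
  have hc : c ≠ 0 := by rintro rfl; nlinarith [sq_nonneg (a - d)]
  have hcr : (c : ℝ) ≠ 0 := by exact_mod_cast hc
  have hcc : (c : ℂ) ≠ 0 := by exact_mod_cast hc
  set Δ : ℝ := ((4 * (a * d - b * c) - (a + d) ^ 2 : ℤ) : ℝ) with hΔ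
  have hΔ0 : 0 < Δ := by rw [hΔ]; exact_mod_cast (by linarith)
  set t : ℝ := √Δ / (2 * |(c : ℝ)|) with ht'
  have htpos : 0 < t := by positivity
  have hsq : t ^ 2 * (4 * (c : ℝ) ^ 2) = Δ := by
    rw [ht', div_pow, Real.sq_sqrt hΔ0.le, mul_pow, sq_abs]
    field_simp
    norm_num
  refine ⟨⟨((a - d : ℝ) / (2 * c) : ℝ) + t * Complex.I, by
    rw [Complex.add_im, Complex.ofReal_im]; simpa using htpos⟩, ?_⟩
  have hsqc : ((t : ℂ) ^ 2) * (4 * (c : ℂ) ^ 2) =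
      ((4 * (a * d - b * c) - (a + d) ^ 2 : ℤ) : ℂ) := by
    have := congrArg (fun x : ℝ => (x : ℂ)) hsq
    simpa [hΔ] using this
  show (c : ℂ) * ((((a - d : ℝ) / (2 * c) : ℝ) : ℂ) + t * Complex.I) ^ 2 +
    (d - a) * ((((a - d : ℝ) / (2 * c) : ℝ) : ℂ) + t * Complex.I) - b = 0
  push_cast at hsqc ⊢
  have hI : Complex.I ^ 2 = -1 := Complex.I_sq
  have h4 : (4 * (c : ℂ)) ≠ 0 := by simpa using hcc
  apply mul_left_cancel₀ h4
  have e1 : ((a : ℂ) - d) / (2 * (c : ℂ)) = ((a : ℂ) - d) * (2 * (c : ℂ))⁻¹ := rfl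
  have e2 : (2 * (c : ℂ)) * (2 * (c : ℂ))⁻¹ = 1 := mul_inv_cancel₀ (by simpa using hcc)
  rw [e1]
  generalize (2 * (c : ℂ))⁻¹ = r at e2
  linear_combination (-1 : ℂ) * hsqc + 4 * c ^ 2 * t ^ 2 * hI +
    (4 * c * t * Complex.I * (a - d) + (a - d) ^ 2 * (2 * c * r + 1) - 2 * (a - d) ^ 2) * e2

/-- A holomorphic function of positive even weight which is invariant up to sign under an elliptic
matrix of infinite order vanishes identically. -/
theorem eq_zero_of_elliptic {k : ℤ} (hk : 0 < k) {g : ℍ → ℂ}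
    (hg : DifferentiableOn ℂ (g ∘ UpperHalfPlane.ofComplex) {z | 0 < z.im})
    (heven : Even k) {a b c d : ℤ} (ht : (a + d) ^ 2 < 4 * (a * d - b * c))
    (hnd : ¬ (a * d - b * c) ∣ (a + d) ^ 2) {s : ℂ} (hs : s ^ 2 = 1)
    (h : intSlash k a b c d g = s • g) : g = 0 := by
  have hD : 0 < a * d - b * c := by nlinarith [sq_nonneg (a + d)]
  obtain ⟨z₀, hz₀⟩ := exists_fixed_point ht
  set G : ℂ → ℂ := g ∘ UpperHalfPlane.ofComplex with hG
  have hU : IsOpen {z : ℂ | 0 < z.im} := isOpen_lt continuous_const Complex.continuous_im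
  have hUc : IsPreconnected {z : ℂ | 0 < z.im} := (convex_halfSpace_im_gt 0).isPreconnected
  have hA : AnalyticOnNhd ℂ G {z : ℂ | 0 < z.im} := hg.analyticOnNhd hU
  have hz₀U : (z₀ : ℂ) ∈ {z : ℂ | 0 < z.im} := z₀.im_pos
  have hzero : (∀ᶠ z in 𝓝 (z₀ : ℂ), G z = 0) → g = 0 := by
    intro hev
    have := hA.eqOn_zero_of_preconnected_of_eventuallyEq_zero hUc hz₀U hev
    funext z
    have := this z.im_pos
    simpa [hG] using this
  by_contra hne
  have hne' : ¬ ∀ᶠ z in 𝓝 (z₀ : ℂ), G z = 0 := fun h' => hne (hzero h')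
  obtain ⟨m, u, hu, hu0, hGu⟩ :=
    (hA z₀ hz₀U).exists_eventuallyEq_pow_smul_nonzero_iff.mpr hne'
  have hmat := det_int_pos hD
  set φ : ℂ → ℂ := fun z => (a * z + b) / (c * z + d) with hφ
  set j : ℂ := c * z₀ + d with hj
  have hj0 : j ≠ 0 := by simpa using bottom_row_ne_zero hmat.ne' z₀
  have hDc : ((a * d - b * c : ℤ) : ℂ) ≠ 0 := by exact_mod_cast hD.ne'
  have hφz₀ : φ z₀ = z₀ := by
    simp only [hφ]
    rw [div_eq_iff hj0]
    linear_combination -hz₀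
  have hcont : ContinuousAt φ z₀ := by
    apply ContinuousAt.div
    · fun_prop
    · fun_prop
    · exact hj0
  have hfe : ∀ z : ℂ, 0 < z.im →
      ((a * d - b * c : ℤ) : ℂ) ^ (k / 2) * (c * z + d) ^ (-k) * G (φ z) = s * G z := by
    intro z hz
    have := congrFun h ⟨z, hz⟩
    rw [intSlash_apply] at this
    have e : ((glAct !![(a : ℝ), (b : ℝ); (c : ℝ), (d : ℝ)] ⟨z, hz⟩ : ℍ) : ℂ) = φ z := by
      rw [coe_glAct hmat]; simp [hφ]
    have e2 : G (φ z) = g (glAct !![(a : ℝ), (b : ℝ); (c : ℝ), (d : ℝ)] ⟨z, hz⟩) := by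
      rw [← e]; simp [hG]
    have e3 : G z = g ⟨z, hz⟩ := by
      simp [hG, ofComplex_apply_of_im_pos hz]
    rw [e2, e3]
    simpa using this
  have hden : ∀ᶠ z in 𝓝 (z₀ : ℂ), (c : ℂ) * z + d ≠ 0 := by
    have : ContinuousAt (fun z : ℂ => (c : ℂ) * z + d) z₀ := by fun_prop
    exact this.eventually_ne hj0
  have hev : ∀ᶠ z in 𝓝[≠] (z₀ : ℂ),
      ((a * d - b * c : ℤ) : ℂ) ^ (k / 2) * (c * z + d) ^ (-k) *
        (((a * d - b * c : ℤ) : ℂ) / ((c * z + d) * j)) ^ m * u (φ z) = s * u z := by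
    have h1 : ∀ᶠ z in 𝓝 (z₀ : ℂ), G (φ z) = (φ z - z₀) ^ m • u (φ z) := by
      have : Tendsto φ (𝓝 (z₀ : ℂ)) (𝓝 (z₀ : ℂ)) := by
        have := hcont.tendsto
        rwa [hφz₀] at this
      exact this.eventually hGu
    filter_upwards [nhdsWithin_le_nhds h1, nhdsWithin_le_nhds hGu, nhdsWithin_le_nhds hden,
      nhdsWithin_le_nhds (hU.mem_nhds hz₀U), self_mem_nhdsWithin] with z h1 h2 h3 h4 h5
    have h6 : z - (z₀ : ℂ) ≠ 0 := sub_ne_zero.mpr h5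
    have h7 : φ z - z₀ = ((a * d - b * c : ℤ) : ℂ) / ((c * z + d) * j) * (z - z₀) := by
      have : (z₀ : ℂ) = (a * z₀ + b) / j := hφz₀.symm
      have e : φ z - z₀ = (a * z + b) / (c * z + d) - (a * z₀ + b) / j := by rw [← this]
      rw [e, div_sub_div _ _ h3 hj0, div_mul_eq_mul_div]
      congr 1
      rw [hj]; push_cast; ring
    have h8 := hfe z h4
    rw [h1, h2, h7, mul_pow, smul_eq_mul, smul_eq_mul] at h8
    apply mul_right_cancel₀ (pow_ne_zero m h6)
    linear_combination h8
  have hlim1 : Tendsto (fun z : ℂ => ((a * d - b * c : ℤ) : ℂ) ^ (k / 2) * (c * z + d) ^ (-k) *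
        (((a * d - b * c : ℤ) : ℂ) / ((c * z + d) * j)) ^ m * u (φ z)) (𝓝[≠] (z₀ : ℂ))
      (𝓝 (((a * d - b * c : ℤ) : ℂ) ^ (k / 2) * j ^ (-k) *
        (((a * d - b * c : ℤ) : ℂ) / (j * j)) ^ m * u z₀)) := by
    apply Tendsto.mono_left _ nhdsWithin_le_nhds
    have c1 : ContinuousAt (fun z : ℂ => (c : ℂ) * z + d) z₀ := by fun_prop
    have c2 : ContinuousAt (fun z : ℂ => u (φ z)) z₀ := by
      apply ContinuousAt.comp _ hcont
      rw [hφz₀]; exact hu.continuousAt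
    have c3 : ContinuousAt (fun z : ℂ => ((a * d - b * c : ℤ) : ℂ) ^ (k / 2) * (c * z + d) ^ (-k) *
        (((a * d - b * c : ℤ) : ℂ) / ((c * z + d) * j)) ^ m * u (φ z)) z₀ := by
      apply ContinuousAt.mul _ c2
      apply ContinuousAt.mul
      · exact continuousAt_const.mul (c1.zpow₀ _ (Or.inl hj0))
      · apply ContinuousAt.pow
        exact continuousAt_const.div (c1.mul continuousAt_const) (mul_ne_zero hj0 hj0)
    have := c3.tendsto
    simp only [hφz₀] at this
    exact this
  have hlim2 : Tendsto (fun z : ℂ => s * u z) (𝓝[≠] (z₀ : ℂ)) (𝓝 (s * u z₀)) :=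
    (hu.continuousAt.tendsto.const_mul s).mono_left nhdsWithin_le_nhds
  have hkey := tendsto_nhds_unique (hlim1.congr' hev) hlim2
  have hkey' := mul_right_cancel₀ hu0 hkey
  obtain ⟨l, hl⟩ := Int.eq_ofNat_of_zero_le (show 0 ≤ k / 2 by omega)
  have hk2 : k = ((2 * l : ℕ) : ℤ) := by obtain ⟨r, rfl⟩ := heven; push_cast; omega
  rw [hl, hk2, _root_.zpow_neg, zpow_natCast, zpow_natCast] at hkey'
  apply hnd
  have hj2 : j ^ 2 - ((a + d : ℤ) : ℂ) * j + ((a * d - b * c : ℤ) : ℂ) = 0 := by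
    rw [hj]; push_cast; linear_combination (c : ℂ) * hz₀
  refine dvd_sq_trace_of_pow_eq hD hj2 (n := 2 * (l + m)) (by omega) ?_
  have hkey2 : ((a * d - b * c : ℤ) : ℂ) ^ (l + m) = s * j ^ (2 * (l + m)) := by
    rw [div_pow] at hkey'
    field_simp at hkey'
    rw [pow_add, hkey']
    ring_nf
  calc j ^ (2 * (2 * (l + m))) = s ^ 2 * (j ^ (2 * (l + m))) ^ 2 := by rw [hs]; ring
    _ = (s * j ^ (2 * (l + m))) ^ 2 := by ring
    _ = _ := by rw [← hkey2]; ring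

end Elliptic

/-! ### Relations between slash translates -/

section Relations

variable {k : ℤ}

lemma intSlash_comp (hk : Even k) (m : ℤ) {a b c d a' b' c' d' p q r t : ℤ} (hm : m ≠ 0)
    (h : 0 < a * d - b * c) (h' : 0 < a' * d' - b' * c')
    (e₁ : a * a' + b * c' = m * p) (e₂ : a * b' + b * d' = m * q)
    (e₃ : c * a' + d * c' = m * r) (e₄ : c * b' + d * d' = m * t) (g : ℍ → ℂ) :
    intSlash k a' b' c' d' (intSlash k a b c d g) = intSlash k p q r t g := by
  have hdet : (m * p) * (m * t) - (m * q) * (m * r) =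
      (a * d - b * c) * (a' * d' - b' * c') := by
    rw [← e₁, ← e₂, ← e₃, ← e₄]; ring
  have h1 : 0 < m ^ 2 * (p * t - q * r) := by
    have := mul_pos h h'
    linarith
  have h2 : 0 < p * t - q * r := pos_of_mul_pos_right h1 (sq_nonneg m)
  rw [intSlash_intSlash h h', e₁, e₂, e₃, e₄, intSlash_scale hk m hm h2]

lemma intSlash_zero (a b c d : ℤ) : intSlash k a b c d 0 = 0 := by
  funext z; simp [intSlash_apply]

lemma intSlash_adj (hk : Even k) {a b c d : ℤ} (h : 0 < a * d - b * c) (g : ℍ → ℂ) :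
    intSlash k d (-b) (-c) a (intSlash k a b c d g) = g := by
  rw [intSlash_comp hk (a * d - b * c) h.ne' h (by linarith) (p := 1) (q := 0) (r := 0) (t := 1)
    (by ring) (by ring) (by ring) (by ring), intSlash_one]

/-- Holomorphy on the upper half-plane, in terms of the extension by `ofComplex`. -/
def HoloUHP (g : ℍ → ℂ) : Prop :=
  DifferentiableOn ℂ (g ∘ UpperHalfPlane.ofComplex) {z | 0 < z.im}

lemma HoloUHP.add {g h : ℍ → ℂ} (hg : HoloUHP g) (hh : HoloUHP h) : HoloUHP (g + h) :=
  DifferentiableOn.add hg hh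

lemma HoloUHP.sub {g h : ℍ → ℂ} (hg : HoloUHP g) (hh : HoloUHP h) : HoloUHP (g - h) :=
  DifferentiableOn.sub hg hh

lemma HoloUHP.intSlash {g : ℍ → ℂ} (hg : HoloUHP g) {a b c d : ℤ} (h : 0 < a * d - b * c) :
    HoloUHP (intSlash k a b c d g) := by
  have hmat := det_int_pos h
  have e : ∀ z : ℂ, 0 < z.im → ((a * z + b) / (c * z + d) : ℂ) =
      glAct !![(a : ℝ), (b : ℝ); (c : ℝ), (d : ℝ)] (ofComplex z) := by
    intro z hz
    rw [coe_glAct hmat]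
    simp [ofComplex_apply_of_im_pos hz]
  have hne : ∀ z : ℂ, 0 < z.im → (c * z + d : ℂ) ≠ 0 := by
    intro z hz
    simpa using bottom_row_ne_zero hmat.ne' ⟨z, hz⟩
  have key : DifferentiableOn ℂ (fun z : ℂ => ((a * d - b * c : ℤ) : ℂ) ^ (k / 2) *
      (c * z + d) ^ (-k) * (g ∘ ofComplex) ((a * z + b) / (c * z + d))) {z | 0 < z.im} := by
    apply DifferentiableOn.mul
    · apply DifferentiableOn.mul (differentiableOn_const _)
      intro z hz
      exact DifferentiableWithinAt.zpow (f := fun z : ℂ => (c : ℂ) * z + d) (by fun_prop)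
        (Or.inl (hne z hz))
    · apply hg.comp
      · intro z hz
        exact DifferentiableWithinAt.div (by fun_prop) (by fun_prop) (hne z hz)
      · intro z hz
        change 0 < ((a * z + b) / (c * z + d) : ℂ).im
        rw [e z hz]
        exact UpperHalfPlane.im_pos _
  refine key.congr fun z hz => ?_
  have hz' : 0 < z.im := hz
  rw [Function.comp_apply, intSlash_apply, Function.comp_apply, e z hz']
  simp [ofComplex_apply_of_im_pos hz']

/-- Two relations between translates of `v` and `v'` give an invariance of `v`, which
forces `v = 0` if the matrix involved is elliptic of infinite order. -/
lemma eq_zero_of_two_relations (hk : Even k) (hk0 : 0 < k) {v v' : ℍ → ℂ} (hv : HoloUHP v)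
    {a₁ a₂ a₃ a₄ b₁ b₂ b₃ b₄ c₁ c₂ c₃ c₄ d₁ d₂ d₃ d₄ p q r t m : ℤ}
    (hA : 0 < a₁ * a₄ - a₂ * a₃) (hB : 0 < b₁ * b₄ - b₂ * b₃)
    (hC : 0 < c₁ * c₄ - c₂ * c₃) (hD : 0 < d₁ * d₄ - d₂ * d₃)
    (h₁ : intSlash k a₁ a₂ a₃ a₄ v + intSlash k b₁ b₂ b₃ b₄ v' = 0)
    (h₂ : intSlash k c₁ c₂ c₃ c₄ v' + intSlash k d₁ d₂ d₃ d₄ v = 0) (hm : m ≠ 0)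
    (hE : !![a₁, a₂; a₃, a₄] * !![b₄, -b₂; -b₃, b₁] * !![c₁, c₂; c₃, c₄] * !![d₄, -d₂; -d₃, d₁]
      = m • !![p, q; r, t])
    (ht : (p + t) ^ 2 < 4 * (p * t - q * r)) (hnd : ¬ (p * t - q * r) ∣ (p + t) ^ 2) :
    v = 0 ∧ v' = 0 := by
  have hB' : 0 < b₄ * b₁ - (-b₂) * (-b₃) := by linarith
  have hD' : 0 < d₄ * d₁ - (-d₂) * (-d₃) := by linarith
  have e₁ : intSlash k b₄ (-b₂) (-b₃) b₁ (intSlash k a₁ a₂ a₃ a₄ v) = -v' := by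
    have := congrArg (intSlash k b₄ (-b₂) (-b₃) b₁) h₁
    rw [intSlash_add, intSlash_adj hk hB, intSlash_zero] at this
    exact eq_neg_of_add_eq_zero_left this
  have e₂ : intSlash k d₄ (-d₂) (-d₃) d₁ (intSlash k c₁ c₂ c₃ c₄ (-v')) = v := by
    have := congrArg (intSlash k d₄ (-d₂) (-d₃) d₁) h₂
    rw [intSlash_add, intSlash_adj hk hD, intSlash_zero] at this
    rw [intSlash_neg, intSlash_neg, eq_neg_of_add_eq_zero_left this, neg_neg]
  have hv0 : v = 0 := by
    rw [← e₁, intSlash_intSlash hA hB'] at e₂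
    have hAB : 0 < (a₁ * b₄ + a₂ * -b₃) * (a₃ * -b₂ + a₄ * b₁) -
        (a₁ * -b₂ + a₂ * b₁) * (a₃ * b₄ + a₄ * -b₃) := by
      have := mul_pos hA hB
      linarith
    rw [intSlash_intSlash hAB hC] at e₂
    rw [intSlash_comp hk m hm (p := p) (q := q) (r := r) (t := t)
      (by have := mul_pos hAB hC; linarith) hD' ?_ ?_ ?_ ?_] at e₂
    · exact eq_zero_of_elliptic hk0 hv hk ht hnd (s := 1) (by norm_num) (by rw [e₂, one_smul])
    · simpa [Matrix.mul_apply, Fin.sum_univ_two] using congrFun (congrFun hE 0) 0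
    · simpa [Matrix.mul_apply, Fin.sum_univ_two] using congrFun (congrFun hE 0) 1
    · simpa [Matrix.mul_apply, Fin.sum_univ_two] using congrFun (congrFun hE 1) 0
    · simpa [Matrix.mul_apply, Fin.sum_univ_two] using congrFun (congrFun hE 1) 1
  refine ⟨hv0, ?_⟩
  rw [hv0, intSlash_zero, intSlash_zero] at e₁
  exact neg_eq_zero.mp e₁.symm

/-- Holomorphic functions of even positive weight `k` that are invariant under `z ↦ z + 1` and
invariant up to sign under the Fricke involution of level `N`. -/
structure FrickeInvariant (k N : ℤ) (f : ℍ → ℂ) : Prop where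
  even : Even k
  weight_pos : 0 < k
  level_pos : 0 < N
  holo : HoloUHP f
  translate_one : intSlash k 1 1 0 1 f = f
  fricke : ∃ ε : ℂ, ε ^ 2 = 1 ∧ intSlash k 0 (-1) N 0 f = ε • f

namespace FrickeInvariant

variable {N : ℤ} {f : ℍ → ℂ} (hf : FrickeInvariant k N f)

include hf

lemma left_mul {a b c d : ℤ} (h : 0 < a * d - b * c) {s : ℂ}
    (hs : intSlash k a b c d f = s • f) {a' b' c' d' : ℤ} (h' : 0 < a' * d' - b' * c')
    (m : ℤ) {p q r t : ℤ} (hm : m ≠ 0)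
    (e₁ : a * a' + b * c' = m * p) (e₂ : a * b' + b * d' = m * q)
    (e₃ : c * a' + d * c' = m * r) (e₄ : c * b' + d * d' = m * t) :
    intSlash k p q r t f = s • intSlash k a' b' c' d' f := by
  rw [← intSlash_comp hf.even m hm h h' e₁ e₂ e₃ e₄, hs, intSlash_smul]

lemma translate (j : ℤ) : intSlash k 1 j 0 1 f = f := by
  induction j using Int.induction_on with
  | zero => exact intSlash_one f
  | succ i ih =>
    have := hf.left_mul (a := 1) (b := 1) (c := 0) (d := 1) (by norm_num) (s := 1)
      (by rw [one_smul]; exact hf.translate_one)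
      (a' := 1) (b' := i) (c' := 0) (d' := 1) (by norm_num) 1 (p := 1) (q := i + 1) (r := 0)
      (t := 1) one_ne_zero (by ring) (by ring) (by ring) (by ring)
    rw [this, ih, one_smul]
  | pred i ih =>
    have := hf.left_mul (a := 1) (b := 1) (c := 0) (d := 1) (by norm_num) (s := 1)
      (by rw [one_smul]; exact hf.translate_one)
      (a' := 1) (b' := -i - 1) (c' := 0) (d' := 1) (by norm_num) 1 (p := 1) (q := -i) (r := 0)
      (t := 1) one_ne_zero (by ring) (by ring) (by ring) (by ring)
    rw [ih, one_smul] at this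
    exact this.symm

lemma translate_left (j : ℤ) {a b c d a' b' : ℤ} (h : 0 < a * d - b * c) (ha : a' = a + j * c)
    (hb : b' = b + j * d) : intSlash k a' b' c d f = intSlash k a b c d f := by
  have := hf.left_mul (a := 1) (b := j) (c := 0) (d := 1) (by norm_num) (s := 1)
      (by rw [one_smul, hf.translate]) h 1 (p := a') (q := b') (r := c) (t := d)
      one_ne_zero (by linarith) (by linarith) (by ring) (by ring)
  rw [this, one_smul]

/-- Conjugation of slash relations by the Fricke involution. -/
lemma exists_conj : ∃ J : (ℍ → ℂ) →ₗ[ℂ] (ℍ → ℂ), J f = f ∧ ∀ a b c d : ℤ,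
    0 < a * d - b * (N * c) →
      J (intSlash k a b (N * c) d f) = intSlash k d (-c) (-(N * b)) a f := by
  obtain ⟨ε, hε, hH⟩ := hf.fricke
  have hdet : (0 : ℤ) < 0 * 0 - (-1) * N := by linarith [hf.level_pos]
  refine ⟨{ toFun := fun g => ε • intSlash k 0 (-1) N 0 g
            map_add' := fun g h => by rw [intSlash_add, smul_add]
            map_smul' := fun x g => by rw [intSlash_smul, smul_comm]; rfl }, ?_, ?_⟩
  · change ε • intSlash k 0 (-1) N 0 f = f
    rw [hH, smul_smul, ← sq, hε, one_smul]
  · intro a b c d h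
    change ε • intSlash k 0 (-1) N 0 _ = _
    rw [intSlash_intSlash h hdet]
    have := hf.left_mul hdet hH (a' := d) (b' := -c) (c' := -(N * b)) (d' := a) (by linarith) 1
      one_ne_zero (e₁ := (one_mul _).symm) (e₂ := (one_mul _).symm) (e₃ := (one_mul _).symm)
      (e₄ := (one_mul _).symm)
    have e : intSlash k (a * 0 + b * N) (a * -1 + b * 0) (N * c * 0 + d * N) (N * c * -1 + d * 0) f
        = ε • intSlash k d (-c) (-(N * b)) a f := by
      rw [← this]; congr 1 <;> ring_nf
    rw [e, smul_smul, ← sq, hε, one_smul]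

lemma translate_lower (j : ℤ) : intSlash k 1 0 (N * j) 1 f = f := by
  obtain ⟨J, hJ, hc⟩ := hf.exists_conj
  have := hc 1 (-j) 0 1 (by norm_num)
  rw [mul_zero, hf.translate, hJ] at this
  rw [neg_zero, show -(N * -j) = N * j by ring] at this
  exact this.symm

lemma translate_lower_left (j : ℤ) {a b c d c' d' : ℤ} (h : 0 < a * d - b * c)
    (hc : c' = c + N * j * a) (hd : d' = d + N * j * b) :
    intSlash k a b c' d' f = intSlash k a b c d f := by
  have := hf.left_mul (a := 1) (b := 0) (c := N * j) (d := 1) (by norm_num) (s := 1)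
      (by rw [one_smul, hf.translate_lower]) h 1 (p := a) (q := b) (r := c') (t := d')
      one_ne_zero (by ring) (by ring) (by linarith) (by linarith)
  rw [this, one_smul]

end FrickeInvariant

end Relations

section HeckeRelations

namespace FrickeInvariant

variable {k N : ℤ} {f : ℍ → ℂ}

lemma left_eq (hf : FrickeInvariant k N f) {a₁ a₂ a₃ a₄ b₁ b₂ b₃ b₄ : ℤ}
    (ha : 0 < a₁ * a₄ - a₂ * a₃) (hb : 0 < b₁ * b₄ - b₂ * b₃)
    (h : intSlash k a₁ a₂ a₃ a₄ f = intSlash k b₁ b₂ b₃ b₄ f) (x₁ x₂ x₃ x₄ : ℤ)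
    (hx : 0 < x₁ * x₄ - x₂ * x₃)
    (m : ℤ) {p₁ p₂ p₃ p₄ : ℤ} (hm : m ≠ 0) (e₁ : a₁ * x₁ + a₂ * x₃ = m * p₁)
    (e₂ : a₁ * x₂ + a₂ * x₄ = m * p₂) (e₃ : a₃ * x₁ + a₄ * x₃ = m * p₃)
    (e₄ : a₃ * x₂ + a₄ * x₄ = m * p₄)
    (n : ℤ) {q₁ q₂ q₃ q₄ : ℤ} (hn : n ≠ 0) (i₁ : b₁ * x₁ + b₂ * x₃ = n * q₁)
    (i₂ : b₁ * x₂ + b₂ * x₄ = n * q₂) (i₃ : b₃ * x₁ + b₄ * x₃ = n * q₃)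
    (i₄ : b₃ * x₂ + b₄ * x₄ = n * q₄) :
    intSlash k p₁ p₂ p₃ p₄ f = intSlash k q₁ q₂ q₃ q₄ f := by
  rw [← intSlash_comp hf.even m hm ha hx e₁ e₂ e₃ e₄, h,
    intSlash_comp hf.even n hn hb hx i₁ i₂ i₃ i₄]

/-- `F` is an eigenfunction of the Hecke operator `T₂`. -/
def HeckeTwo (k : ℤ) (f : ℍ → ℂ) : Prop :=
  ∃ l : ℂ, intSlash k 2 0 0 1 f + intSlash k 1 0 0 2 f + intSlash k 1 1 0 2 f = l • f

/-- `F` is an eigenfunction of the Hecke operator `T₃`. -/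
def HeckeThree (k : ℤ) (f : ℍ → ℂ) : Prop :=
  ∃ l : ℂ, intSlash k 3 0 0 1 f + intSlash k 1 0 0 3 f + intSlash k 1 1 0 3 f
    + intSlash k 1 2 0 3 f = l • f

/-- Equality of the contributions of `± 1 / n` to a Hecke operator and to its conjugate by
the Fricke involution. -/
def Balanced (k N n : ℤ) (f : ℍ → ℂ) : Prop :=
  intSlash k 1 1 0 n f + intSlash k 1 (-1) 0 n f = intSlash k n 0 N 1 f + intSlash k n 0 (-N) 1 f

variable (hf : FrickeInvariant k N f)

include hf

lemma half_translate (h : HeckeTwo k f) : intSlash k 1 1 0 2 f = intSlash k 2 0 (-N) 1 f := by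
  obtain ⟨l, h⟩ := h
  obtain ⟨J, hJ, hc⟩ := hf.exists_conj
  have h' := congrArg J h
  have c1 := hc 2 0 0 1 (by norm_num)
  have c2 := hc 1 0 0 2 (by norm_num)
  have c3 := hc 1 1 0 2 (by norm_num)
  simp only [mul_zero, neg_zero, mul_one] at c1 c2 c3
  rw [map_add, map_add, map_smul, hJ, c1, c2, c3] at h'
  linear_combination h - h'

lemma half_translate_neg (h : HeckeTwo k f) :
    intSlash k 1 (-1) 0 2 f = intSlash k 2 0 N 1 f := by
  rw [hf.translate_left (-1) (a := 1) (b := 1) (by norm_num) (by norm_num) (by norm_num),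
    hf.half_translate h]
  exact (hf.translate_lower_left 1 (by norm_num) (by ring) (by ring)).symm

lemma half_fixed (h : HeckeTwo k f) {n : ℤ} (hn : 2 * n = N + 1) :
    intSlash k n 1 N 2 f = f ∧ intSlash k n (-1) (-N) 2 f = f := by
  constructor
  · rw [hf.left_eq (p₁ := n) (p₂ := 1) (p₃ := N) (p₄ := 2) (q₁ := 1) (q₂ := 0) (q₃ := 0) (q₄ := 1)
      (by norm_num) (by norm_num) (hf.half_translate h) 1 0 N 2 (by norm_num) 2 two_ne_zero
      (by linarith) (by norm_num) (by ring) (by norm_num) 2 two_ne_zero (by ring) (by ring)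
      (by ring) (by ring), intSlash_one]
  · rw [hf.left_eq (p₁ := n) (p₂ := -1) (p₃ := -N) (p₄ := 2) (q₁ := 1) (q₂ := 0) (q₃ := 0)
      (q₄ := 1) (by norm_num) (by norm_num) (hf.half_translate_neg h) 1 0 (-N) 2 (by norm_num) 2
      two_ne_zero (by linarith) (by norm_num) (by ring) (by norm_num) 2 two_ne_zero (by ring)
      (by ring) (by ring) (by ring), intSlash_one]

lemma balanced_three (h : HeckeThree k f) : Balanced k N 3 f := by
  obtain ⟨l, h⟩ := h
  obtain ⟨J, hJ, hc⟩ := hf.exists_conj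
  have h' := congrArg J h
  have c1 := hc 3 0 0 1 (by norm_num)
  have c2 := hc 1 0 0 3 (by norm_num)
  have c3 := hc 1 1 0 3 (by norm_num)
  have c4 := hc 1 2 0 3 (by norm_num)
  simp only [mul_zero, neg_zero, mul_one] at c1 c2 c3 c4
  rw [map_add, map_add, map_add, map_smul, hJ, c1, c2, c3, c4,
    ← hf.translate_lower_left 1 (a := 3) (b := 0) (c := -(N * 2)) (d := 1) (c' := N) (d' := 1)
      (by norm_num) (by ring) (by ring)] at h'
  rw [← hf.translate_left (-1) (a := 1) (b := 2) (c := 0) (d := 3) (a' := 1) (b' := -1)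
    (by norm_num) (by ring) (by ring)] at h
  unfold Balanced
  linear_combination h - h'

lemma balanced_four (h : HeckeTwo k f) : Balanced k N 4 f := by
  have hr := hf.half_translate h
  obtain ⟨l, h⟩ := h
  obtain ⟨J, hJ, hc⟩ := hf.exists_conj
  have h1 := congrArg (intSlash k 1 1 0 2) h
  rw [intSlash_add, intSlash_add, intSlash_smul,
    intSlash_comp hf.even 2 (p := 1) (q := 1) (r := 0) (t := 1) (by norm_num) (by norm_num)
      (by norm_num) (by norm_num) (by norm_num) (by norm_num) (by norm_num), hf.translate,
    intSlash_comp hf.even 1 (p := 1) (q := 1) (r := 0) (t := 4) (by norm_num) (by norm_num)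
      (by norm_num) (by norm_num) (by norm_num) (by norm_num) (by norm_num),
    intSlash_comp hf.even 1 (p := 1) (q := 3) (r := 0) (t := 4) (by norm_num) (by norm_num)
      (by norm_num) (by norm_num) (by norm_num) (by norm_num) (by norm_num),
    ← hf.translate_left (-1) (a := 1) (b := 3) (c := 0) (d := 4) (a' := 1) (b' := -1)
      (by norm_num) (by norm_num) (by norm_num)] at h1
  have h' := congrArg J h1
  have c2 := hc 1 1 0 2 (by norm_num)
  have c3 := hc 1 1 0 4 (by norm_num)
  have c4 := hc 1 (-1) 0 4 (by norm_num)
  simp only [mul_zero, neg_zero, mul_one, mul_neg, neg_neg] at c2 c3 c4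
  rw [map_add, map_add, map_smul, hJ, c2, c3, c4, ← hr] at h'
  unfold Balanced
  linear_combination h1 - h'

lemma balanced_six (h₂ : HeckeTwo k f) (h : HeckeThree k f) : Balanced k N 6 f := by
  have hr := hf.half_translate h₂
  obtain ⟨l, h⟩ := h
  obtain ⟨J, hJ, hc⟩ := hf.exists_conj
  have h1 := congrArg (intSlash k 1 1 0 2) h
  rw [intSlash_add, intSlash_add, intSlash_add, intSlash_smul,
    intSlash_comp hf.even 1 (p := 3) (q := 3) (r := 0) (t := 2) (by norm_num) (by norm_num)
      (by norm_num) (by norm_num) (by norm_num) (by norm_num) (by norm_num),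
    intSlash_comp hf.even 1 (p := 1) (q := 1) (r := 0) (t := 6) (by norm_num) (by norm_num)
      (by norm_num) (by norm_num) (by norm_num) (by norm_num) (by norm_num),
    intSlash_comp hf.even 1 (p := 1) (q := 3) (r := 0) (t := 6) (by norm_num) (by norm_num)
      (by norm_num) (by norm_num) (by norm_num) (by norm_num) (by norm_num),
    intSlash_comp hf.even 1 (p := 1) (q := 5) (r := 0) (t := 6) (by norm_num) (by norm_num)
      (by norm_num) (by norm_num) (by norm_num) (by norm_num) (by norm_num),
    ← hf.translate_left (-1) (a := 1) (b := 5) (c := 0) (d := 6) (a' := 1) (b' := -1)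
      (by norm_num) (by norm_num) (by norm_num)] at h1
  have h' := congrArg J h1
  have c1 := hc 3 3 0 2 (by norm_num)
  have c2 := hc 1 1 0 2 (by norm_num)
  have c3 := hc 1 1 0 6 (by norm_num)
  have c4 := hc 1 3 0 6 (by norm_num)
  have c5 := hc 1 (-1) 0 6 (by norm_num)
  simp only [mul_zero, neg_zero, mul_one, mul_neg, neg_neg] at c1 c2 c3 c4 c5
  rw [map_add, map_add, map_add, map_smul, c1, c2, c3, c4, c5, ← hr] at h'
  have e1 : intSlash k 3 3 0 2 f = intSlash k 6 0 (-(N * 3)) 1 f := by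
    rw [hf.translate_left 1 (a := 3) (b := 1) (c := 0) (d := 2) (a' := 3) (b' := 3) (by norm_num)
      (by ring) (by ring)]
    exact hf.left_eq (by norm_num) (by norm_num) hr 3 0 0 1 (by norm_num) 1 one_ne_zero
      (by ring) (by ring) (by ring) (by ring) 1 one_ne_zero (by ring) (by ring) (by ring) (by ring)
  have e2 : intSlash k 1 3 0 6 f = intSlash k 2 0 (-(N * 3)) 3 f := by
    rw [hf.translate_lower_left (-1) (a := 2) (b := 0) (c := -N) (d := 3) (c' := -(N * 3)) (d' := 3)
      (by norm_num) (by ring) (by ring)]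
    exact hf.left_eq (by norm_num) (by norm_num) hr 1 0 0 3 (by norm_num) 1 one_ne_zero
      (by ring) (by ring) (by ring) (by ring) 1 one_ne_zero (by ring) (by ring) (by ring) (by ring)
  unfold Balanced
  linear_combination h1 - h' - e1 - e2

/-- Two balanced relations with `i j = N + 1` produce two elements of `Γ₀(N)` fixing `f`. -/
lemma fixed_of_balanced {i j : ℤ} (hij : i * j = N + 1) (hi : 0 < i) (hN : ¬ N + 1 ∣ 4)
    (hbi : Balanced k N i f) (hbj : Balanced k N j f) :
    intSlash k j 1 N i f = f ∧ intSlash k j (-1) (-N) i f = f := by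
  have hN0 := hf.level_pos
  have hj : 0 < j := by nlinarith
  have d1 : 0 < j * i - 1 * N := by linarith
  have d2 : 0 < j * i - (-1) * (-N) := by linarith
  have h₁ : intSlash k i 0 (-N) 1 (intSlash k j 1 N i f - f)
      + intSlash k i 0 N 1 (intSlash k j (-1) (-N) i f - f) = 0 := by
    rw [intSlash_sub, intSlash_sub,
      intSlash_comp hf.even 1 (p := 1) (q := 1) (r := 0) (t := i) one_ne_zero d1
        (by linarith) (by linarith) (by ring) (by ring) (by ring),
      intSlash_comp hf.even 1 (p := 1) (q := -1) (r := 0) (t := i) one_ne_zero d2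
        (by linarith) (by linarith) (by ring) (by ring) (by ring)]
    unfold Balanced at hbi
    linear_combination hbi
  have h₂ : intSlash k 1 1 0 j (intSlash k j (-1) (-N) i f - f)
      + intSlash k 1 (-1) 0 j (intSlash k j 1 N i f - f) = 0 := by
    rw [intSlash_sub, intSlash_sub,
      intSlash_comp hf.even 1 (p := j) (q := 0) (r := -N) (t := 1) one_ne_zero d2
        (by linarith) (by linarith) (by ring) (by ring) (by linarith),
      intSlash_comp hf.even 1 (p := j) (q := 0) (r := N) (t := 1) one_ne_zero d1
        (by linarith) (by linarith) (by ring) (by ring) (by linarith)]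
    unfold Balanced at hbj
    linear_combination -hbj
  have hdet : (N + 1) * (-3 * N + 1) - (2 * i) * (-2 * N * j) = (N + 1) ^ 2 := by
    linear_combination 4 * N * hij
  have := eq_zero_of_two_relations hf.even hf.weight_pos ((hf.holo.intSlash d1).sub hf.holo)
    (p := N + 1) (q := 2 * i) (r := -2 * N * j) (t := -3 * N + 1) (m := 1)
    (by linarith) (by linarith) (by linarith) (by linarith) h₁ h₂ one_ne_zero ?_ ?_ ?_
  · exact ⟨sub_eq_zero.mp this.1, sub_eq_zero.mp this.2⟩
  · ext u v
    fin_cases u <;> fin_cases v <;> simp [Matrix.mul_apply, Fin.sum_univ_two] <;>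
    first | ring1 | linear_combination hij
  · rw [hdet]
    nlinarith
  · rw [hdet, Int.pow_dvd_pow_iff two_ne_zero]
    intro hdvd
    apply hN
    have := hdvd.add (Dvd.intro_left 2 (rfl : 2 * (N + 1) = _))
    rwa [show N + 1 + (-3 * N + 1) + 2 * (N + 1) = 4 by ring] at this

end FrickeInvariant

end HeckeRelations

section LevelRelations

/-- `f` is fixed by the normalised operator `U₂`. -/
def UTwo (k : ℤ) (f : ℍ → ℂ) : Prop :=
  intSlash k 1 0 0 2 f + intSlash k 1 1 0 2 f = f

/-- `f` is fixed by the normalised operator `U₃`. -/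
def UThree (k : ℤ) (f : ℍ → ℂ) : Prop :=
  intSlash k 1 0 0 3 f + intSlash k 1 1 0 3 f + intSlash k 1 2 0 3 f = f

namespace FrickeInvariant

variable {k N : ℤ} {f : ℍ → ℂ}

lemma uTwo_conj (hf : FrickeInvariant k N f) (h : UTwo k f) :
    intSlash k 2 0 0 1 f + intSlash k 2 0 (-N) 1 f = f := by
  obtain ⟨J, hJ, hc⟩ := hf.exists_conj
  have h' := congrArg J h
  have c1 := hc 1 0 0 2 (by norm_num)
  have c2 := hc 1 1 0 2 (by norm_num)
  simp only [mul_zero, neg_zero, mul_one] at c1 c2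
  rwa [map_add, hJ, c1, c2] at h'

lemma uTwo_half (hf : FrickeInvariant k N f) (h : UTwo k f) :
    intSlash k 2 1 0 2 f = -intSlash k 2 0 (-N) 1 f := by
  have h1 := congrArg (intSlash k 2 0 0 1) h
  rw [intSlash_add,
    intSlash_comp hf.even 2 (p := 1) (q := 0) (r := 0) (t := 1) (by norm_num) (by norm_num)
      (by norm_num) (by norm_num) (by norm_num) (by norm_num) (by norm_num), intSlash_one,
    intSlash_comp hf.even 1 (p := 2) (q := 1) (r := 0) (t := 2) (by norm_num) (by norm_num)
      (by norm_num) (by norm_num) (by norm_num) (by norm_num) (by norm_num)] at h1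
  linear_combination h1 + hf.uTwo_conj h

lemma uTwo_half_neg (hf : FrickeInvariant k N f) (h : UTwo k f) :
    intSlash k 2 (-1) 0 2 f = -intSlash k 2 0 N 1 f := by
  rw [hf.translate_left (-1) (a := 2) (b := 1) (c := 0) (d := 2) (a' := 2) (b' := -1)
    (by norm_num) (by norm_num) (by norm_num), hf.uTwo_half h,
    hf.translate_lower_left 1 (a := 2) (b := 0) (c := -N) (d := 1) (c' := N) (d' := 1)
    (by norm_num) (by ring) (by ring)]

lemma uTwo_skew (hf : FrickeInvariant k N f) (h : UTwo k f) {n : ℤ} (hn : 2 * n = N + 2) :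
    intSlash k n 1 N 2 f = -f ∧ intSlash k n (-1) (-N) 2 f = -f := by
  constructor
  · have h1 := congrArg (intSlash k 1 0 N 2) (hf.uTwo_half h)
    rwa [intSlash_neg,
      intSlash_comp hf.even 2 (p := n) (q := 1) (r := N) (t := 2) (by norm_num) (by norm_num)
        (by norm_num) (by linarith) (by norm_num) (by ring) (by norm_num),
      intSlash_comp hf.even 2 (p := 1) (q := 0) (r := 0) (t := 1) (by norm_num) (by norm_num)
        (by norm_num) (by norm_num) (by norm_num) (by ring) (by norm_num), intSlash_one] at h1
  · have h1 := congrArg (intSlash k 1 0 (-N) 2) (hf.uTwo_half_neg h)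
    rwa [intSlash_neg,
      intSlash_comp hf.even 2 (p := n) (q := -1) (r := -N) (t := 2) (by norm_num) (by norm_num)
        (by norm_num) (by linarith) (by norm_num) (by ring) (by norm_num),
      intSlash_comp hf.even 2 (p := 1) (q := 0) (r := 0) (t := 1) (by norm_num) (by norm_num)
        (by norm_num) (by norm_num) (by norm_num) (by ring) (by norm_num), intSlash_one] at h1

lemma skew_fourteen (hf : FrickeInvariant k 14 f) (h : UTwo k f) :
    intSlash k 4 1 14 4 f = -f ∧ intSlash k 4 (-1) (-14) 4 f = -f := by
  have r1 : intSlash k 1 1 0 4 f + intSlash k 1 (-1) 0 4 f = intSlash k 1 1 0 2 f := by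
    have h1 := congrArg (intSlash k 1 1 0 2) h
    rwa [intSlash_add,
      intSlash_comp hf.even 1 (p := 1) (q := 1) (r := 0) (t := 4) (by norm_num) (by norm_num)
        (by norm_num) (by norm_num) (by norm_num) (by norm_num) (by norm_num),
      intSlash_comp hf.even 1 (p := 1) (q := 3) (r := 0) (t := 4) (by norm_num) (by norm_num)
        (by norm_num) (by norm_num) (by norm_num) (by norm_num) (by norm_num),
      ← hf.translate_left (-1) (a := 1) (b := 3) (c := 0) (d := 4) (a' := 1) (b' := -1)
        (by norm_num) (by norm_num) (by norm_num)] at h1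
  have r2 : intSlash k 1 1 0 2 f = -intSlash k 1 0 (-7) 1 f := by
    have h1 := congrArg (intSlash k 1 0 0 2) (hf.uTwo_half h)
    rwa [intSlash_neg,
      intSlash_comp hf.even 2 (p := 1) (q := 1) (r := 0) (t := 2) (by norm_num) (by norm_num)
        (by norm_num) (by norm_num) (by norm_num) (by norm_num) (by norm_num),
      intSlash_comp hf.even 2 (p := 1) (q := 0) (r := -7) (t := 1) (by norm_num) (by norm_num)
        (by norm_num) (by norm_num) (by norm_num) (by norm_num) (by norm_num)] at h1
  have r3 : intSlash k 2 0 (-7) 1 f + intSlash k 2 0 7 1 f = intSlash k 1 0 (-7) 1 f := by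
    have h1 := congrArg (intSlash k 1 0 (-7) 1) (hf.uTwo_conj h)
    rwa [intSlash_add,
      intSlash_comp hf.even 1 (p := 2) (q := 0) (r := -7) (t := 1) (by norm_num) (by norm_num)
        (by norm_num) (by norm_num) (by norm_num) (by norm_num) (by norm_num),
      intSlash_comp hf.even 1 (p := 2) (q := 0) (r := -21) (t := 1) (by norm_num) (by norm_num)
        (by norm_num) (by norm_num) (by norm_num) (by norm_num) (by norm_num),
      ← hf.translate_lower_left 1 (a := 2) (b := 0) (c := -21) (d := 1) (c' := 7) (d' := 1)
        (by norm_num) (by norm_num) (by norm_num)] at h1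
  have hw : intSlash k 4 1 14 4 f + f = 0 := by
    have h1 : intSlash k 2 0 (-7) 1 (intSlash k 4 1 14 4 f + f)
        + intSlash k 1 (-1) 0 4 (intSlash k 4 1 14 4 f + f) = 0 := by
      rw [intSlash_add, intSlash_add,
        intSlash_comp hf.even 1 (p := 1) (q := 1) (r := 0) (t := 4) (by norm_num) (by norm_num)
          (by norm_num) (by norm_num) (by norm_num) (by norm_num) (by norm_num),
        intSlash_comp hf.even 2 (p := 2) (q := 0) (r := 7) (t := 1) (by norm_num) (by norm_num)
          (by norm_num) (by norm_num) (by norm_num) (by norm_num) (by norm_num)]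
      linear_combination r1 + r2 + r3
    have h2 := congrArg (intSlash k 1 0 7 2) h1
    rw [intSlash_add, intSlash_zero,
      intSlash_comp hf.even 2 (p := 1) (q := 0) (r := 0) (t := 1) (by norm_num) (by norm_num)
        (by norm_num) (by norm_num) (by norm_num) (by norm_num) (by norm_num), intSlash_one,
      intSlash_comp hf.even 1 (p := -6) (q := -2) (r := 28) (t := 8) (by norm_num) (by norm_num)
        (by norm_num) (by norm_num) (by norm_num) (by norm_num) (by norm_num)] at h2
    refine eq_zero_of_elliptic hf.weight_pos ((hf.holo.intSlash (by norm_num)).add hf.holo)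
      hf.even (a := -6) (b := -2) (c := 28) (d := 8) (by norm_num) (by norm_num) (s := -1)
      (by norm_num) ?_
    rw [neg_one_smul]
    exact eq_neg_of_add_eq_zero_right h2
  have hw' := eq_neg_of_add_eq_zero_left hw
  refine ⟨hw', ?_⟩
  have h1 := congrArg (intSlash k 4 (-1) (-14) 4) hw'
  rw [intSlash_adj hf.even (by norm_num), intSlash_neg] at h1
  exact (neg_eq_iff_eq_neg.mp h1.symm)

lemma uThree_conj (hf : FrickeInvariant k N f) (h : UThree k f) :
    intSlash k 3 0 0 1 f + intSlash k 3 0 (-N) 1 f + intSlash k 3 0 (-(N * 2)) 1 f = f := by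
  obtain ⟨J, hJ, hc⟩ := hf.exists_conj
  have h' := congrArg J h
  have c1 := hc 1 0 0 3 (by norm_num)
  have c2 := hc 1 1 0 3 (by norm_num)
  have c3 := hc 1 2 0 3 (by norm_num)
  simp only [mul_zero, neg_zero, mul_one] at c1 c2 c3
  rwa [map_add, map_add, hJ, c1, c2, c3] at h'

lemma skew_fifteen (hf : FrickeInvariant k 15 f) (h₂ : HeckeTwo k f) (h : UThree k f) :
    intSlash k 6 1 15 3 f = -f ∧ intSlash k 6 (-1) (-15) 3 f = -f := by
  have hc := hf.uThree_conj h
  norm_num at hc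
  have e15 := hf.translate_lower_left 1 (a := 3) (b := 0) (c := -30) (d := 1) (c' := 15) (d' := 1)
    (by norm_num) (by norm_num) (by norm_num)
  have r1 : intSlash k 3 1 0 3 f + intSlash k 3 (-1) 0 3 f
      = -intSlash k 3 0 (-15) 1 f - intSlash k 3 0 15 1 f := by
    have h1 := congrArg (intSlash k 3 0 0 1) h
    rw [intSlash_add, intSlash_add,
      intSlash_comp hf.even 3 (p := 1) (q := 0) (r := 0) (t := 1) (by norm_num) (by norm_num)
        (by norm_num) (by norm_num) (by norm_num) (by norm_num) (by norm_num), intSlash_one,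
      intSlash_comp hf.even 1 (p := 3) (q := 1) (r := 0) (t := 3) (by norm_num) (by norm_num)
        (by norm_num) (by norm_num) (by norm_num) (by norm_num) (by norm_num),
      intSlash_comp hf.even 1 (p := 3) (q := 2) (r := 0) (t := 3) (by norm_num) (by norm_num)
        (by norm_num) (by norm_num) (by norm_num) (by norm_num) (by norm_num),
      ← hf.translate_left (-1) (a := 3) (b := 2) (c := 0) (d := 3) (a' := 3) (b' := -1)
        (by norm_num) (by norm_num) (by norm_num)] at h1
    linear_combination h1 + hc + e15
  have r2 : intSlash k 1 1 0 6 f + intSlash k 1 (-1) 0 6 f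
      = -intSlash k 2 0 5 1 f - intSlash k 2 0 (-5) 1 f := by
    have hr := hf.half_translate h₂
    have h1 := congrArg (intSlash k 1 1 0 2) h
    rw [intSlash_add, intSlash_add,
      intSlash_comp hf.even 1 (p := 1) (q := 1) (r := 0) (t := 6) (by norm_num) (by norm_num)
        (by norm_num) (by norm_num) (by norm_num) (by norm_num) (by norm_num),
      intSlash_comp hf.even 1 (p := 1) (q := 3) (r := 0) (t := 6) (by norm_num) (by norm_num)
        (by norm_num) (by norm_num) (by norm_num) (by norm_num) (by norm_num),
      intSlash_comp hf.even 1 (p := 1) (q := 5) (r := 0) (t := 6) (by norm_num) (by norm_num)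
        (by norm_num) (by norm_num) (by norm_num) (by norm_num) (by norm_num),
      ← hf.translate_left (-1) (a := 1) (b := 5) (c := 0) (d := 6) (a' := 1) (b' := -1)
        (by norm_num) (by norm_num) (by norm_num)] at h1
    have h3 := congrArg (intSlash k 1 0 0 3) hr
    rw [intSlash_comp hf.even 1 (p := 1) (q := 3) (r := 0) (t := 6) (by norm_num) (by norm_num)
        (by norm_num) (by norm_num) (by norm_num) (by norm_num) (by norm_num),
      intSlash_comp hf.even 1 (p := 2) (q := 0) (r := -15) (t := 3) (by norm_num) (by norm_num)
        (by norm_num) (by norm_num) (by norm_num) (by norm_num) (by norm_num)] at h3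
    have h4 := congrArg (intSlash k 2 0 (-15) 3) hc
    rw [intSlash_add, intSlash_add,
      intSlash_comp hf.even 3 (p := 2) (q := 0) (r := -5) (t := 1) (by norm_num) (by norm_num)
        (by norm_num) (by norm_num) (by norm_num) (by norm_num) (by norm_num),
      intSlash_comp hf.even 3 (p := 2) (q := 0) (r := -15) (t := 1) (by norm_num) (by norm_num)
        (by norm_num) (by norm_num) (by norm_num) (by norm_num) (by norm_num),
      intSlash_comp hf.even 3 (p := 2) (q := 0) (r := -25) (t := 1) (by norm_num) (by norm_num)
        (by norm_num) (by norm_num) (by norm_num) (by norm_num) (by norm_num),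
      ← hf.translate_lower_left 1 (a := 2) (b := 0) (c := -25) (d := 1) (c' := 5) (d' := 1)
        (by norm_num) (by norm_num) (by norm_num)] at h4
    linear_combination h1 + hr - h3 + h4
  have h₁ : intSlash k 3 0 (-15) 1 (intSlash k 6 1 15 3 f + f)
      + intSlash k 3 0 15 1 (intSlash k 6 (-1) (-15) 3 f + f) = 0 := by
    rw [intSlash_add, intSlash_add,
      intSlash_comp hf.even 1 (p := 3) (q := 1) (r := 0) (t := 3) (by norm_num) (by norm_num)
        (by norm_num) (by norm_num) (by norm_num) (by norm_num) (by norm_num),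
      intSlash_comp hf.even 1 (p := 3) (q := -1) (r := 0) (t := 3) (by norm_num) (by norm_num)
        (by norm_num) (by norm_num) (by norm_num) (by norm_num) (by norm_num)]
    linear_combination r1
  have h₂' : intSlash k 1 1 0 6 (intSlash k 6 (-1) (-15) 3 f + f)
      + intSlash k 1 (-1) 0 6 (intSlash k 6 1 15 3 f + f) = 0 := by
    rw [intSlash_add, intSlash_add,
      intSlash_comp hf.even 3 (p := 2) (q := 0) (r := -5) (t := 1) (by norm_num) (by norm_num)
        (by norm_num) (by norm_num) (by norm_num) (by norm_num) (by norm_num),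
      intSlash_comp hf.even 3 (p := 2) (q := 0) (r := 5) (t := 1) (by norm_num) (by norm_num)
        (by norm_num) (by norm_num) (by norm_num) (by norm_num) (by norm_num)]
    linear_combination r2
  have := eq_zero_of_two_relations hf.even hf.weight_pos
    ((hf.holo.intSlash (by norm_num)).add hf.holo)
    (p := -3) (q := -1) (r := 30) (t := 7) (m := -6)
    (by norm_num) (by norm_num) (by norm_num) (by norm_num) h₁ h₂' (by norm_num)
    (by simp) (by norm_num) (by norm_num)
  exact ⟨eq_neg_of_add_eq_zero_left this.1, eq_neg_of_add_eq_zero_left this.2⟩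

lemma fixed_twentyThree (hf : FrickeInvariant k 23 f) (h₂ : HeckeTwo k f) (h₃ : HeckeThree k f) :
    intSlash k 8 1 23 3 f = f ∧ intSlash k 8 (-1) (-23) 3 f = f := by
  obtain ⟨g1, -⟩ := hf.half_fixed h₂ (n := 12) (by norm_num)
  obtain ⟨g2, g2'⟩ := hf.fixed_of_balanced (i := 4) (j := 6) (by norm_num) (by norm_num)
    (by norm_num) (hf.balanced_four h₂) (hf.balanced_six h₂ h₃)
  have hb : Balanced k 23 3 f := hf.balanced_three h₃
  have e1 : intSlash k 13 (-2) 46 (-7) f = f := by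
    have := congrArg (intSlash k 6 (-1) (-23) 4) g2
    rwa [intSlash_comp hf.even 1 (p := 13) (q := -2) (r := 46) (t := -7) (by norm_num)
      (by norm_num) (by norm_num) (by norm_num) (by norm_num) (by norm_num) (by norm_num),
      g2'] at this
  have e2 : intSlash k 8 (-1) (-23) 3 f = intSlash k (-7) 1 69 (-10) f := by
    have g3 : intSlash k (-11) (-1) 23 2 f = f := by
      rw [hf.translate_left (-1) (a := 12) (b := 1) (c := 23) (d := 2) (a' := -11) (b' := -1)
        (by norm_num) (by norm_num) (by norm_num), g1]
    have := congrArg (intSlash k (-7) 1 69 (-10)) g3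
    rwa [intSlash_comp hf.even 1 (p := 8) (q := -1) (r := -23) (t := 3) (by norm_num)
      (by norm_num) (by norm_num) (by norm_num) (by norm_num) (by norm_num) (by norm_num)] at this
  have h₁ : intSlash k 3 0 (-23) 1 (intSlash k 8 1 23 3 f - f)
      + intSlash k 3 0 23 1 (intSlash k 8 (-1) (-23) 3 f - f) = 0 := by
    rw [intSlash_sub, intSlash_sub,
      intSlash_comp hf.even 1 (p := 1) (q := 1) (r := 0) (t := 3) (by norm_num) (by norm_num)
        (by norm_num) (by norm_num) (by norm_num) (by norm_num) (by norm_num),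
      intSlash_comp hf.even 1 (p := 1) (q := -1) (r := 0) (t := 3) (by norm_num) (by norm_num)
        (by norm_num) (by norm_num) (by norm_num) (by norm_num) (by norm_num)]
    unfold Balanced at hb
    linear_combination hb
  have h₂' : intSlash k 1 0 0 1 (intSlash k 8 (-1) (-23) 3 f - f)
      + intSlash k (-7) 1 69 (-10) (intSlash k 8 1 23 3 f - f) = 0 := by
    rw [intSlash_one, intSlash_sub,
      intSlash_comp hf.even 1 (p := 13) (q := -2) (r := 46) (t := -7) (by norm_num) (by norm_num)
        (by norm_num) (by norm_num) (by norm_num) (by norm_num) (by norm_num), e1]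
    linear_combination e2
  have := eq_zero_of_two_relations hf.even hf.weight_pos
    ((hf.holo.intSlash (by norm_num)).sub hf.holo)
    (p := -30) (q := -3) (r := 253) (t := 25) (m := 1)
    (by norm_num) (by norm_num) (by norm_num) (by norm_num) h₁ h₂' (by norm_num)
    (by simp) (by norm_num) (by norm_num)
  exact ⟨sub_eq_zero.mp this.1, sub_eq_zero.mp this.2⟩

end FrickeInvariant

end LevelRelations

/-! ### Verified coset tables -/

section CosetTables

/-- Integer matrices `a, b; c, d` as quadruples, for kernel computation. -/
structure IntMat where
  a : ℤ
  b : ℤ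
  c : ℤ
  d : ℤ

instance : DecidableEq IntMat := fun x y =>
  decidable_of_iff (x.a = y.a ∧ x.b = y.b ∧ x.c = y.c ∧ x.d = y.d) (by cases x; cases y; simp)

namespace IntMat

def mul (x y : IntMat) : IntMat :=
  ⟨x.a * y.a + x.b * y.c, x.a * y.b + x.b * y.d, x.c * y.a + x.d * y.c, x.c * y.b + x.d * y.d⟩

def adj (x : IntMat) : IntMat := ⟨x.d, -x.b, -x.c, x.a⟩

def det (x : IntMat) : ℤ := x.a * x.d - x.b * x.c

lemma det_mul (x y : IntMat) : (x.mul y).det = x.det * y.det := by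
  simp only [mul, det]; ring

lemma det_adj (x : IntMat) : x.adj.det = x.det := by
  simp only [adj, det]; ring

/-- The slash action of an `IntMat`. -/
noncomputable def slash (k : ℤ) (x : IntMat) (g : ℍ → ℂ) : ℍ → ℂ := intSlash k x.a x.b x.c x.d g

variable {k : ℤ}

lemma slash_slash {x y : IntMat} (hx : 0 < x.det) (hy : 0 < y.det) (g : ℍ → ℂ) :
    y.slash k (x.slash k g) = (x.mul y).slash k g :=
  intSlash_intSlash hx hy g

lemma slash_scale (hk : Even k) {x : IntMat} (hx : 0 < x.det) {m : ℤ} (hm : m ≠ 0) (g : ℍ → ℂ) :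
    (⟨m * x.a, m * x.b, m * x.c, m * x.d⟩ : IntMat).slash k g = x.slash k g :=
  intSlash_scale hk m hm hx g

end IntMat

/-- A matrix with two flags, recording the sign by which it acts on a function. -/
structure SignedMat where
  mat : IntMat
  fricke : Bool
  skew : Bool

namespace SignedMat

/-- The sign recorded by a `SignedMat`, if the Fricke involution acts by `ε`. -/
noncomputable def sign (ε : ℂ) (x : SignedMat) : ℂ :=
  (if x.fricke then ε else 1) * (if x.skew then -1 else 1)

def mul (x y : SignedMat) : SignedMat :=
  ⟨x.mat.mul y.mat, xor x.fricke y.fricke, xor x.skew y.skew⟩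

def adj (x : SignedMat) : SignedMat := ⟨x.mat.adj, x.fricke, x.skew⟩

lemma sign_mul {ε : ℂ} (hε : ε ^ 2 = 1) (x y : SignedMat) :
    (x.mul y).sign ε = x.sign ε * y.sign ε := by
  rw [sq] at hε
  cases h1 : x.fricke <;> cases h2 : y.fricke <;> cases h3 : x.skew <;> cases h4 : y.skew <;>
    simp [sign, mul, h1, h2, h3, h4, hε]

lemma sign_mul_self {ε : ℂ} (hε : ε ^ 2 = 1) (x : SignedMat) : x.sign ε * x.sign ε = 1 := by
  rw [sq] at hε
  cases h1 : x.fricke <;> cases h3 : x.skew <;> simp [sign, h1, h3, hε]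

/-- `x` acts on `f` by its recorded sign. -/
def Acts (k : ℤ) (ε : ℂ) (f : ℍ → ℂ) (x : SignedMat) : Prop :=
  0 < x.mat.det ∧ x.mat.slash k f = x.sign ε • f

variable {k : ℤ} {ε : ℂ} {f : ℍ → ℂ}

lemma Acts.mul (hε : ε ^ 2 = 1) {x y : SignedMat} (hx : x.Acts k ε f) (hy : y.Acts k ε f) :
    (x.mul y).Acts k ε f := by
  refine ⟨?_, ?_⟩
  · change 0 < (x.mat.mul y.mat).det
    rw [IntMat.det_mul]
    exact mul_pos hx.1 hy.1
  · change (x.mat.mul y.mat).slash k f = _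
    rw [← IntMat.slash_slash hx.1 hy.1, hx.2, IntMat.slash, intSlash_smul, ← IntMat.slash, hy.2,
      smul_smul, sign_mul hε]

lemma Acts.adj (hk : Even k) (hε : ε ^ 2 = 1) {x : SignedMat} (hx : x.Acts k ε f) :
    x.adj.Acts k ε f := by
  refine ⟨?_, ?_⟩
  · change 0 < x.mat.adj.det
    rw [IntMat.det_adj]; exact hx.1
  · have h1 : x.mat.adj.slash k (x.mat.slash k f) = f := intSlash_adj hk hx.1 f
    rw [hx.2, IntMat.slash, intSlash_smul, ← IntMat.slash] at h1
    have h2 : x.adj.mat.slash k f = x.mat.adj.slash k f := rfl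
    have h3 : x.adj.sign ε = x.sign ε := rfl
    rw [h2, h3]
    nth_rewrite 2 [← h1]
    rw [smul_smul, sign_mul_self hε, one_smul]

/-- The product of a word in generators and translations. -/
def evalWord (gens : List SignedMat) : List (ℕ × ℤ) → SignedMat
  | [] => ⟨⟨1, 0, 0, 1⟩, false, false⟩
  | (i, j) :: w =>
    (gens.getD i ⟨⟨1, 0, 0, 1⟩, false, false⟩).mul
      ((⟨⟨1, j, 0, 1⟩, false, false⟩ : SignedMat).mul (evalWord gens w))

lemma Acts.evalWord (hε : ε ^ 2 = 1) (hT : ∀ j : ℤ, intSlash k 1 j 0 1 f = f)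
    {gens : List SignedMat} (hg : ∀ g ∈ gens, g.Acts k ε f) (w : List (ℕ × ℤ)) :
    (SignedMat.evalWord gens w).Acts k ε f := by
  have h1 : ∀ j : ℤ, (⟨⟨1, j, 0, 1⟩, false, false⟩ : SignedMat).Acts k ε f := fun j =>
    ⟨by simp [IntMat.det], by simp [sign, IntMat.slash, hT]⟩
  induction w with
  | nil => exact h1 0
  | cons x w ih =>
    obtain ⟨i, j⟩ := x
    refine Acts.mul hε ?_ (Acts.mul hε (h1 j) ih)
    rw [List.getD_eq_getElem?_getD]
    cases h : gens[i]? with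
    | none => exact h1 0
    | some g => exact hg g (List.mem_of_getElem? h)

end SignedMat

/-- A coset representative, with the images of its coset under right multiplication by the
standard generators of `SL(2, ℤ)` and words in the generators witnessing this. -/
structure CosetRow where
  rep : IntMat
  imageS : ℕ
  wordS : List (ℕ × ℤ)
  imageT : ℕ
  wordT : List (ℕ × ℤ)
  wordCusp : List (ℕ × ℤ)

namespace CosetRow

/-- `w` is a word that fixes `f` and carries the representative `y` to a multiple of `x`. -/
def checkEdge (N : ℤ) (gens : List SignedMat) (x y : IntMat) (w : List (ℕ × ℤ)) : Bool :=
  let v := SignedMat.evalWord gens w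
  let u := v.mat.adj.mul (x.mul y.adj)
  !v.fricke && !v.skew && decide (u.a ≠ 0) && decide (u.b = 0) && decide (u.c = 0) &&
    decide (u.d = u.a) && decide ((x.mul y.adj).c % N = 0)

def checkImage (N : ℤ) (gens : List SignedMat) (tab : List CosetRow) (x : IntMat) (i : ℕ)
    (w : List (ℕ × ℤ)) : Bool :=
  match tab[i]? with
  | none => false
  | some y => checkEdge N gens x y.rep w

def check (N : ℤ) (gens : List SignedMat) (tab : List CosetRow) (x : CosetRow) : Bool :=
  decide (x.rep.det = 1) &&
  checkImage N gens tab (x.rep.mul ⟨0, -1, 1, 0⟩) x.imageS x.wordS &&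
  checkImage N gens tab (x.rep.mul ⟨1, 1, 0, 1⟩) x.imageT x.wordT &&
  decide (((SignedMat.evalWord gens x.wordCusp).mat.adj.mul x.rep).c = 0) &&
  (decide (x.rep.c % N ≠ 0) || decide (x.rep = ⟨1, 0, 0, 1⟩))

def checkTable (N : ℤ) (gens : List SignedMat) (tab : List CosetRow) : Bool :=
  tab.all (check N gens tab) && (tab.head?.map CosetRow.rep == some ⟨1, 0, 0, 1⟩)

end CosetRow

end CosetTables

section CosetTableSoundness

namespace IntMat

variable {k N : ℤ} {f : ℍ → ℂ}

/-- Two matrices that represent the same coset of `Γ₀(N)` and carry `f` to the same function. -/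
def Equivalent (k N : ℤ) (f : ℍ → ℂ) (x y : IntMat) : Prop :=
  x.slash k f = y.slash k f ∧ N ∣ (x.mul y.adj).c

lemma Equivalent.trans {x y z : IntMat} (hy : y.det = 1) (h : Equivalent k N f x y)
    (h' : Equivalent k N f y z) : Equivalent k N f x z := by
  refine ⟨h.1.trans h'.1, ?_⟩
  have h1 : (x.mul z.adj).c = (x.mul y.adj).c * (y.mul z.adj).a +
      (x.mul y.adj).d * (y.mul z.adj).c := by
    simp only [mul, adj, IntMat.det] at hy ⊢
    linear_combination (-x.c * z.d + x.d * z.c) * hy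
  rw [h1]
  exact dvd_add (h.2.mul_right _) (h'.2.mul_left _)

lemma Equivalent.mul_right {x y s : IntMat} (hx : x.det = 1) (hy : y.det = 1) (hs : s.det = 1)
    (h : Equivalent k N f x y) : Equivalent k N f (x.mul s) (y.mul s) := by
  refine ⟨?_, ?_⟩
  · rw [← slash_slash (by omega) (by omega), ← slash_slash (by omega) (by omega), h.1]
  · have h1 : ((x.mul s).mul (y.mul s).adj).c = (x.mul y.adj).c := by
      simp only [mul, adj, IntMat.det] at hs ⊢
      linear_combination (x.c * y.d - x.d * y.c) * hs
    rw [h1]; exact h.2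

lemma Equivalent.neg_left (hk : Even k) {x y : IntMat} (hx : x.det = 1)
    (h : Equivalent k N f x y) : Equivalent k N f ⟨-x.a, -x.b, -x.c, -x.d⟩ y := by
  refine ⟨?_, ?_⟩
  · rw [← h.1, ← slash_scale hk (show 0 < x.det by omega) (m := -1) (by norm_num)]
    simp
  · have h1 : (mul ⟨-x.a, -x.b, -x.c, -x.d⟩ y.adj).c = -(x.mul y.adj).c := by
      simp only [mul, adj]; ring
    rw [h1]; exact h.2.neg_right

/-- An element of `SL(2, ℤ)` as an `IntMat`. -/
def ofSL (σ : SpecialLinearGroup (Fin 2) ℤ) : IntMat := ⟨σ 0 0, σ 0 1, σ 1 0, σ 1 1⟩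

lemma det_ofSL (σ : SpecialLinearGroup (Fin 2) ℤ) : (ofSL σ).det = 1 := by
  have h := σ.det_coe
  rw [Matrix.det_fin_two] at h
  exact h

lemma ofSL_mul (σ τ : SpecialLinearGroup (Fin 2) ℤ) : ofSL (σ * τ) = (ofSL σ).mul (ofSL τ) := by
  simp [ofSL, mul, Matrix.mul_apply, Fin.sum_univ_two]

lemma ofSL_inv (σ : SpecialLinearGroup (Fin 2) ℤ) : ofSL σ⁻¹ = (ofSL σ).adj := by
  simp [ofSL, adj, SpecialLinearGroup.SL2_inv_expl σ]

lemma slash_ofSL (σ : SpecialLinearGroup (Fin 2) ℤ) (g : ℍ → ℂ) :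
    (ofSL σ).slash k g = _root_.slash k (sl2ToReal σ) g :=
  (slash_sl2ToReal σ g).symm

end IntMat

namespace CosetRow

open IntMat hiding det det_mul det_adj slash

variable {k N : ℤ} {ε : ℂ} {f : ℍ → ℂ} {gens : List SignedMat} {tab : List CosetRow}

lemma equivalent_of_checkEdge (hk : Even k) (hε : ε ^ 2 = 1)
    (hT : ∀ j : ℤ, intSlash k 1 j 0 1 f = f) (hg : ∀ g ∈ gens, g.Acts k ε f)
    {x y : IntMat} (hy : y.det = 1) {w : List (ℕ × ℤ)}
    (h : checkEdge N gens x y w = true) : Equivalent k N f x y := by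
  have hw := SignedMat.Acts.evalWord hε hT hg w
  simp only [checkEdge, Bool.and_eq_true, Bool.not_eq_true', decide_eq_true_eq] at h
  obtain ⟨⟨⟨⟨⟨⟨h1, h2⟩, h3⟩, h4⟩, h5⟩, h6⟩, h7⟩ := h
  set v := SignedMat.evalWord gens w
  refine ⟨?_, Int.dvd_of_emod_eq_zero h7⟩
  have hv : v.mat.slash k f = f := by simpa [SignedMat.sign, h1, h2] using hw.2
  set u := v.mat.adj.mul (x.mul y.adj) with hu
  have hux : u.det = v.mat.det * x.det := by
    rw [hu, IntMat.det_mul, IntMat.det_mul, IntMat.det_adj, IntMat.det_adj, hy, mul_one]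
  have hudet : u.det = u.a ^ 2 := by simp only [IntMat.det]; rw [h4, h5, h6]; ring
  have hx : 0 < x.det := by
    have : 0 < v.mat.det * x.det := by rw [← hux, hudet]; positivity
    exact pos_of_mul_pos_right this hw.1.le
  have key : (⟨v.mat.det * x.a, v.mat.det * x.b, v.mat.det * x.c, v.mat.det * x.d⟩ : IntMat) =
      ⟨u.a * (v.mat.mul y).a, u.a * (v.mat.mul y).b, u.a * (v.mat.mul y).c,
        u.a * (v.mat.mul y).d⟩ := by
    have e : (v.mat.mul u).mul y =
        ⟨v.mat.det * x.a, v.mat.det * x.b, v.mat.det * x.c, v.mat.det * x.d⟩ := by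
      rw [hu]
      simp only [mul, adj, IntMat.det, IntMat.mk.injEq] at hy ⊢
      refine ⟨?_, ?_, ?_, ?_⟩
      · linear_combination (v.mat.a * v.mat.d - v.mat.b * v.mat.c) * x.a * hy
      · linear_combination (v.mat.a * v.mat.d - v.mat.b * v.mat.c) * x.b * hy
      · linear_combination (v.mat.a * v.mat.d - v.mat.b * v.mat.c) * x.c * hy
      · linear_combination (v.mat.a * v.mat.d - v.mat.b * v.mat.c) * x.d * hy
    rw [← e]
    simp only [mul, IntMat.mk.injEq, h4, h5, h6]
    refine ⟨?_, ?_, ?_, ?_⟩ <;> ring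
  have hvy : 0 < (v.mat.mul y).det := by rw [IntMat.det_mul, hy, mul_one]; exact hw.1
  rw [← slash_scale hk hx hw.1.ne', key, slash_scale hk hvy h3,
    ← slash_slash hw.1 (by omega), hv]

lemma equivalent_of_checkImage (hk : Even k) (hε : ε ^ 2 = 1)
    (hT : ∀ j : ℤ, intSlash k 1 j 0 1 f = f) (hg : ∀ g ∈ gens, g.Acts k ε f)
    (ht : ∀ y ∈ tab, y.rep.det = 1) {x : IntMat} {i : ℕ} {w : List (ℕ × ℤ)}
    (h : checkImage N gens tab x i w = true) : ∃ y ∈ tab, Equivalent k N f x y.rep := by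
  unfold checkImage at h
  split at h
  · simp at h
  · rename_i y hy
    have hm := List.mem_of_getElem? hy
    exact ⟨y, hm, equivalent_of_checkEdge hk hε hT hg (ht y hm) h⟩

lemma exists_equivalent (hk : Even k) (hε : ε ^ 2 = 1)
    (hT : ∀ j : ℤ, intSlash k 1 j 0 1 f = f) (hg : ∀ g ∈ gens, g.Acts k ε f)
    (h : checkTable N gens tab = true) (σ : SpecialLinearGroup (Fin 2) ℤ) :
    ∃ y ∈ tab, Equivalent k N f (ofSL σ) y.rep := by
  simp only [checkTable, check, Bool.and_eq_true, List.all_eq_true, decide_eq_true_eq] at h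
  obtain ⟨h, h0⟩ := h
  have ht : ∀ y ∈ tab, y.rep.det = 1 := fun y hy => (h y hy).1.1.1.1
  have stepS : ∀ x : IntMat, x.det = 1 → (∃ y ∈ tab, Equivalent k N f x y.rep) →
      ∃ y ∈ tab, Equivalent k N f (x.mul ⟨0, -1, 1, 0⟩) y.rep := by
    rintro x hx ⟨y, hy, hxy⟩
    obtain ⟨z, hz, hyz⟩ := equivalent_of_checkImage hk hε hT hg ht (h y hy).1.1.1.2
    exact ⟨z, hz, (hxy.mul_right hx (ht y hy) (by simp [IntMat.det])).trans
      (by rw [IntMat.det_mul, ht y hy]; simp [IntMat.det]) hyz⟩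
  have stepT : ∀ x : IntMat, x.det = 1 → (∃ y ∈ tab, Equivalent k N f x y.rep) →
      ∃ y ∈ tab, Equivalent k N f (x.mul ⟨1, 1, 0, 1⟩) y.rep := by
    rintro x hx ⟨y, hy, hxy⟩
    obtain ⟨z, hz, hyz⟩ := equivalent_of_checkImage hk hε hT hg ht (h y hy).1.1.2
    exact ⟨z, hz, (hxy.mul_right hx (ht y hy) (by simp [IntMat.det])).trans
      (by rw [IntMat.det_mul, ht y hy]; simp [IntMat.det]) hyz⟩
  have hσ : σ ∈ Subgroup.closure {ModularGroup.S, ModularGroup.T} := by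
    rw [SpecialLinearGroup.SL2Z_generators]; trivial
  have hS : ofSL ModularGroup.S = ⟨0, -1, 1, 0⟩ := by simp [ofSL, ModularGroup.S]
  have hTT : ofSL ModularGroup.T = ⟨1, 1, 0, 1⟩ := by simp [ofSL, ModularGroup.T]
  have hSi : ofSL ModularGroup.S⁻¹ = ⟨0, 1, -1, 0⟩ := by
    rw [ofSL_inv, hS]; simp [adj]
  have hTi : ofSL ModularGroup.T⁻¹ = ⟨1, -1, 0, 1⟩ := by
    rw [ofSL_inv, hTT]; simp [adj]
  induction hσ using Subgroup.closure_induction_right with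
  | one =>
    cases tab with
    | nil => simp at h0
    | cons y t =>
      refine ⟨y, List.mem_cons_self, ?_⟩
      have : y.rep = ⟨1, 0, 0, 1⟩ := by simpa using h0
      have h1 : ofSL 1 = ⟨1, 0, 0, 1⟩ := by simp [ofSL]
      rw [this, h1]
      exact ⟨rfl, by simp [mul, adj]⟩
  | mul_right x _ y hy ih =>
    rw [ofSL_mul]
    rcases hy with rfl | rfl
    · rw [hS]; exact stepS _ (det_ofSL x) ih
    · rw [hTT]; exact stepT _ (det_ofSL x) ih
  | mul_inv_cancel x _ y hy ih =>
    rw [ofSL_mul]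
    have hd := det_ofSL x
    rcases hy with rfl | rfl
    · rw [hSi]
      obtain ⟨z, hz, hxz⟩ := stepS _ hd ih
      refine ⟨z, hz, ?_⟩
      convert hxz.neg_left hk (by rw [IntMat.det_mul, hd]; simp [IntMat.det]) using 1
      simp [mul]
    · rw [hTi]
      have e (x : IntMat) (hx : x.det = 1) : (x.mul ⟨0, -1, 1, 0⟩).det = 1 ∧
          (x.mul ⟨1, 1, 0, 1⟩).det = 1 := by
        rw [IntMat.det_mul, IntMat.det_mul, hx]; simp [IntMat.det]
      have h1 := stepS _ hd ih
      have d1 := (e _ hd).1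
      have h2 := stepT _ d1 h1
      have d2 := (e _ d1).2
      have h3 := stepS _ d2 h2
      have d3 := (e _ d2).1
      have h4 := stepT _ d3 h3
      have d4 := (e _ d3).2
      obtain ⟨z, hz, h5⟩ := stepS _ d4 h4
      refine ⟨z, hz, ?_⟩
      have d5 := (e _ d4).1
      convert h5.neg_left hk d5 using 1
      simp only [mul, IntMat.mk.injEq]; refine ⟨?_, ?_, ?_, ?_⟩ <;> ring1

/-- A verified coset table shows that `f` is invariant under `Γ₀(N)`. -/
lemma slash_eq_of_mem_Gamma0 {N : ℕ} (hk : Even k) (hε : ε ^ 2 = 1)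
    (hT : ∀ j : ℤ, intSlash k 1 j 0 1 f = f) (hg : ∀ g ∈ gens, g.Acts k ε f)
    (h : checkTable N gens tab = true) {γ : SpecialLinearGroup (Fin 2) ℤ}
    (hγ : γ ∈ CongruenceSubgroup.Gamma0 N) : _root_.slash k (sl2ToReal γ) f = f := by
  obtain ⟨y, hy, hxy, hc⟩ := exists_equivalent hk hε hT hg h γ
  simp only [checkTable, check, Bool.and_eq_true, List.all_eq_true, decide_eq_true_eq,
    Bool.or_eq_true] at h
  have hy' := h.1 y hy
  rw [CongruenceSubgroup.Gamma0_mem, ZMod.intCast_zmod_eq_zero_iff_dvd] at hγ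
  have hdet := det_ofSL γ
  have h1 : (N : ℤ) ∣ y.rep.c := by
    have e : y.rep.c = (ofSL γ).a * (γ 1 0 * y.rep.d - ((ofSL γ).mul y.rep.adj).c)
        - γ 1 0 * (ofSL γ).b * y.rep.c := by
      simp only [IntMat.det, ofSL, mul, adj] at hdet ⊢
      linear_combination (-y.rep.c) * hdet
    rw [e]
    exact dvd_sub ((dvd_sub (hγ.mul_right _) hc).mul_left _) ((hγ.mul_right _).mul_right _)
  have h2 : y.rep = ⟨1, 0, 0, 1⟩ := hy'.2.resolve_left (by
    simpa using Int.emod_eq_zero_of_dvd h1)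
  rw [← slash_ofSL, hxy, h2]
  exact hT 0

/-- A verified coset table expresses `f` at every cusp through an upper triangular matrix. -/
lemma exists_upperTriangular (hk : Even k) (hε : ε ^ 2 = 1)
    (hT : ∀ j : ℤ, intSlash k 1 j 0 1 f = f) (hg : ∀ g ∈ gens, g.Acts k ε f)
    (h : checkTable N gens tab = true) (σ : SpecialLinearGroup (Fin 2) ℤ) :
    ∃ (c : ℂ) (a b d : ℤ), 0 < a * d ∧
      _root_.slash k (sl2ToReal σ) f = c • intSlash k a b 0 d f := by
  obtain ⟨y, hy, hxy, -⟩ := exists_equivalent hk hε hT hg h σ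
  simp only [checkTable, check, Bool.and_eq_true, List.all_eq_true, decide_eq_true_eq] at h
  obtain ⟨⟨⟨⟨hdet, -⟩, -⟩, hc⟩, -⟩ := h.1 y hy
  have hw := SignedMat.Acts.evalWord hε hT hg y.wordCusp
  set v := SignedMat.evalWord gens y.wordCusp
  set u := v.mat.adj.mul y.rep with hu
  have hadj := hw.adj hk hε
  have hud : u.det = v.mat.det := by rw [hu, IntMat.det_mul, IntMat.det_adj, hdet, mul_one]
  have hud' : u.det = u.a * u.d := by simp only [IntMat.det, hc, mul_zero, sub_zero]
  refine ⟨v.sign ε, u.a, u.b, u.d, by rw [← hud', hud]; exact hw.1, ?_⟩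
  rw [← slash_ofSL, hxy]
  have h1 : v.mat.mul u =
      ⟨v.mat.det * y.rep.a, v.mat.det * y.rep.b, v.mat.det * y.rep.c, v.mat.det * y.rep.d⟩ := by
    rw [hu]
    simp only [mul, adj, IntMat.det, IntMat.mk.injEq]
    refine ⟨?_, ?_, ?_, ?_⟩ <;> ring
  rw [← slash_scale hk (by omega) hw.1.ne', ← h1,
    ← slash_slash hw.1 (by rw [hud]; exact hw.1), hw.2, IntMat.slash, intSlash_smul, hc]

end CosetRow

end CosetTableSoundness

/-! ### Coset tables for the individual levels -/

section LevelTables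

/-- A list of generators, preceded by the identity and followed by the inverses. -/
def withInverses (l : List SignedMat) : List SignedMat :=
  ⟨⟨1, 0, 0, 1⟩, false, false⟩ :: (l ++ l.map SignedMat.adj)

def generatorsFive : List SignedMat :=
  [⟨⟨0, -1, 5, 0⟩, true, false⟩, ⟨⟨3, 1, 5, 2⟩, false, false⟩, ⟨⟨3, -1, -5, 2⟩, false, false⟩]

def cosetsFive : List CosetRow :=
  [⟨⟨1, 0, 0, 1⟩, 1, [], 0, [(0, 1)], []⟩,
   ⟨⟨0, -1, 1, 0⟩, 0, [], 2, [], [(1, 0)]⟩,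
   ⟨⟨0, -1, 1, 1⟩, 5, [(0, -1), (4, -1), (4, 0)], 3, [], [(1, 0)]⟩,
   ⟨⟨0, -1, 1, 2⟩, 3, [(5, 1)], 4, [], [(1, 0)]⟩,
   ⟨⟨0, -1, 1, 3⟩, 4, [(4, 1), (4, 1), (5, 1)], 5, [], [(1, 0)]⟩,
   ⟨⟨0, -1, 1, 4⟩, 2, [(4, 1), (4, 1)], 1, [(4, 1), (4, 0)], [(1, 0)]⟩]

lemma checkTable_five :
    CosetRow.checkTable 5 (withInverses generatorsFive) cosetsFive = true := by
  decide +kernel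

def generatorsSix : List SignedMat :=
  [⟨⟨0, -1, 6, 0⟩, true, false⟩, ⟨⟨4, 1, 6, 2⟩, false, true⟩, ⟨⟨4, -1, -6, 2⟩, false, true⟩]

def cosetsSix : List CosetRow :=
  [⟨⟨1, 0, 0, 1⟩, 1, [], 0, [(0, 1)], []⟩,
   ⟨⟨0, -1, 1, 0⟩, 0, [], 2, [], [(1, 0)]⟩,
   ⟨⟨0, -1, 1, 1⟩, 6, [(0, -1), (4, -1), (4, 0)], 3, [], [(1, 0)]⟩,
   ⟨⟨0, -1, 1, 2⟩, 9, [(5, 1), (6, -1)], 4, [], [(1, 0)]⟩,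
   ⟨⟨0, -1, 1, 3⟩, 10, [(4, 1), (4, 0)], 5, [], [(1, 0)]⟩,
   ⟨⟨0, -1, 1, 4⟩, 7, [(4, 1), (4, 0)], 6, [], [(1, 0)]⟩,
   ⟨⟨0, -1, 1, 5⟩, 2, [(4, 1), (4, 1)], 1, [(4, 1), (4, 0)], [(1, 0)]⟩,
   ⟨⟨1, 0, 2, 1⟩, 5, [(4, -1), (4, 0)], 8, [], [(2, 0), (1, 0)]⟩,
   ⟨⟨1, 1, 2, 3⟩, 11, [(6, -2), (6, -1)], 9, [], [(2, 0), (1, 0)]⟩,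
   ⟨⟨1, 2, 2, 5⟩, 3, [(6, -1), (5, 1)], 7, [(6, -1), (5, 0)], [(2, 0), (1, 0)]⟩,
   ⟨⟨1, 0, 3, 1⟩, 4, [(4, -1), (4, 0)], 11, [], [(0, 1), (3, 0)]⟩,
   ⟨⟨1, 1, 3, 4⟩, 8, [(6, 0), (6, -1)], 10, [(6, 0), (6, -1)], [(0, 1), (3, 0)]⟩]

lemma checkTable_six :
    CosetRow.checkTable 6 (withInverses generatorsSix) cosetsSix = true := by
  decide +kernel

def generatorsSeven : List SignedMat :=
  [⟨⟨0, -1, 7, 0⟩, true, false⟩, ⟨⟨4, 1, 7, 2⟩, false, false⟩, ⟨⟨4, -1, -7, 2⟩, false, false⟩]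

def cosetsSeven : List CosetRow :=
  [⟨⟨1, 0, 0, 1⟩, 1, [], 0, [(0, 1)], []⟩,
   ⟨⟨0, -1, 1, 0⟩, 0, [], 2, [], [(1, 0)]⟩,
   ⟨⟨0, -1, 1, 1⟩, 7, [(0, -1), (4, -1), (4, 0)], 3, [], [(1, 0)]⟩,
   ⟨⟨0, -1, 1, 2⟩, 4, [(0, -1), (2, 0)], 4, [], [(1, 0)]⟩,
   ⟨⟨0, -1, 1, 3⟩, 3, [(5, 1)], 5, [], [(1, 0)]⟩,
   ⟨⟨0, -1, 1, 4⟩, 6, [(4, 0), (2, -1), (4, 0)], 6, [], [(1, 0)]⟩,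
   ⟨⟨0, -1, 1, 5⟩, 5, [(4, 1), (4, 0), (2, 0)], 7, [], [(1, 0)]⟩,
   ⟨⟨0, -1, 1, 6⟩, 2, [(4, 1), (4, 1)], 1, [(4, 1), (4, 0)], [(1, 0)]⟩]

lemma checkTable_seven :
    CosetRow.checkTable 7 (withInverses generatorsSeven) cosetsSeven = true := by
  decide +kernel

def generatorsEight : List SignedMat :=
  [⟨⟨0, -1, 8, 0⟩, true, false⟩, ⟨⟨2, 1, 0, 2⟩, false, true⟩]

def cosetsEight : List CosetRow :=
  [⟨⟨1, 0, 0, 1⟩, 1, [], 0, [(0, 1)], []⟩,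
   ⟨⟨0, -1, 1, 0⟩, 0, [], 2, [], [(1, 0)]⟩,
   ⟨⟨0, -1, 1, 1⟩, 8, [(0, -1), (3, -1), (3, 0)], 3, [], [(1, 0)]⟩,
   ⟨⟨0, -1, 1, 2⟩, 10, [(0, -1), (2, 0), (3, -1), (3, 0), (4, 0)], 4, [], [(1, 0)]⟩,
   ⟨⟨0, -1, 1, 3⟩, 6, [(3, 0), (4, 1), (3, 1), (3, 0), (4, 0), (3, 0)], 5, [], [(1, 0)]⟩,
   ⟨⟨0, -1, 1, 4⟩, 11, [(3, 1), (3, 0)], 6, [], [(1, 0)]⟩,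
   ⟨⟨0, -1, 1, 5⟩, 4, [(0, -1), (2, 0), (3, 0), (4, 0), (3, -1), (3, 0), (4, 1), (3, 0), (4, 1)],
      7, [], [(1, 0)]⟩,
   ⟨⟨0, -1, 1, 6⟩, 9, [(3, 1), (3, 0)], 8, [], [(1, 0)]⟩,
   ⟨⟨0, -1, 1, 7⟩, 2, [(3, 1), (3, 1)], 1, [(3, 1), (3, 0)], [(1, 0)]⟩,
   ⟨⟨1, 0, 2, 1⟩, 7, [(3, -1), (3, 0)], 10, [], [(2, 0), (1, 0)]⟩,
   ⟨⟨1, 1, 2, 3⟩, 3, [(2, 0), (3, 1), (3, 0), (4, 1)], 9, [(2, 0), (3, 1), (3, 0), (4, 0)], [(2,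
      0), (1, 0)]⟩,
   ⟨⟨1, 0, 4, 1⟩, 5, [(3, -1), (3, 0)], 11, [(2, 0), (3, 0), (4, 1), (3, 1), (3, 0), (4, 0), (3,
      0), (4, 0)], [(1, -1), (2, 0), (1, 0)]⟩]

lemma checkTable_eight :
    CosetRow.checkTable 8 (withInverses generatorsEight) cosetsEight = true := by
  decide +kernel

def generatorsTen : List SignedMat :=
  [⟨⟨0, -1, 10, 0⟩, true, false⟩, ⟨⟨6, 1, 10, 2⟩, false, true⟩, ⟨⟨6, -1, -10, 2⟩, false, true⟩]

def cosetsTen : List CosetRow :=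
  [⟨⟨1, 0, 0, 1⟩, 1, [], 0, [(0, 1)], []⟩,
   ⟨⟨0, -1, 1, 0⟩, 0, [], 2, [], [(1, 0)]⟩,
   ⟨⟨0, -1, 1, 1⟩, 10, [(0, -1), (4, -1), (4, 0)], 3, [], [(1, 0)]⟩,
   ⟨⟨0, -1, 1, 2⟩, 15, [(0, -1), (2, 0), (6, -1)], 4, [], [(1, 0)]⟩,
   ⟨⟨0, -1, 1, 3⟩, 4, [(5, 1), (5, 1)], 5, [], [(1, 0)]⟩,
   ⟨⟨0, -1, 1, 4⟩, 14, [(5, 1), (6, -1)], 6, [], [(1, 0)]⟩,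
   ⟨⟨0, -1, 1, 5⟩, 16, [(4, 1), (4, 0)], 7, [], [(1, 0)]⟩,
   ⟨⟨0, -1, 1, 6⟩, 12, [(5, 0), (6, -1)], 8, [], [(1, 0)]⟩,
   ⟨⟨0, -1, 1, 7⟩, 8, [(4, 1), (4, 1), (3, 0), (2, 0)], 9, [], [(1, 0)]⟩,
   ⟨⟨0, -1, 1, 8⟩, 11, [(4, 1), (4, 0)], 10, [], [(1, 0)]⟩,
   ⟨⟨0, -1, 1, 9⟩, 2, [(4, 1), (4, 1)], 1, [(4, 1), (4, 0)], [(1, 0)]⟩,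
   ⟨⟨1, 0, 2, 1⟩, 9, [(4, -1), (4, 0)], 12, [], [(2, 0), (1, 0)]⟩,
   ⟨⟨1, 1, 2, 3⟩, 7, [(0, 1), (3, 0), (2, 0)], 13, [], [(2, 0), (1, 0)]⟩,
   ⟨⟨1, 2, 2, 5⟩, 17, [(0, 1), (3, 0), (3, 0)], 14, [], [(2, 0), (1, 0)]⟩,
   ⟨⟨1, 3, 2, 7⟩, 5, [(0, 1), (3, -1), (2, 0)], 15, [], [(2, 0), (1, 0)]⟩,
   ⟨⟨1, 4, 2, 9⟩, 3, [(0, 1), (3, 0), (5, 1)], 11, [(0, 1), (3, 0), (5, 0)], [(2, 0), (1, 0)]⟩,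
   ⟨⟨1, 0, 5, 1⟩, 6, [(4, -1), (4, 0)], 17, [], [(6, 0)]⟩,
   ⟨⟨1, 1, 5, 6⟩, 13, [(6, 0), (6, -1)], 16, [(6, 1), (3, 0)], [(6, 0)]⟩]

lemma checkTable_ten :
    CosetRow.checkTable 10 (withInverses generatorsTen) cosetsTen = true := by
  decide +kernel

def generatorsEleven : List SignedMat :=
  [⟨⟨0, -1, 11, 0⟩, true, false⟩, ⟨⟨6, 1, 11, 2⟩, false, false⟩, ⟨⟨6, -1, -11, 2⟩, false, false⟩,
    ⟨⟨4, 1, 11, 3⟩, false, false⟩, ⟨⟨4, -1, -11, 3⟩, false, false⟩]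

def cosetsEleven : List CosetRow :=
  [⟨⟨1, 0, 0, 1⟩, 1, [], 0, [(0, 1)], []⟩,
   ⟨⟨0, -1, 1, 0⟩, 0, [], 2, [], [(1, 0)]⟩,
   ⟨⟨0, -1, 1, 1⟩, 11, [(0, -1), (6, -1), (6, 0)], 3, [], [(1, 0)]⟩,
   ⟨⟨0, -1, 1, 2⟩, 6, [(0, -1), (2, 0)], 4, [], [(1, 0)]⟩,
   ⟨⟨0, -1, 1, 3⟩, 8, [(6, 0), (10, -1), (6, 0)], 5, [], [(1, 0)]⟩,
   ⟨⟨0, -1, 1, 4⟩, 9, [(6, 0), (4, -1), (6, 0)], 6, [], [(1, 0)]⟩,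
   ⟨⟨0, -1, 1, 5⟩, 3, [(7, 1)], 7, [], [(1, 0)]⟩,
   ⟨⟨0, -1, 1, 6⟩, 10, [(6, 0), (2, -1), (6, 0)], 8, [], [(1, 0)]⟩,
   ⟨⟨0, -1, 1, 7⟩, 4, [(7, 0), (4, 0)], 9, [], [(1, 0)]⟩,
   ⟨⟨0, -1, 1, 8⟩, 5, [(6, 1), (6, 0), (4, 0)], 10, [], [(1, 0)]⟩,
   ⟨⟨0, -1, 1, 9⟩, 7, [(6, 1), (6, 0), (2, 0)], 11, [], [(1, 0)]⟩,
   ⟨⟨0, -1, 1, 10⟩, 2, [(6, 1), (6, 1)], 1, [(6, 1), (6, 0)], [(1, 0)]⟩]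

lemma checkTable_eleven :
    CosetRow.checkTable 11 (withInverses generatorsEleven) cosetsEleven = true := by
  decide +kernel

def generatorsTwelve : List SignedMat :=
  [⟨⟨0, -1, 12, 0⟩, true, false⟩, ⟨⟨2, 1, 0, 2⟩, false, true⟩]

def cosetsTwelve : List CosetRow :=
  [⟨⟨1, 0, 0, 1⟩, 1, [], 0, [(0, 1)], []⟩,
   ⟨⟨0, -1, 1, 0⟩, 0, [], 2, [], [(1, 0)]⟩,
   ⟨⟨0, -1, 1, 1⟩, 12, [(0, -1), (3, -1), (3, 0)], 3, [], [(1, 0)]⟩,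
   ⟨⟨0, -1, 1, 2⟩, 15, [(0, -1), (2, 0), (3, -1), (3, 0), (4, 0)], 4, [], [(1, 0)]⟩,
   ⟨⟨0, -1, 1, 3⟩, 18, [(0, -1), (2, 0), (3, 0), (4, 0), (3, -1), (3, 0), (4, 0), (3, 0), (4,
      0)], 5, [], [(1, 0)]⟩,
   ⟨⟨0, -1, 1, 4⟩, 21, [(3, 0), (4, 1), (3, 1), (3, 0), (4, 1), (3, 0)], 6, [], [(1, 0)]⟩,
   ⟨⟨0, -1, 1, 5⟩, 8, [(3, 0), (4, 1), (3, 1), (3, 0), (4, 0), (3, 0)], 7, [], [(1, 0)]⟩,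
   ⟨⟨0, -1, 1, 6⟩, 23, [(3, 1), (3, 0)], 8, [], [(1, 0)]⟩,
   ⟨⟨0, -1, 1, 7⟩, 6, [(3, 0), (4, 1), (3, -1), (3, 0), (4, 0), (3, 0)], 9, [], [(1, 0)]⟩,
   ⟨⟨0, -1, 1, 8⟩, 20, [(3, 1), (3, 0)], 10, [], [(1, 0)]⟩,
   ⟨⟨0, -1, 1, 9⟩, 16, [(3, 1), (3, 0)], 11, [], [(1, 0)]⟩,
   ⟨⟨0, -1, 1, 10⟩, 13, [(3, 1), (3, 0)], 12, [], [(1, 0)]⟩,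
   ⟨⟨0, -1, 1, 11⟩, 2, [(3, 1), (3, 1)], 1, [(3, 1), (3, 0)], [(1, 0)]⟩,
   ⟨⟨1, 0, 2, 1⟩, 11, [(3, -1), (3, 0)], 14, [], [(2, 0), (1, 0)]⟩,
   ⟨⟨1, 1, 2, 3⟩, 19, [(2, 0), (3, 0), (4, 1), (3, -1), (3, 0), (4, 0), (3, 0), (4, 0)], 15, [],
      [(2, 0), (1, 0)]⟩,
   ⟨⟨1, 2, 2, 5⟩, 3, [(2, 0), (3, 1), (3, 0), (4, 1)], 13, [(2, 0), (3, 1), (3, 0), (4, 0)], [(2,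
      0), (1, 0)]⟩,
   ⟨⟨1, 0, 3, 1⟩, 10, [(3, -1), (3, 0)], 17, [], [(2, 0), (1, 0), (2, 0), (1, 0)]⟩,
   ⟨⟨1, 1, 3, 4⟩, 22, [(3, 0), (4, 0), (3, 0), (4, 0), (3, -1), (3, 0), (4, 1), (3, 0), (4, 1),
      (3, 0)], 18, [], [(2, 0), (1, 0), (2, 0), (1, 0)]⟩,
   ⟨⟨1, 2, 3, 7⟩, 4, [(2, 0), (3, 0), (4, 1), (3, 1), (3, 0), (4, 1), (3, 0), (4, 1)], 19, [],
      [(2, 0), (1, 0), (2, 0), (1, 0)]⟩,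
   ⟨⟨1, 3, 3, 10⟩, 14, [(2, 0), (3, 0), (4, 1), (3, 1), (3, 0), (4, 0), (3, 0), (4, 0)], 16, [(2,
      0), (3, 0), (4, 1), (3, 1), (3, 0), (4, 0), (3, 0), (4, 0)], [(2, 0), (1, 0), (2, 0), (1,
      0)]⟩,
   ⟨⟨1, 0, 4, 1⟩, 9, [(3, -1), (3, 0)], 21, [], [(1, -1), (2, 0), (1, -1), (2, 0), (1, 0)]⟩,
   ⟨⟨1, 1, 4, 5⟩, 5, [(3, 0), (4, 0), (3, -1), (3, 0), (4, 0), (3, 0)], 22, [], [(1, -1), (2, 0),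
      (1, -1), (2, 0), (1, 0)]⟩,
   ⟨⟨1, 2, 4, 9⟩, 17, [(2, 0), (3, 0), (4, 1), (3, 0), (4, 1), (3, 1), (3, 0), (4, 0), (3, 0),
      (4, 0), (3, 0), (4, 0)], 20, [(2, 0), (3, 0), (4, 1), (3, 0), (4, 1), (3, 1), (3, 0), (4,
      0), (3, 0), (4, 0), (3, 0), (4, 0)], [(1, -1), (2, 0), (1, -1), (2, 0), (1, 0)]⟩,
   ⟨⟨1, 0, 6, 1⟩, 7, [(3, -1), (3, 0)], 23, [(3, 0), (4, 0), (3, 1), (3, 0), (4, 1), (3, 0)],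
      [(1, -1), (2, 0), (1, 0)]⟩]

lemma checkTable_twelve :
    CosetRow.checkTable 12 (withInverses generatorsTwelve) cosetsTwelve = true := by
  decide +kernel

def generatorsFourteen : List SignedMat :=
  [⟨⟨0, -1, 14, 0⟩, true, false⟩, ⟨⟨8, 1, 14, 2⟩, false, true⟩, ⟨⟨8, -1, -14, 2⟩, false, true⟩,
    ⟨⟨4, 1, 14, 4⟩, false, true⟩, ⟨⟨4, -1, -14, 4⟩, false, true⟩]

def cosetsFourteen : List CosetRow :=
  [⟨⟨1, 0, 0, 1⟩, 1, [], 0, [(0, 1)], []⟩,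
   ⟨⟨0, -1, 1, 0⟩, 0, [], 2, [], [(1, 0)]⟩,
   ⟨⟨0, -1, 1, 1⟩, 14, [(0, -1), (6, -1), (6, 0)], 3, [], [(1, 0)]⟩,
   ⟨⟨0, -1, 1, 2⟩, 21, [(0, -1), (2, 0), (8, -1)], 4, [], [(1, 0)]⟩,
   ⟨⟨0, -1, 1, 3⟩, 10, [(9, 0), (2, 0)], 5, [], [(1, 0)]⟩,
   ⟨⟨0, -1, 1, 4⟩, 16, [(9, 0), (8, -1)], 6, [], [(1, 0)]⟩,
   ⟨⟨0, -1, 1, 5⟩, 12, [(6, 0), (4, -1), (2, -1), (6, 0)], 7, [], [(1, 0)]⟩,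
   ⟨⟨0, -1, 1, 6⟩, 19, [(7, 1), (8, -1)], 8, [], [(1, 0)]⟩,
   ⟨⟨0, -1, 1, 7⟩, 22, [(6, 1), (6, 0)], 9, [], [(1, 0)]⟩,
   ⟨⟨0, -1, 1, 8⟩, 17, [(7, 0), (8, -1)], 10, [], [(1, 0)]⟩,
   ⟨⟨0, -1, 1, 9⟩, 4, [(7, 0), (4, 0)], 11, [], [(1, 0)]⟩,
   ⟨⟨0, -1, 1, 10⟩, 20, [(6, 1), (6, 0), (4, 0), (8, -1)], 12, [], [(1, 0)]⟩,
   ⟨⟨0, -1, 1, 11⟩, 6, [(6, 1), (6, 0), (4, -1), (2, 0)], 13, [], [(1, 0)]⟩,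
   ⟨⟨0, -1, 1, 12⟩, 15, [(6, 1), (6, 0)], 14, [], [(1, 0)]⟩,
   ⟨⟨0, -1, 1, 13⟩, 2, [(6, 1), (6, 1)], 1, [(6, 1), (6, 0)], [(1, 0)]⟩,
   ⟨⟨1, 0, 2, 1⟩, 13, [(6, -1), (6, 0)], 16, [], [(2, 0), (1, 0)]⟩,
   ⟨⟨1, 1, 2, 3⟩, 5, [(4, -1), (2, 0)], 17, [], [(2, 0), (1, 0)]⟩,
   ⟨⟨1, 2, 2, 5⟩, 9, [(0, 1), (3, 0), (2, 0)], 18, [], [(2, 0), (1, 0)]⟩,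
   ⟨⟨1, 3, 2, 7⟩, 23, [(0, 1), (3, 0), (3, 0)], 19, [], [(2, 0), (1, 0)]⟩,
   ⟨⟨1, 4, 2, 9⟩, 7, [(0, 1), (3, -1), (2, 0)], 20, [], [(2, 0), (1, 0)]⟩,
   ⟨⟨1, 5, 2, 11⟩, 11, [(6, 0), (7, 1), (4, -1), (6, 0)], 21, [], [(2, 0), (1, 0)]⟩,
   ⟨⟨1, 6, 2, 13⟩, 3, [(0, 1), (3, 0), (7, 1)], 15, [(0, 1), (3, 0), (7, 0)], [(2, 0), (1, 0)]⟩,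
   ⟨⟨1, 0, 7, 1⟩, 8, [(6, -1), (6, 0)], 23, [], [(8, 0)]⟩,
   ⟨⟨1, 1, 7, 8⟩, 18, [(8, 0), (8, -1)], 22, [(8, 1), (3, 0)], [(8, 0)]⟩]

lemma checkTable_fourteen :
    CosetRow.checkTable 14 (withInverses generatorsFourteen) cosetsFourteen = true := by
  decide +kernel

def generatorsFifteen : List SignedMat :=
  [⟨⟨0, -1, 15, 0⟩, true, false⟩, ⟨⟨8, 1, 15, 2⟩, false, false⟩, ⟨⟨8, -1, -15, 2⟩, false, false⟩,
    ⟨⟨6, 1, 15, 3⟩, false, true⟩, ⟨⟨6, -1, -15, 3⟩, false, true⟩]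

def cosetsFifteen : List CosetRow :=
  [⟨⟨1, 0, 0, 1⟩, 1, [], 0, [(0, 1)], []⟩,
   ⟨⟨0, -1, 1, 0⟩, 0, [], 2, [], [(1, 0)]⟩,
   ⟨⟨0, -1, 1, 1⟩, 15, [(0, -1), (6, -1), (6, 0)], 3, [], [(1, 0)]⟩,
   ⟨⟨0, -1, 1, 2⟩, 8, [(0, -1), (2, 0)], 4, [], [(1, 0)]⟩,
   ⟨⟨0, -1, 1, 3⟩, 17, [(9, 1), (5, 0)], 5, [], [(1, 0)]⟩,
   ⟨⟨0, -1, 1, 4⟩, 12, [(6, 0), (10, -1), (4, -1), (6, 0)], 6, [], [(1, 0)]⟩,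
   ⟨⟨0, -1, 1, 5⟩, 23, [(9, 0), (5, 0)], 7, [], [(1, 0)]⟩,
   ⟨⟨0, -1, 1, 6⟩, 18, [(9, 0), (8, 0), (5, 0)], 8, [], [(1, 0)]⟩,
   ⟨⟨0, -1, 1, 7⟩, 3, [(7, 1)], 9, [], [(1, 0)]⟩,
   ⟨⟨0, -1, 1, 8⟩, 14, [(6, 0), (2, -1), (6, 0)], 10, [], [(1, 0)]⟩,
   ⟨⟨0, -1, 1, 9⟩, 20, [(6, 1), (5, -1), (6, 0), (9, 0)], 11, [], [(1, 0)]⟩,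
   ⟨⟨0, -1, 1, 10⟩, 21, [(6, 1), (6, 0)], 12, [], [(1, 0)]⟩,
   ⟨⟨0, -1, 1, 11⟩, 5, [(7, 0), (4, -1), (4, 0)], 13, [], [(1, 0)]⟩,
   ⟨⟨0, -1, 1, 12⟩, 16, [(6, 1), (6, 0)], 14, [], [(1, 0)]⟩,
   ⟨⟨0, -1, 1, 13⟩, 9, [(6, 1), (6, 0), (2, 0)], 15, [], [(1, 0)]⟩,
   ⟨⟨0, -1, 1, 14⟩, 2, [(6, 1), (6, 1)], 1, [(6, 1), (6, 0)], [(1, 0)]⟩,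
   ⟨⟨1, 0, 3, 1⟩, 13, [(6, -1), (6, 0)], 17, [], [(4, 0), (1, 0)]⟩,
   ⟨⟨1, 1, 3, 4⟩, 4, [(10, -1), (4, 0)], 18, [], [(4, 0), (1, 0)]⟩,
   ⟨⟨1, 2, 3, 7⟩, 7, [(10, -1), (4, -1), (2, 0)], 19, [], [(4, 0), (1, 0)]⟩,
   ⟨⟨1, 3, 3, 10⟩, 22, [(6, 0), (9, 1), (6, 0), (5, 0)], 20, [], [(4, 0), (1, 0)]⟩,
   ⟨⟨1, 4, 3, 13⟩, 10, [(6, 0), (9, 1), (6, 0), (9, 0), (2, 0)], 16, [(6, 0), (9, 1), (6, 0), (9,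
      0)], [(4, 0), (1, 0)]⟩,
   ⟨⟨1, 0, 5, 1⟩, 11, [(6, -1), (6, 0)], 22, [], [(10, 0)]⟩,
   ⟨⟨1, 1, 5, 6⟩, 19, [(6, 0), (5, -1), (6, 0), (9, 0)], 23, [], [(10, 0)]⟩,
   ⟨⟨1, 2, 5, 11⟩, 6, [(10, 0), (4, 0)], 21, [(10, 1), (5, 0)], [(10, 0)]⟩]

lemma checkTable_fifteen :
    CosetRow.checkTable 15 (withInverses generatorsFifteen) cosetsFifteen = true := by
  decide +kernel

def generatorsSeventeen : List SignedMat :=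
  [⟨⟨0, -1, 17, 0⟩, true, false⟩, ⟨⟨9, 1, 17, 2⟩, false, false⟩, ⟨⟨9, -1, -17, 2⟩, false, false⟩,
    ⟨⟨6, 1, 17, 3⟩, false, false⟩, ⟨⟨6, -1, -17, 3⟩, false, false⟩]

def cosetsSeventeen : List CosetRow :=
  [⟨⟨1, 0, 0, 1⟩, 1, [], 0, [(0, 1)], []⟩,
   ⟨⟨0, -1, 1, 0⟩, 0, [], 2, [], [(1, 0)]⟩,
   ⟨⟨0, -1, 1, 1⟩, 17, [(0, -1), (6, -1), (6, 0)], 3, [], [(1, 0)]⟩,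
   ⟨⟨0, -1, 1, 2⟩, 9, [(0, -1), (2, 0)], 4, [], [(1, 0)]⟩,
   ⟨⟨0, -1, 1, 3⟩, 12, [(6, 0), (10, -1), (6, 0)], 5, [], [(1, 0)]⟩,
   ⟨⟨0, -1, 1, 4⟩, 5, [(0, 0), (5, 0), (8, -1), (4, 0)], 6, [], [(1, 0)]⟩,
   ⟨⟨0, -1, 1, 5⟩, 11, [(9, 0), (2, 0)], 7, [], [(1, 0)]⟩,
   ⟨⟨0, -1, 1, 6⟩, 15, [(6, 0), (4, -1), (6, 0)], 8, [], [(1, 0)]⟩,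
   ⟨⟨0, -1, 1, 7⟩, 13, [(7, 1), (5, 0), (1, -1), (1, 0)], 9, [], [(1, 0)]⟩,
   ⟨⟨0, -1, 1, 8⟩, 3, [(7, 1)], 10, [], [(1, 0)]⟩,
   ⟨⟨0, -1, 1, 9⟩, 16, [(6, 0), (2, -1), (6, 0)], 11, [], [(1, 0)]⟩,
   ⟨⟨0, -1, 1, 10⟩, 6, [(7, 0), (4, 0)], 12, [], [(1, 0)]⟩,
   ⟨⟨0, -1, 1, 11⟩, 4, [(6, 1), (6, 0), (10, 0)], 13, [], [(1, 0)]⟩,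
   ⟨⟨0, -1, 1, 12⟩, 8, [(6, 1), (6, 0), (10, -1), (2, 0)], 14, [], [(1, 0)]⟩,
   ⟨⟨0, -1, 1, 13⟩, 14, [(6, 1), (5, 0), (8, -1), (4, -1), (6, 0)], 15, [], [(1, 0)]⟩,
   ⟨⟨0, -1, 1, 14⟩, 7, [(6, 1), (6, 0), (4, 0)], 16, [], [(1, 0)]⟩,
   ⟨⟨0, -1, 1, 15⟩, 10, [(6, 1), (6, 0), (2, 0)], 17, [], [(1, 0)]⟩,
   ⟨⟨0, -1, 1, 16⟩, 2, [(6, 1), (6, 1)], 1, [(6, 1), (6, 0)], [(1, 0)]⟩]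

lemma checkTable_seventeen :
    CosetRow.checkTable 17 (withInverses generatorsSeventeen) cosetsSeventeen = true := by
  decide +kernel

def generatorsTwentyThree : List SignedMat :=
  [⟨⟨0, -1, 23, 0⟩, true, false⟩, ⟨⟨12, 1, 23, 2⟩, false, false⟩, ⟨⟨12, -1, -23, 2⟩, false,
    false⟩, ⟨⟨6, 1, 23, 4⟩, false, false⟩, ⟨⟨6, -1, -23, 4⟩, false, false⟩, ⟨⟨8, 1, 23, 3⟩, false,
    false⟩, ⟨⟨8, -1, -23, 3⟩, false, false⟩]

def cosetsTwentyThree : List CosetRow :=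
  [⟨⟨1, 0, 0, 1⟩, 1, [], 0, [(0, 1)], []⟩,
   ⟨⟨0, -1, 1, 0⟩, 0, [], 2, [], [(1, 0)]⟩,
   ⟨⟨0, -1, 1, 1⟩, 23, [(0, -1), (8, -1), (8, 0)], 3, [], [(1, 0)]⟩,
   ⟨⟨0, -1, 1, 2⟩, 12, [(0, -1), (2, 0)], 4, [], [(1, 0)]⟩,
   ⟨⟨0, -1, 1, 3⟩, 16, [(8, 0), (14, -1), (8, 0)], 5, [], [(1, 0)]⟩,
   ⟨⟨0, -1, 1, 4⟩, 18, [(8, 0), (12, -1), (8, 0)], 6, [], [(1, 0)]⟩,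
   ⟨⟨0, -1, 1, 5⟩, 10, [(0, 0), (11, 0), (6, 0)], 7, [], [(1, 0)]⟩,
   ⟨⟨0, -1, 1, 6⟩, 20, [(8, 0), (4, -1), (8, 0)], 8, [], [(1, 0)]⟩,
   ⟨⟨0, -1, 1, 7⟩, 14, [(13, 0), (2, 0)], 9, [], [(1, 0)]⟩,
   ⟨⟨0, -1, 1, 8⟩, 21, [(8, 0), (6, -1), (8, 0)], 10, [], [(1, 0)]⟩,
   ⟨⟨0, -1, 1, 9⟩, 6, [(13, 0), (4, 0)], 11, [], [(1, 0)]⟩,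
   ⟨⟨0, -1, 1, 10⟩, 17, [(8, 0), (6, 0), (11, 0), (12, -1), (8, 0)], 12, [], [(1, 0)]⟩,
   ⟨⟨0, -1, 1, 11⟩, 3, [(9, 1)], 13, [], [(1, 0)]⟩,
   ⟨⟨0, -1, 1, 12⟩, 22, [(8, 0), (2, -1), (8, 0)], 14, [], [(1, 0)]⟩,
   ⟨⟨0, -1, 1, 13⟩, 8, [(9, 0), (6, 0)], 15, [], [(1, 0)]⟩,
   ⟨⟨0, -1, 1, 14⟩, 19, [(8, 0), (2, 0), (13, 0), (4, -1), (8, 0)], 16, [], [(1, 0)]⟩,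
   ⟨⟨0, -1, 1, 15⟩, 4, [(8, 1), (8, 0), (14, 0)], 17, [], [(1, 0)]⟩,
   ⟨⟨0, -1, 1, 16⟩, 11, [(8, 1), (8, 0), (14, -1), (2, 0)], 18, [], [(1, 0)]⟩,
   ⟨⟨0, -1, 1, 17⟩, 5, [(8, 1), (8, 0), (12, 0)], 19, [], [(1, 0)]⟩,
   ⟨⟨0, -1, 1, 18⟩, 15, [(8, 1), (5, 0), (14, -1), (8, 0)], 20, [], [(1, 0)]⟩,
   ⟨⟨0, -1, 1, 19⟩, 7, [(8, 1), (8, 0), (4, 0)], 21, [], [(1, 0)]⟩,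
   ⟨⟨0, -1, 1, 20⟩, 9, [(8, 1), (8, 0), (6, 0)], 22, [], [(1, 0)]⟩,
   ⟨⟨0, -1, 1, 21⟩, 13, [(8, 1), (8, 0), (2, 0)], 23, [], [(1, 0)]⟩,
   ⟨⟨0, -1, 1, 22⟩, 2, [(8, 1), (8, 1)], 1, [(8, 1), (8, 0)], [(1, 0)]⟩]

lemma checkTable_twentyThree :
    CosetRow.checkTable 23 (withInverses generatorsTwentyThree) cosetsTwentyThree = true := by
  decide +kernel

end LevelTables

section ModularForms

variable {k : ℤ} {f : ℍ → ℂ}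

lemma acts_fricke {N : ℤ} {ε : ℂ} (hN : 0 < N) (h : intSlash k 0 (-1) N 0 f = ε • f) :
    SignedMat.Acts k ε f ⟨⟨0, -1, N, 0⟩, true, false⟩ :=
  ⟨by simpa [IntMat.det] using hN, by simpa [SignedMat.sign, IntMat.slash] using h⟩

lemma acts_fixed {ε : ℂ} {a b c d : ℤ} (hd : 0 < a * d - b * c)
    (h : intSlash k a b c d f = f) : SignedMat.Acts k ε f ⟨⟨a, b, c, d⟩, false, false⟩ :=
  ⟨hd, by simpa [SignedMat.sign, IntMat.slash] using h⟩

lemma acts_skew {ε : ℂ} {a b c d : ℤ} (hd : 0 < a * d - b * c)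
    (h : intSlash k a b c d f = -f) : SignedMat.Acts k ε f ⟨⟨a, b, c, d⟩, false, true⟩ :=
  ⟨hd, by simpa [SignedMat.sign, IntMat.slash] using h⟩

lemma acts_withInverses (hk : Even k) {ε : ℂ} (hε : ε ^ 2 = 1) {gens : List SignedMat}
    (h : ∀ g ∈ gens, g.Acts k ε f) : ∀ g ∈ withInverses gens, g.Acts k ε f := by
  intro g hg
  simp only [withInverses, List.mem_cons, List.mem_append, List.mem_map] at hg
  rcases hg with rfl | hg | ⟨g, hg, rfl⟩
  · exact acts_fixed (by norm_num) (intSlash_one f)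
  · exact h g hg
  · exact (h g hg).adj hk hε

/-- For each of the levels considered there is a verified coset table all of whose generators act
on `f` by a sign. -/
lemma FrickeInvariant.exists_cosetTable {N : ℕ}
    (hN : N ∈ ({5, 6, 7, 8, 10, 11, 12, 14, 15, 17, 23} : Set ℕ))
    (hf : FrickeInvariant k N f)
    (h₂ : ¬ 2 ∣ N → HeckeTwo k f) (h₃ : ¬ 3 ∣ N → HeckeThree k f)
    (u₂ : 2 ∣ N → ¬ 2 ^ 2 ∣ N → UTwo k f) (u₃ : 3 ∣ N → ¬ 3 ^ 2 ∣ N → UThree k f)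
    (s₂ : 2 ^ 2 ∣ N → intSlash k 2 1 0 2 f = -f) :
    ∃ (ε : ℂ) (gens : List SignedMat) (tab : List CosetRow), ε ^ 2 = 1 ∧
      CosetRow.checkTable N gens tab = true ∧ ∀ g ∈ gens, g.Acts k ε f := by
  obtain ⟨ε, hε, hH⟩ := hf.fricke
  have aH := acts_fricke hf.level_pos hH
  simp only [Set.mem_insert_iff, Set.mem_singleton_iff] at hN
  rcases hN with rfl | rfl | rfl | rfl | rfl | rfl | rfl | rfl | rfl | rfl | rfl
  · obtain ⟨g₁, g₂⟩ := hf.half_fixed (h₂ (by norm_num)) (n := 3) (by norm_num)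
    refine ⟨ε, _, _, hε, checkTable_five, acts_withInverses hf.even hε ?_⟩
    simp only [generatorsFive, List.forall_mem_cons]
    exact ⟨aH, acts_fixed (by norm_num) g₁, acts_fixed (by norm_num) g₂, by simp⟩
  · obtain ⟨g₁, g₂⟩ := hf.uTwo_skew (u₂ (by norm_num) (by norm_num)) (n := 4) (by norm_num)
    refine ⟨ε, _, _, hε, checkTable_six, acts_withInverses hf.even hε ?_⟩
    simp only [generatorsSix, List.forall_mem_cons]
    exact ⟨aH, acts_skew (by norm_num) g₁, acts_skew (by norm_num) g₂, by simp⟩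
  · obtain ⟨g₁, g₂⟩ := hf.half_fixed (h₂ (by norm_num)) (n := 4) (by norm_num)
    refine ⟨ε, _, _, hε, checkTable_seven, acts_withInverses hf.even hε ?_⟩
    simp only [generatorsSeven, List.forall_mem_cons]
    exact ⟨aH, acts_fixed (by norm_num) g₁, acts_fixed (by norm_num) g₂, by simp⟩
  · refine ⟨ε, _, _, hε, checkTable_eight, acts_withInverses hf.even hε ?_⟩
    simp only [generatorsEight, List.forall_mem_cons]
    exact ⟨aH, acts_skew (by norm_num) (s₂ (by norm_num)), by simp⟩
  · obtain ⟨g₁, g₂⟩ := hf.uTwo_skew (u₂ (by norm_num) (by norm_num)) (n := 6) (by norm_num)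
    refine ⟨ε, _, _, hε, checkTable_ten, acts_withInverses hf.even hε ?_⟩
    simp only [generatorsTen, List.forall_mem_cons]
    exact ⟨aH, acts_skew (by norm_num) g₁, acts_skew (by norm_num) g₂, by simp⟩
  · have h₃' := h₃ (by norm_num)
    have h₂' := h₂ (by norm_num)
    obtain ⟨g₁, g₂⟩ := hf.half_fixed h₂' (n := 6) (by norm_num)
    obtain ⟨g₃, g₄⟩ := hf.fixed_of_balanced (i := 3) (j := 4) (by norm_num) (by norm_num)
      (by norm_num) (hf.balanced_three h₃') (hf.balanced_four h₂')
    refine ⟨ε, _, _, hε, checkTable_eleven, acts_withInverses hf.even hε ?_⟩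
    simp only [generatorsEleven, List.forall_mem_cons]
    exact ⟨aH, acts_fixed (by norm_num) g₁, acts_fixed (by norm_num) g₂,
      acts_fixed (by norm_num) g₃, acts_fixed (by norm_num) g₄, by simp⟩
  · refine ⟨ε, _, _, hε, checkTable_twelve, acts_withInverses hf.even hε ?_⟩
    simp only [generatorsTwelve, List.forall_mem_cons]
    exact ⟨aH, acts_skew (by norm_num) (s₂ (by norm_num)), by simp⟩
  · have h := u₂ (by norm_num) (by norm_num)
    obtain ⟨g₁, g₂⟩ := hf.uTwo_skew h (n := 8) (by norm_num)
    obtain ⟨g₃, g₄⟩ := hf.skew_fourteen h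
    refine ⟨ε, _, _, hε, checkTable_fourteen, acts_withInverses hf.even hε ?_⟩
    simp only [generatorsFourteen, List.forall_mem_cons]
    exact ⟨aH, acts_skew (by norm_num) g₁, acts_skew (by norm_num) g₂,
      acts_skew (by norm_num) g₃, acts_skew (by norm_num) g₄, by simp⟩
  · have h₂' := h₂ (by norm_num)
    obtain ⟨g₁, g₂⟩ := hf.half_fixed h₂' (n := 8) (by norm_num)
    obtain ⟨g₃, g₄⟩ := hf.skew_fifteen h₂' (u₃ (by norm_num) (by norm_num))
    refine ⟨ε, _, _, hε, checkTable_fifteen, acts_withInverses hf.even hε ?_⟩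
    simp only [generatorsFifteen, List.forall_mem_cons]
    exact ⟨aH, acts_fixed (by norm_num) g₁, acts_fixed (by norm_num) g₂,
      acts_skew (by norm_num) g₃, acts_skew (by norm_num) g₄, by simp⟩
  · have h₃' := h₃ (by norm_num)
    have h₂' := h₂ (by norm_num)
    obtain ⟨g₁, g₂⟩ := hf.half_fixed h₂' (n := 9) (by norm_num)
    obtain ⟨g₃, g₄⟩ := hf.fixed_of_balanced (i := 3) (j := 6) (by norm_num) (by norm_num)
      (by norm_num) (hf.balanced_three h₃') (hf.balanced_six h₂' h₃')
    refine ⟨ε, _, _, hε, checkTable_seventeen, acts_withInverses hf.even hε ?_⟩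
    simp only [generatorsSeventeen, List.forall_mem_cons]
    exact ⟨aH, acts_fixed (by norm_num) g₁, acts_fixed (by norm_num) g₂,
      acts_fixed (by norm_num) g₃, acts_fixed (by norm_num) g₄, by simp⟩
  · have h₃' := h₃ (by norm_num)
    have h₂' := h₂ (by norm_num)
    obtain ⟨g₁, g₂⟩ := hf.half_fixed h₂' (n := 12) (by norm_num)
    obtain ⟨g₃, g₄⟩ := hf.fixed_of_balanced (i := 4) (j := 6) (by norm_num) (by norm_num)
      (by norm_num) (hf.balanced_four h₂') (hf.balanced_six h₂' h₃')
    obtain ⟨g₅, g₆⟩ := hf.fixed_twentyThree h₂' h₃'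
    refine ⟨ε, _, _, hε, checkTable_twentyThree, acts_withInverses hf.even hε ?_⟩
    simp only [generatorsTwentyThree, List.forall_mem_cons]
    exact ⟨aH, acts_fixed (by norm_num) g₁, acts_fixed (by norm_num) g₂,
      acts_fixed (by norm_num) g₃, acts_fixed (by norm_num) g₄,
      acts_fixed (by norm_num) g₅, acts_fixed (by norm_num) g₆, by simp⟩

lemma tendsto_intSlash_upperTriangular (hf : Tendsto f atImInfty (𝓝 0)) {a b d : ℤ}
    (h : 0 < a * d) : Tendsto (intSlash k a b 0 d f) atImInfty (𝓝 0) := by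
  have hdet := det_int_pos (a := a) (b := b) (c := 0) (d := d) (by simpa using h)
  have hd : (d : ℝ) ≠ 0 := by
    rintro e
    rw [Int.cast_eq_zero] at e
    simp [e] at h
  have hpos : (0 : ℝ) < a / d := by
    have : (0 : ℝ) < a * d := by exact_mod_cast h
    rw [show (a : ℝ) / d = a * d / (d * d) by field_simp]
    exact div_pos this (mul_self_pos.2 hd)
  have him (z : ℍ) : (glAct !![(a : ℝ), (b : ℝ); ((0 : ℤ) : ℝ), (d : ℝ)] z).im =
      a / d * z.im := by
    have e : (glAct !![(a : ℝ), (b : ℝ); ((0 : ℤ) : ℝ), (d : ℝ)] z : ℂ) =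
        ((a / d : ℝ) : ℂ) * z + ((b / d : ℝ) : ℂ) := by
      rw [coe_glAct hdet]
      have hd' : (d : ℂ) ≠ 0 := by exact_mod_cast hd
      simp
      field_simp
    rw [← UpperHalfPlane.coe_im, e, Complex.add_im, Complex.ofReal_im, Complex.im_ofReal_mul,
      add_zero]
    rfl
  have ht : Tendsto (fun z : ℍ => glAct !![(a : ℝ), (b : ℝ); ((0 : ℤ) : ℝ), (d : ℝ)] z)
      atImInfty atImInfty := by
    refine tendsto_comap_iff.2 ?_
    have : UpperHalfPlane.im ∘ (fun z : ℍ =>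
        glAct !![(a : ℝ), (b : ℝ); ((0 : ℤ) : ℝ), (d : ℝ)] z) = fun z : ℍ => (a / d : ℝ) * z.im :=
      funext him
    rw [this]
    exact tendsto_comap.const_mul_atTop hpos
  have h1 := (hf.comp ht).const_mul (((a * d - b * 0 : ℤ) : ℂ) ^ (k / 2) * (d : ℂ) ^ (-k))
  rw [mul_zero (_ * _)] at h1
  refine h1.congr fun z => ?_
  rw [intSlash_apply]
  simp

/-- At the levels considered, the relations satisfied by a Hecke eigenform with the Fricke
functional equation imply that it is a cusp form. -/
lemma FrickeInvariant.cuspForm {N : ℕ}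
    (hN : N ∈ ({5, 6, 7, 8, 10, 11, 12, 14, 15, 17, 23} : Set ℕ))
    (hf : FrickeInvariant k N f)
    (h₂ : ¬ 2 ∣ N → HeckeTwo k f) (h₃ : ¬ 3 ∣ N → HeckeThree k f)
    (u₂ : 2 ∣ N → ¬ 2 ^ 2 ∣ N → UTwo k f) (u₃ : 3 ∣ N → ¬ 3 ^ 2 ∣ N → UThree k f)
    (s₂ : 2 ^ 2 ∣ N → intSlash k 2 1 0 2 f = -f) (hcusp : Tendsto f atImInfty (𝓝 0)) :
    (∀ γ ∈ CongruenceSubgroup.Gamma0 N, slash k (sl2ToReal γ) f = f) ∧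
    ∀ σ : SpecialLinearGroup (Fin 2) ℤ, Tendsto (slash k (sl2ToReal σ) f) atImInfty (𝓝 0) := by
  obtain ⟨ε, gens, tab, hε, htab, hg⟩ := hf.exists_cosetTable hN h₂ h₃ u₂ u₃ s₂
  refine ⟨fun γ hγ => CosetRow.slash_eq_of_mem_Gamma0 hf.even hε hf.translate hg htab hγ,
    fun σ => ?_⟩
  obtain ⟨c, a, b, d, had, e⟩ :=
    CosetRow.exists_upperTriangular hf.even hε hf.translate hg htab σ
  rw [e]
  have := (tendsto_intSlash_upperTriangular (k := k) (b := b) hcusp had).const_smul c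
  rwa [smul_zero] at this

end ModularForms

section FourierSeries

variable {a : ℕ → ℂ} {C : ℝ}

lemma exists_coeff_bound (h : (fun n : ℕ => a n) =O[atTop] fun n : ℕ => (n : ℝ) ^ C) :
    ∃ K : ℝ, 0 < K ∧ ∀ n : ℕ, ‖a (n + 1)‖ ≤ K * ((n : ℝ) + 1) ^ C := by
  have h1 : (fun n : ℕ => a (n + 1)) =O[atTop] fun n : ℕ => ((n : ℝ) + 1) ^ C := by
    have := h.comp_tendsto (tendsto_add_atTop_nat 1)
    simpa [Function.comp_def] using this
  obtain ⟨K, hK, hb⟩ := Asymptotics.bound_of_isBigO_nat_atTop h1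
  refine ⟨K, hK, fun n => ?_⟩
  have hp : (0 : ℝ) < ((n : ℝ) + 1) ^ C := Real.rpow_pos_of_pos (by positivity) _
  have := hb (x := n) hp.ne'
  rwa [Real.norm_of_nonneg hp.le] at this

lemma summable_one_div_nat_succ_sq : Summable fun n : ℕ => 1 / ((n : ℝ) + 1) ^ 2 := by
  have := (summable_nat_add_iff 1).2 (Real.summable_one_div_nat_pow.2 one_lt_two)
  simpa using this

lemma exists_fourier_term_bound (h : (fun n : ℕ => a n) =O[atTop] fun n : ℕ => (n : ℝ) ^ C) :
    ∃ (M : ℕ) (B : ℝ), 0 ≤ B ∧ ∀ y : ℝ, 0 < y → ∀ n : ℕ,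
      ‖a (n + 1)‖ * Real.exp (-(2 * Real.pi * (n + 1) * y)) ≤
        B * (Real.exp (-(Real.pi * y)) / y ^ M) * (1 / ((n : ℝ) + 1) ^ 2) := by
  obtain ⟨K, hK, hb⟩ := exists_coeff_bound h
  obtain ⟨M, hM⟩ := exists_nat_ge (C + 2)
  refine ⟨M, K * (M.factorial / Real.pi ^ M), by positivity, fun y hy n => ?_⟩
  have hn : (0 : ℝ) < (n : ℝ) + 1 := by positivity
  have hpi := Real.pi_pos
  have e1 : Real.exp (-(2 * Real.pi * (n + 1) * y)) ≤
      Real.exp (-(Real.pi * y)) * Real.exp (-(Real.pi * (n + 1) * y)) := by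
    rw [← Real.exp_add]
    refine Real.exp_le_exp.2 ?_
    have : 0 ≤ Real.pi * n * y := by positivity
    nlinarith
  have e2 : Real.exp (-(Real.pi * (n + 1) * y)) ≤ M.factorial / (Real.pi * (n + 1) * y) ^ M := by
    have hx : 0 < Real.pi * (n + 1) * y := by positivity
    rw [Real.exp_neg, inv_eq_one_div, div_le_div_iff₀ (Real.exp_pos _) (by positivity), one_mul]
    have := Real.pow_div_factorial_le_exp _ hx.le M
    rw [div_le_iff₀ (by positivity)] at this
    linarith
  have e3 : ((n : ℝ) + 1) ^ C ≤ ((n : ℝ) + 1) ^ M / ((n : ℝ) + 1) ^ 2 := by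
    rw [le_div_iff₀ (by positivity), ← Real.rpow_natCast, ← Real.rpow_natCast,
      ← Real.rpow_add hn]
    exact Real.rpow_le_rpow_of_exponent_le (by linarith) (by exact_mod_cast hM)
  calc ‖a (n + 1)‖ * Real.exp (-(2 * Real.pi * (n + 1) * y))
      ≤ (K * (((n : ℝ) + 1) ^ M / ((n : ℝ) + 1) ^ 2)) * (Real.exp (-(Real.pi * y)) *
          (M.factorial / (Real.pi * (n + 1) * y) ^ M)) := by
        gcongr
        · exact (hb n).trans (by gcongr)
        · exact e1.trans (by gcongr)
    _ = _ := by
        rw [mul_pow, mul_pow]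
        field_simp

lemma norm_fourier_term (n : ℕ) (z : ℂ) :
    ‖a (n + 1) * Complex.exp (2 * (Real.pi : ℂ) * Complex.I * ((n : ℂ) + 1) * z)‖ =
      ‖a (n + 1)‖ * Real.exp (-(2 * Real.pi * (n + 1) * z.im)) := by
  rw [norm_mul, Complex.norm_exp]
  congr 2
  have : (2 * (Real.pi : ℂ) * Complex.I * ((n : ℂ) + 1) * z) =
      ((2 * Real.pi * (n + 1) : ℝ) : ℂ) * (Complex.I * z) := by push_cast; ring
  rw [this, Complex.re_ofReal_mul]
  simp

lemma summable_norm_fourier (h : (fun n : ℕ => a n) =O[atTop] fun n : ℕ => (n : ℝ) ^ C)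
    {z : ℂ} (hz : 0 < z.im) : Summable fun n : ℕ =>
      ‖a (n + 1) * Complex.exp (2 * (Real.pi : ℂ) * Complex.I * ((n : ℂ) + 1) * z)‖ := by
  obtain ⟨M, B, hB, hb⟩ := exists_fourier_term_bound h
  refine Summable.of_nonneg_of_le (fun n => norm_nonneg _) (fun n => ?_)
    (summable_one_div_nat_succ_sq.mul_left (B * (Real.exp (-(Real.pi * z.im)) / z.im ^ M)))
  rw [norm_fourier_term]
  exact hb _ hz n

lemma exists_fourierSeries_bound
    (h : (fun n : ℕ => a n) =O[atTop] fun n : ℕ => (n : ℝ) ^ C) :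
    ∃ (M : ℕ) (B : ℝ), 0 ≤ B ∧ ∀ z : ℍ,
      ‖fourierSeries a z‖ ≤ B * (Real.exp (-(Real.pi * z.im)) / z.im ^ M) := by
  obtain ⟨M, B, hB, hb⟩ := exists_fourier_term_bound h
  refine ⟨M, B * ∑' n : ℕ, 1 / ((n : ℝ) + 1) ^ 2,
    mul_nonneg hB (tsum_nonneg fun n => by positivity),
    fun z => ?_⟩
  have hs := (summable_one_div_nat_succ_sq.mul_left
    (B * (Real.exp (-(Real.pi * z.im)) / z.im ^ M))).hasSum
  refine (tsum_of_norm_bounded hs fun n => ?_).trans_eq ?_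
  · rw [norm_fourier_term]
    exact hb _ z.im_pos n
  · rw [tsum_mul_left]; ring

lemma holoUHP_fourierSeries (h : (fun n : ℕ => a n) =O[atTop] fun n : ℕ => (n : ℝ) ^ C) :
    HoloUHP (fourierSeries a) := by
  have h1 : DifferentiableOn ℂ (fun z : ℂ => ∑' n : ℕ, a (n + 1) *
      Complex.exp (2 * (Real.pi : ℂ) * Complex.I * ((n : ℂ) + 1) * z)) {z | 0 < z.im} := by
    intro z hz
    simp only [Set.mem_ofPred_eq] at hz
    have hz2 : 0 < ((z.im / 2 : ℝ) * Complex.I : ℂ).im := by simpa using hz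
    have hopen : IsOpen {w : ℂ | z.im / 2 < w.im} := isOpen_lt continuous_const continuous_im
    have hd := differentiableOn_tsum_of_summable_norm (U := {w : ℂ | z.im / 2 < w.im})
      (F := fun (n : ℕ) (w : ℂ) => a (n + 1) *
        Complex.exp (2 * (Real.pi : ℂ) * Complex.I * ((n : ℂ) + 1) * w))
      (summable_norm_fourier h hz2) (fun n => by fun_prop) hopen (fun n w hw => by
        rw [norm_fourier_term, norm_fourier_term]
        simp only [Set.mem_ofPred_eq] at hw
        have : ((z.im / 2 : ℝ) * Complex.I : ℂ).im = z.im / 2 := by simp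
        rw [this]
        have hpi := Real.pi_pos
        gcongr)
    exact (hd.differentiableAt (hopen.mem_nhds (by simp only [Set.mem_ofPred_eq]; linarith))
      ).differentiableWithinAt
  refine h1.congr fun z hz => ?_
  simp only [Function.comp_apply, ofComplex_apply_of_im_pos hz, fourierSeries]

lemma tendsto_fourierSeries (h : (fun n : ℕ => a n) =O[atTop] fun n : ℕ => (n : ℝ) ^ C) :
    Tendsto (fourierSeries a) atImInfty (𝓝 0) := by
  obtain ⟨M, B, hB, hb⟩ := exists_fourierSeries_bound h
  have h1 : Tendsto (fun y : ℝ => B * (Real.exp (-(Real.pi * y)) / y ^ M)) atTop (𝓝 0) := by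
    have e1 : Tendsto (fun y : ℝ => Real.exp (-(Real.pi * y))) atTop (𝓝 0) :=
      Real.tendsto_exp_neg_atTop_nhds_zero.comp (tendsto_id.const_mul_atTop Real.pi_pos)
    rw [← mul_zero B]
    refine Tendsto.const_mul B ?_
    refine squeeze_zero' ?_ ?_ e1
    · filter_upwards [eventually_gt_atTop 0] with y hy using by positivity
    · filter_upwards [eventually_ge_atTop 1] with y hy
      exact div_le_self (Real.exp_pos _).le (one_le_pow₀ hy)
  exact squeeze_zero_norm hb (h1.comp tendsto_comap)

lemma fourierSeries_translate (k : ℤ) : intSlash k 1 1 0 1 (fourierSeries a) = fourierSeries a := by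
  funext z
  rw [intSlash_apply]
  have hdet := det_int_pos (a := 1) (b := 1) (c := 0) (d := 1) (by norm_num)
  simp only [fourierSeries, coe_glAct hdet]
  simp
  congr 1
  funext n
  congr 1
  rw [Complex.exp_eq_exp_iff_exists_int]
  exact ⟨n + 1, by push_cast; ring⟩

end FourierSeries

section ContourShift

open MeasureTheory

lemma integrable_vertical {g : ℂ → ℂ} (hg : Differentiable ℂ g) {α M : ℝ}
    (hb : ∀ s : ℂ, s.re = α → ‖g s‖ ≤ M / (1 + s.im ^ 2)) :
    Integrable fun t : ℝ => g (α + t * Complex.I) := by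
  have h1 : Continuous fun t : ℝ => g (α + t * Complex.I) :=
    hg.continuous.comp (by fun_prop)
  refine (integrable_inv_one_add_sq.const_mul M).mono' h1.aestronglyMeasurable ?_
  refine Eventually.of_forall fun t => ?_
  simpa [div_eq_mul_inv] using hb (α + t * Complex.I) (by simp)

/-- Shifting a vertical line of integration. -/
lemma integral_vertical_eq {g : ℂ → ℂ} (hg : Differentiable ℂ g) {α β M : ℝ} (hαβ : α ≤ β)
    (hb : ∀ s : ℂ, α ≤ s.re → s.re ≤ β → ‖g s‖ ≤ M / (1 + s.im ^ 2)) :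
    ∫ t : ℝ, g (α + t * Complex.I) = ∫ t : ℝ, g (β + t * Complex.I) := by
  have iα := integrable_vertical hg (fun s hs => hb s hs.ge (hs.le.trans hαβ))
  have iβ := integrable_vertical hg (fun s hs => hb s (hαβ.trans hs.ge) hs.le)
  have tα := intervalIntegral_tendsto_integral iα tendsto_neg_atTop_atBot tendsto_id
  have tβ := intervalIntegral_tendsto_integral iβ tendsto_neg_atTop_atBot tendsto_id
  have hrect (T : ℝ) : (∫ x : ℝ in α..β, g (x + (-T : ℝ) * Complex.I)) -
      (∫ x : ℝ in α..β, g (x + (T : ℝ) * Complex.I)) +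
      Complex.I • (∫ t : ℝ in (-T)..T, g (β + t * Complex.I)) -
      Complex.I • (∫ t : ℝ in (-T)..T, g (α + t * Complex.I)) = 0 := by
    have := Complex.integral_boundary_rect_eq_zero_of_differentiableOn g
      (α + (-T : ℝ) * Complex.I) (β + T * Complex.I) hg.differentiableOn
    simpa using this
  have hM : Tendsto (fun T : ℝ => M / (1 + T ^ 2) * |β - α|) atTop (𝓝 0) := by
    have h1 : Tendsto (fun T : ℝ => 1 + T ^ 2) atTop atTop :=
      tendsto_atTop_add_const_left _ _ (tendsto_pow_atTop two_ne_zero)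
    simpa using (h1.const_div_atTop M).mul_const |β - α|
  have hor (T : ℝ) : ‖∫ x : ℝ in α..β, g (x + T * Complex.I)‖ ≤ M / (1 + T ^ 2) * |β - α| := by
    refine intervalIntegral.norm_integral_le_of_norm_le_const fun x hx => ?_
    rw [Set.uIoc_of_le hαβ] at hx
    simpa using hb (x + T * Complex.I) (by simpa using hx.1.le) (by simpa using hx.2)
  have h1 : Tendsto (fun T : ℝ => ∫ x : ℝ in α..β, g (x + T * Complex.I)) atTop (𝓝 0) :=
    squeeze_zero_norm hor hM
  have h2 : Tendsto (fun T : ℝ => ∫ x : ℝ in α..β, g (x + (-T : ℝ) * Complex.I)) atTop (𝓝 0) :=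
    squeeze_zero_norm (fun T => by simpa using hor (-T)) hM
  have h3 := ((h2.sub h1).add (tβ.const_smul Complex.I)).sub (tα.const_smul Complex.I)
  have h4 := tendsto_nhds_unique h3
    ((tendsto_const_nhds (x := (0 : ℂ))).congr fun T => (hrect T).symm)
  have h5 : Complex.I * ((∫ t : ℝ, g (β + t * Complex.I)) -
      ∫ t : ℝ, g (α + t * Complex.I)) = 0 := by
    simp only [smul_eq_mul] at h4
    linear_combination h4
  exact (sub_eq_zero.1 ((mul_eq_zero.1 h5).resolve_left Complex.I_ne_zero)).symm

/-- Quadratic decay on one vertical line, and a functional equation, give quadratic decay in the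
strip between the line and its reflection. -/
lemma exists_strip_decay {Φ : ℂ → ℂ} (hΦ : Differentiable ℂ Φ) {κ σ D : ℝ} {c : ℂ}
    (hbdd : ∀ σ₁ σ₂ : ℝ, ∃ M : ℝ, ∀ s : ℂ, σ₁ ≤ s.re → s.re ≤ σ₂ → ‖Φ s‖ ≤ M)
    (hfe : ∀ s : ℂ, Φ s = c * Φ (κ - s)) (hσ : 0 < σ) (hκ : κ < 2 * σ)
    (hD : ∀ s : ℂ, s.re = σ → ‖Φ s‖ * ‖s‖ ^ 2 ≤ D) :
    ∃ M : ℝ, 0 ≤ M ∧ ∀ s : ℂ, κ - σ ≤ s.re → s.re ≤ σ → ‖Φ s‖ ≤ M / (1 + s.im ^ 2) := by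
  obtain ⟨A, hA, hA1, hA2⟩ : ∃ A : ℝ, 1 ≤ A ∧ 1 ≤ κ - σ + A ∧ 0 ≤ κ + A :=
    ⟨1 + |κ - σ| + |κ|, by
      linarith [abs_nonneg (κ - σ), abs_nonneg κ], by
      linarith [neg_abs_le (κ - σ), abs_nonneg κ], by
      linarith [neg_abs_le κ, abs_nonneg (κ - σ)]⟩
  have aux (w : ℂ) (hw : w.re = σ) (b : ℝ) (hb : 0 ≤ b) : ‖w‖ + b ≤ (1 + b / σ) * ‖w‖ := by
    have h1 : σ ≤ ‖w‖ := hw ▸ Complex.re_le_norm w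
    have h2 : b ≤ b / σ * ‖w‖ := by
      rw [div_mul_eq_mul_div, le_div_iff₀ hσ]
      exact mul_le_mul_of_nonneg_left h1 hb
    linarith
  have bound (w v : ℂ) (hw : w.re = σ) (b : ℝ) (hb : 0 ≤ b) (hv : ‖v‖ ≤ ‖w‖ + b) :
      ‖Φ w‖ * ‖v‖ ^ 2 ≤ D * (1 + b / σ) ^ 2 := by
    calc ‖Φ w‖ * ‖v‖ ^ 2 ≤ ‖Φ w‖ * ((1 + b / σ) * ‖w‖) ^ 2 := by
          gcongr; exact hv.trans (aux w hw b hb)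
      _ = ‖Φ w‖ * ‖w‖ ^ 2 * (1 + b / σ) ^ 2 := by ring
      _ ≤ _ := by gcongr; exact hD w hw
  set G : ℂ → ℂ := fun s => Φ s * (s + A) ^ 2 with hG
  set R := max (D * (1 + A / σ) ^ 2) (‖c‖ * (D * (1 + (κ + A) / σ) ^ 2)) with hR
  have hσG (s : ℂ) (hs : s.re = σ) : ‖G s‖ ≤ R := by
    refine le_trans ?_ (le_max_left _ _)
    rw [hG, norm_mul, norm_pow]
    refine bound s _ hs A (by linarith) ((norm_add_le _ _).trans_eq ?_)
    rw [Complex.norm_real, Real.norm_of_nonneg (by linarith)]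
  have hκG (s : ℂ) (hs : s.re = κ - σ) : ‖G s‖ ≤ R := by
    refine le_trans ?_ (le_max_right _ _)
    rw [hG, norm_mul, norm_pow, hfe, norm_mul, mul_assoc]
    refine mul_le_mul_of_nonneg_left ?_ (norm_nonneg _)
    refine bound _ _ (by simp [hs]) (κ + A) hA2 ?_
    have : s + A = ((κ + A : ℝ) : ℂ) - (κ - s) := by push_cast; ring
    rw [this]
    refine (norm_sub_le _ _).trans_eq ?_
    rw [Complex.norm_real, Real.norm_of_nonneg hA2, add_comm]
  obtain ⟨M, hM⟩ := hbdd (κ - σ) σ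
  have hw : 0 < σ - (κ - σ) := by linarith
  have hGle (s : ℂ) (h1 : κ - σ ≤ s.re) (h2 : s.re ≤ σ) : ‖G s‖ ≤ R := by
    refine PhragmenLindelof.vertical_strip (a := κ - σ) (b := σ)
      (Differentiable.diffContOnCl (by fun_prop)) ?_ hκG hσG h1 h2
    have hpi := Real.pi_pos
    set e := Real.pi / (2 * (σ - (κ - σ))) with he
    have hepos : 0 < e := by positivity
    refine ⟨e, ?_, 2 / e, ?_⟩
    · rw [he]
      exact div_lt_div_of_pos_left hpi hw (by linarith)
    · have hmem : Complex.re ⁻¹' Set.Ioo (κ - σ) σ ∈ comap (_root_.abs ∘ Complex.im) atTop ⊓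
          𝓟 (Complex.re ⁻¹' Set.Ioo (κ - σ) σ) := mem_inf_of_right (mem_principal_self _)
      refine IsBigO.of_bound (|M| * (A + |κ - σ| + |σ|) ^ 2) ?_
      filter_upwards [hmem] with z hz
      have hz1 : κ - σ < z.re := hz.1
      have hz2 : z.re < σ := hz.2
      rw [Real.norm_of_nonneg (Real.exp_pos _).le, hG, norm_mul, norm_pow]
      set L := A + |κ - σ| + |σ| with hL
      have hL1 : 1 ≤ L := by
        rw [hL]; linarith [abs_nonneg (κ - σ), abs_nonneg σ]
      have n1 : ‖z + A‖ ≤ L * (1 + |z.im|) := by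
        have n2 := Complex.norm_le_abs_re_add_abs_im (z + A)
        have n3 : |z.re + A| ≤ L := by
          rw [abs_le, hL]
          constructor
          · linarith [neg_abs_le (κ - σ), abs_nonneg σ]
          · linarith [le_abs_self σ, abs_nonneg (κ - σ)]
        simp only [add_re, ofReal_re, add_im, ofReal_im, add_zero] at n2
        nlinarith [abs_nonneg z.im]
      have n4 : (1 + |z.im|) ^ 2 ≤ Real.exp (2 / e * Real.exp (e * |z.im|)) := by
        have h3 : 1 + |z.im| ≤ Real.exp |z.im| := by
          linarith [Real.add_one_le_exp |z.im|]
        have h4 : (1 + |z.im|) ^ 2 ≤ Real.exp (2 * |z.im|) := by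
          calc (1 + |z.im|) ^ 2 ≤ Real.exp |z.im| ^ 2 := by gcongr
            _ = _ := by rw [← Real.exp_nat_mul]; norm_num
        refine h4.trans (Real.exp_le_exp.2 ?_)
        have h5 : e * |z.im| ≤ Real.exp (e * |z.im|) := by
          linarith [Real.add_one_le_exp (e * |z.im|)]
        calc 2 * |z.im| = 2 / e * (e * |z.im|) := by field_simp
          _ ≤ _ := by gcongr
      calc ‖Φ z‖ * ‖z + A‖ ^ 2 ≤ |M| * (L * (1 + |z.im|)) ^ 2 := by
            gcongr
            exact (hM z hz1.le hz2.le).trans (le_abs_self M)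
        _ = |M| * L ^ 2 * (1 + |z.im|) ^ 2 := by ring
        _ ≤ _ := by gcongr
  refine ⟨max R 0, le_max_right _ _, fun s h1 h2 => ?_⟩
  have h3 := hGle s h1 h2
  rw [hG, norm_mul, norm_pow] at h3
  rw [le_div_iff₀ (by positivity)]
  refine le_trans ?_ (h3.trans (le_max_left _ _))
  refine mul_le_mul_of_nonneg_left ?_ (norm_nonneg _)
  rw [Complex.sq_norm, Complex.normSq_apply]
  simp only [add_re, ofReal_re, add_im, ofReal_im, add_zero]
  nlinarith

end ContourShift

section MellinTransform

open MeasureTheory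

variable {a : ℕ → ℂ} {C : ℝ}

lemma summable_norm_dirichlet (h : (fun n : ℕ => a n) =O[atTop] fun n : ℕ => (n : ℝ) ^ C)
    {σ : ℝ} (hσ : C + 2 < σ) : Summable fun n : ℕ => ‖a (n + 1)‖ / ((n : ℝ) + 1) ^ σ := by
  obtain ⟨K, hK, hb⟩ := exists_coeff_bound h
  refine Summable.of_nonneg_of_le (fun n => by positivity) (fun n => ?_)
    (summable_one_div_nat_succ_sq.mul_left K)
  have hn : (1 : ℝ) ≤ n + 1 := by linarith [Nat.cast_nonneg (α := ℝ) n]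
  have hn0 : (0 : ℝ) < n + 1 := by linarith
  rw [div_le_iff₀ (by positivity)]
  refine (hb n).trans ?_
  have h1 : ((n : ℝ) + 1) ^ (C + 2) ≤ ((n : ℝ) + 1) ^ σ :=
    Real.rpow_le_rpow_of_exponent_le hn hσ.le
  have h2 : ((n : ℝ) + 1) ^ (C + 2) = ((n : ℝ) + 1) ^ C * ((n : ℝ) + 1) ^ 2 := by
    rw [Real.rpow_add hn0]; norm_cast
  calc K * ((n : ℝ) + 1) ^ C = K * (1 / ((n : ℝ) + 1) ^ 2) * ((n : ℝ) + 1) ^ (C + 2) := by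
        rw [h2]; field_simp
    _ ≤ _ := by gcongr

/-- The restriction of `f` to the imaginary axis, scaled by `r`. -/
noncomputable def imaginaryAxis (f : ℍ → ℂ) (r : ℝ) (y : ℝ) : ℂ :=
  f (ofComplex ((y * r : ℝ) * Complex.I))

lemma coe_axis {t : ℝ} (ht : 0 < t) : ((ofComplex (t * Complex.I) : ℍ) : ℂ) = t * Complex.I := by
  rw [ofComplex_apply_of_im_pos (by simpa using ht)]

lemma hasSum_imaginaryAxis (h : (fun n : ℕ => a n) =O[atTop] fun n : ℕ => (n : ℝ) ^ C)
    {r t : ℝ} (hr : 0 < r) (ht : 0 < t) :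
    HasSum (fun n : ℕ => a (n + 1) * Real.exp (-(2 * Real.pi * r * ((n : ℝ) + 1)) * t))
      (imaginaryAxis (fourierSeries a) r t) := by
  have htr : 0 < t * r := by positivity
  have h1 := (summable_norm_fourier h (z := (t * r : ℝ) * Complex.I) (by simpa using htr)).of_norm
  rw [imaginaryAxis, fourierSeries, coe_axis htr]
  convert h1.hasSum using 2 with n
  congr 1
  rw [Complex.ofReal_exp]
  congr 2
  push_cast
  linear_combination (-(2 * Real.pi * r * ((n : ℂ) + 1)) * t) * Complex.I_sq

lemma mellin_imaginaryAxis (h : (fun n : ℕ => a n) =O[atTop] fun n : ℕ => (n : ℝ) ^ C)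
    {r : ℝ} (hr : 0 < r) (hC : 0 < C) {s : ℂ} (hs : C + 2 < s.re) :
    mellin (imaginaryAxis (fourierSeries a) r) s =
      (2 * (Real.pi : ℂ) * r) ^ (-s) * Complex.Gamma s * dirichletSeries a s := by
  have hp (n : ℕ) : 0 < 2 * Real.pi * r * ((n : ℝ) + 1) := by positivity
  have h0 : 0 < 2 * Real.pi * r := by positivity
  have h1 := hasSum_mellin (a := fun n : ℕ => a (n + 1))
    (p := fun n : ℕ => 2 * Real.pi * r * ((n : ℝ) + 1)) (s := s)
    (F := imaginaryAxis (fourierSeries a) r)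
    (fun n => Or.inr (hp n)) (by linarith) (fun t ht => hasSum_imaginaryAxis h hr ht) ?_
  · rw [← h1.tsum_eq, dirichletSeries, ← tsum_mul_left]
    refine tsum_congr fun n => ?_
    rw [Complex.ofReal_mul, Complex.mul_cpow_ofReal_nonneg h0.le (by positivity), Complex.cpow_neg]
    push_cast
    field_simp
  · refine ((summable_norm_dirichlet h hs).mul_left ((2 * Real.pi * r) ^ s.re)⁻¹).congr fun n => ?_
    rw [Real.mul_rpow h0.le (by positivity)]
    field_simp

lemma norm_Gamma_le {s : ℂ} (hs : 0 < s.re) : ‖Complex.Gamma s‖ ≤ Real.Gamma s.re := by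
  rw [Complex.Gamma_eq_integral hs, Real.Gamma_eq_integral hs, Complex.GammaIntegral]
  refine (norm_integral_le_integral_norm _).trans_eq ?_
  refine setIntegral_congr_fun measurableSet_Ioi fun x hx => ?_
  have hx' : 0 < x := hx
  simp only [norm_mul, Complex.norm_real, Real.norm_of_nonneg (Real.exp_pos _).le]
  rw [Complex.norm_cpow_eq_rpow_re_of_pos hx']
  simp

lemma norm_dirichletSeries_le (h : (fun n : ℕ => a n) =O[atTop] fun n : ℕ => (n : ℝ) ^ C)
    {s : ℂ} (hs : C + 2 < s.re) :
    ‖dirichletSeries a s‖ ≤ ∑' n : ℕ, ‖a (n + 1)‖ / ((n : ℝ) + 1) ^ s.re := by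
  have h1 (n : ℕ) : ‖a (n + 1) / ((n : ℂ) + 1) ^ s‖ = ‖a (n + 1)‖ / ((n : ℝ) + 1) ^ s.re := by
    rw [norm_div]
    have := Complex.norm_cpow_eq_rpow_re_of_pos (x := (n : ℝ) + 1) (by positivity) s
    push_cast at this
    rw [this]
  rw [dirichletSeries]
  simp_rw [← h1]
  refine norm_tsum_le_tsum_norm ?_
  simp_rw [h1]
  exact summable_norm_dirichlet h hs

lemma norm_completed_le (h : (fun n : ℕ => a n) =O[atTop] fun n : ℕ => (n : ℝ) ^ C)
    {r : ℝ} (hr : 0 < r) (hC : 0 < C) {s : ℂ} (hs : C + 2 < s.re) :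
    ‖(2 * (Real.pi : ℂ) * r) ^ (-s) * Complex.Gamma s * dirichletSeries a s‖ * ‖s‖ ^ 2 ≤
      (2 * Real.pi * r) ^ (-s.re) * Real.Gamma (s.re + 2) *
        ∑' n : ℕ, ‖a (n + 1)‖ / ((n : ℝ) + 1) ^ s.re := by
  have hre : 0 < s.re := by linarith
  have h0 : s ≠ 0 := fun h0 => by simp [h0] at hre
  have h1 : s + 1 ≠ 0 := fun h1 => by
    have := congrArg Complex.re h1
    simp at this
    linarith
  have hG : Complex.Gamma s * (s * (s + 1)) = Complex.Gamma (s + 2) := by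
    rw [show s + 2 = s + 1 + 1 by ring, Complex.Gamma_add_one _ h1, Complex.Gamma_add_one _ h0]
    ring
  have hle : ‖s‖ ≤ ‖s + 1‖ := by
    rw [Complex.norm_def, Complex.norm_def]
    refine Real.sqrt_le_sqrt ?_
    simp only [Complex.normSq_apply, add_re, one_re, add_im, one_im, add_zero]
    nlinarith
  have hpow : ‖(2 * (Real.pi : ℂ) * r) ^ (-s)‖ = (2 * Real.pi * r) ^ (-s.re) := by
    have := Complex.norm_cpow_eq_rpow_re_of_pos (x := 2 * Real.pi * r) (by positivity) (-s)
    push_cast at this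
    simpa using this
  have hGam : ‖Complex.Gamma s‖ * ‖s‖ ^ 2 ≤ Real.Gamma (s.re + 2) := by
    calc ‖Complex.Gamma s‖ * ‖s‖ ^ 2 ≤ ‖Complex.Gamma s‖ * (‖s‖ * ‖s + 1‖) := by
          rw [sq]; gcongr
      _ = ‖Complex.Gamma (s + 2)‖ := by rw [← hG, norm_mul, norm_mul]
      _ ≤ _ := by simpa using norm_Gamma_le (s := s + 2) (by simp; linarith)
  rw [norm_mul, norm_mul, hpow]
  calc _ = (2 * Real.pi * r) ^ (-s.re) * (‖Complex.Gamma s‖ * ‖s‖ ^ 2) * ‖dirichletSeries a s‖ := by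
        ring
    _ ≤ _ := by
      gcongr
      exact norm_dirichletSeries_le h hs

lemma continuousOn_imaginaryAxis (h : (fun n : ℕ => a n) =O[atTop] fun n : ℕ => (n : ℝ) ^ C)
    {r : ℝ} (hr : 0 < r) : ContinuousOn (imaginaryAxis (fourierSeries a) r) (Set.Ioi 0) := by
  have h1 := (holoUHP_fourierSeries h).continuousOn
  refine h1.comp (f := fun y : ℝ => ((y * r : ℝ) * Complex.I : ℂ))
    (Continuous.continuousOn (by fun_prop)) fun y hy => ?_
  have : 0 < y := hy
  simp only [Set.mem_ofPred_eq]
  simpa using mul_pos this hr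

lemma exists_mellinConvergent (h : (fun n : ℕ => a n) =O[atTop] fun n : ℕ => (n : ℝ) ^ C)
    {r : ℝ} (hr : 0 < r) :
    ∃ M : ℝ, ∀ s : ℂ, M < s.re → MellinConvergent (imaginaryAxis (fourierSeries a) r) s := by
  obtain ⟨M, B, hB, hb⟩ := exists_fourierSeries_bound h
  have hbound (y : ℝ) (hy : 0 < y) : ‖imaginaryAxis (fourierSeries a) r y‖ ≤
      B * (Real.exp (-(Real.pi * (y * r))) / (y * r) ^ M) := by
    have := hb (ofComplex ((y * r : ℝ) * Complex.I))
    rw [← UpperHalfPlane.coe_im, coe_axis (by positivity)] at this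
    simpa [imaginaryAxis] using this
  refine ⟨M, fun s hs => mellinConvergent_of_isBigO_rpow_exp (a := Real.pi * r) (b := M)
    (by positivity) ((continuousOn_imaginaryAxis h hr).locallyIntegrableOn measurableSet_Ioi)
    ?_ ?_ hs⟩
  · refine IsBigO.of_bound (B / r ^ M) ?_
    filter_upwards [eventually_ge_atTop 1] with y hy
    have hy0 : 0 < y := by linarith
    refine (hbound y hy0).trans ?_
    rw [Real.norm_of_nonneg (Real.exp_pos _).le, show -(Real.pi * r) * y = -(Real.pi * (y * r)) by
      ring, mul_pow, ← mul_div_assoc, div_mul_eq_mul_div]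
    refine div_le_div_of_nonneg_left (by positivity) (by positivity) ?_
    exact le_mul_of_one_le_left (by positivity) (one_le_pow₀ hy)
  · refine IsBigO.of_bound (B / r ^ M) ?_
    filter_upwards [self_mem_nhdsWithin] with y hy
    have hy0 : 0 < y := hy
    refine (hbound y hy0).trans ?_
    rw [Real.norm_of_nonneg (by positivity), Real.rpow_neg hy0.le, Real.rpow_natCast]
    have : Real.exp (-(Real.pi * (y * r))) ≤ 1 := Real.exp_le_one_iff.2 (by
      have : 0 < Real.pi * (y * r) := by positivity
      linarith)
    calc B * (Real.exp (-(Real.pi * (y * r))) / (y * r) ^ M) ≤ B * (1 / (y * r) ^ M) := by gcongr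
      _ = _ := by rw [mul_pow]; field_simp

end MellinTransform

section FunctionalEquation

open MeasureTheory

variable {a : ℕ → ℂ} {C : ℝ}

lemma imaginaryAxis_eq_inv (h : (fun n : ℕ => a n) =O[atTop] fun n : ℕ => (n : ℝ) ^ C)
    {r : ℝ} (hr : 0 < r) (hC : 0 < C) {Φ : ℂ → ℂ} (hΦ : Differentiable ℂ Φ) {κ : ℝ} {c : ℂ}
    (hbdd : ∀ σ₁ σ₂ : ℝ, ∃ M : ℝ, ∀ s : ℂ, σ₁ ≤ s.re → s.re ≤ σ₂ → ‖Φ s‖ ≤ M)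
    (hfe : ∀ s : ℂ, Φ s = c * Φ (κ - s))
    (hΦeq : ∀ s : ℂ, C + 2 < s.re →
      Φ s = (2 * (Real.pi : ℂ) * r) ^ (-s) * Complex.Gamma s * dirichletSeries a s)
    {y : ℝ} (hy : 0 < y) :
    imaginaryAxis (fourierSeries a) r y =
      c * (y : ℂ) ^ (-κ : ℂ) * imaginaryAxis (fourierSeries a) r y⁻¹ := by
  obtain ⟨M₀, hM₀⟩ := exists_mellinConvergent h hr
  obtain ⟨σ, h1, h2, h3⟩ : ∃ σ : ℝ, C + 2 < σ ∧ M₀ < σ ∧ κ < 2 * σ :=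
    ⟨C + 3 + |M₀| + |κ|, by linarith [abs_nonneg M₀, abs_nonneg κ],
      by linarith [le_abs_self M₀, abs_nonneg κ],
      by linarith [le_abs_self κ, abs_nonneg κ, abs_nonneg M₀]⟩
  have hσ : 0 < σ := by linarith
  obtain ⟨M, hM, hdecay⟩ := exists_strip_decay hΦ hbdd hfe hσ h3 (fun s hs => by
    have := norm_completed_le h hr hC (s := s) (by rwa [hs])
    rw [hΦeq s (by rwa [hs])]
    rwa [hs] at this)
  have hmel (t : ℝ) : mellin (imaginaryAxis (fourierSeries a) r) (σ + t * Complex.I) =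
      Φ (σ + t * Complex.I) := by
    rw [mellin_imaginaryAxis h hr hC (by simpa using h1), hΦeq _ (by simpa using h1)]
  have hinv {x : ℝ} (hx : 0 < x) : imaginaryAxis (fourierSeries a) r x =
      (1 / (2 * Real.pi)) • ∫ t : ℝ, (x : ℂ) ^ (-(σ + t * Complex.I)) * Φ (σ + t * Complex.I) := by
    rw [← mellinInv_mellin_eq σ _ hx (hM₀ σ (by simpa using h2)) ?_
      ((continuousOn_imaginaryAxis h hr).continuousAt (Ioi_mem_nhds hx)), mellinInv]
    · simp only [hmel, smul_eq_mul]
    · rw [VerticalIntegrable]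
      simp only [hmel]
      exact integrable_vertical hΦ fun s hs => hdecay s (by linarith) hs.le
  have hy0 : (y : ℂ) ≠ 0 := by exact_mod_cast hy.ne'
  have hshift := integral_vertical_eq (g := fun s => (y : ℂ) ^ (-s) * Φ s) (α := κ - σ) (β := σ)
    (M := Real.exp (|Real.log y| * (|κ - σ| + |σ|)) * M)
    ((Differentiable.const_cpow (by fun_prop) (Or.inl hy0)).mul hΦ) (by linarith)
    (fun s hs1 hs2 => by
      rw [norm_mul, Complex.norm_cpow_eq_rpow_re_of_pos hy, mul_div_assoc]
      refine mul_le_mul ?_ (hdecay s hs1 hs2) (norm_nonneg _) (Real.exp_pos _).le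
      rw [Real.rpow_def_of_pos hy]
      refine Real.exp_le_exp.2 ((le_abs_self _).trans ?_)
      rw [abs_mul]
      refine mul_le_mul_of_nonneg_left ?_ (abs_nonneg _)
      rw [neg_re, abs_neg, abs_le]
      constructor
      · linarith [neg_abs_le (κ - σ), abs_nonneg σ]
      · linarith [le_abs_self σ, abs_nonneg (κ - σ)])
  rw [hinv hy, hinv (inv_pos.2 hy), ← hshift, ← integral_neg_eq_self, mul_smul_comm,
    ← integral_const_mul]
  congr 1
  refine integral_congr_ae (Eventually.of_forall fun t => ?_)
  simp only
  rw [hfe]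
  have e1 : (κ : ℂ) - (((κ - σ : ℝ) : ℂ) + ((-t : ℝ) : ℂ) * Complex.I) = σ + t * Complex.I := by
    push_cast; ring
  have e2 : (y : ℂ) ^ (-(((κ - σ : ℝ) : ℂ) + ((-t : ℝ) : ℂ) * Complex.I)) =
      (y : ℂ) ^ (-κ : ℂ) * ((y⁻¹ : ℝ) : ℂ) ^ (-(σ + t * Complex.I)) := by
    rw [Complex.ofReal_inv, Complex.inv_cpow, ← Complex.cpow_neg, ← Complex.cpow_add _ _ hy0]
    · congr 1; push_cast; ring
    · rw [Complex.arg_ofReal_of_nonneg hy.le]; exact Real.pi_pos.ne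
  rw [e1, e2]
  ring

end FunctionalEquation

section FrickeInvolution

variable {k : ℤ}

lemma HoloUHP.const_smul {g : ℍ → ℂ} (hg : HoloUHP g) (c : ℂ) : HoloUHP (c • g) :=
  DifferentiableOn.const_smul hg c

lemma eq_of_eq_imaginaryAxis {f g : ℍ → ℂ} (hf : HoloUHP f) (hg : HoloUHP g)
    (h : ∀ t : ℝ, 0 < t → f (ofComplex (t * Complex.I)) = g (ofComplex (t * Complex.I))) :
    f = g := by
  rw [← sub_eq_zero]
  refine UpperHalfPlane.eq_zero_of_frequently (UpperHalfPlane.mdifferentiable_iff.2 (hf.sub hg))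
    (τ := UpperHalfPlane.I) ?_
  have hcoe : ((UpperHalfPlane.I : ℍ) : ℂ) = Complex.I := rfl
  have h1 : Tendsto (fun t : ℝ => ofComplex (t * Complex.I)) (𝓝[≠] 1) (𝓝[≠] UpperHalfPlane.I) := by
    refine tendsto_nhdsWithin_iff.2 ⟨?_, ?_⟩
    · refine Tendsto.mono_left ?_ nhdsWithin_le_nhds
      rw [UpperHalfPlane.isEmbedding_coe.tendsto_nhds_iff, hcoe]
      have h2 : Tendsto (fun t : ℝ => (t : ℂ) * Complex.I) (𝓝 1) (𝓝 ((1 : ℝ) * Complex.I)) :=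
        Continuous.tendsto (by fun_prop) 1
      rw [Complex.ofReal_one, one_mul] at h2
      refine h2.congr' ?_
      filter_upwards [lt_mem_nhds (zero_lt_one (α := ℝ))] with t ht
      exact (coe_axis ht).symm
    · have h2 : ∀ᶠ t : ℝ in 𝓝[≠] 1, 0 < t := nhdsWithin_le_nhds (lt_mem_nhds zero_lt_one)
      filter_upwards [h2, self_mem_nhdsWithin] with t ht ht1 h3
      have h4 := congrArg (fun z : ℍ => (z : ℂ).im) h3
      simp only [coe_axis ht, hcoe] at h4
      exact ht1 (by simpa using h4)
  refine h1.frequently (Eventually.frequently ?_)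
  have h2 : ∀ᶠ t : ℝ in 𝓝[≠] 1, 0 < t := nhdsWithin_le_nhds (lt_mem_nhds zero_lt_one)
  filter_upwards [h2] with t ht
  simp [h t ht]

lemma intSlash_fricke_eq {f : ℍ → ℂ} (hk : Even k) {N : ℕ} (hN : 0 < N) (hf : HoloUHP f) {ε : ℂ}
    (hε : ε ^ 2 = 1)
    (h : ∀ y : ℝ, 0 < y → imaginaryAxis f (1 / Real.sqrt N) y =
      ε * (-1) ^ (k / 2) * (y : ℂ) ^ (-k) * imaginaryAxis f (1 / Real.sqrt N) y⁻¹) :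
    intSlash k 0 (-1) N 0 f = ε • f := by
  have hN' : (0 : ℝ) < N := by exact_mod_cast hN
  have hsq : 0 < Real.sqrt N := Real.sqrt_pos.2 hN'
  have hdet : (0 : ℤ) < 0 * 0 - (-1) * N := by simpa using hN
  refine eq_of_eq_imaginaryAxis (hf.intSlash hdet) (hf.const_smul ε) fun t ht => ?_
  set y := t * Real.sqrt N with hy
  have hy0 : 0 < y := by positivity
  have e1 : y * (1 / Real.sqrt N) = t := by rw [hy]; field_simp
  have hss : Real.sqrt N * Real.sqrt N = N := Real.mul_self_sqrt hN'.le
  have e2 : glAct !![((0 : ℤ) : ℝ), ((-1 : ℤ) : ℝ); ((N : ℤ) : ℝ), ((0 : ℤ) : ℝ)]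
      (ofComplex (t * Complex.I)) = ofComplex ((y⁻¹ * (1 / Real.sqrt N) : ℝ) * Complex.I) := by
    apply UpperHalfPlane.ext
    have htc : (t : ℂ) ≠ 0 := by exact_mod_cast ht.ne'
    have hNc : (N : ℂ) ≠ 0 := by exact_mod_cast hN.ne'
    have : y⁻¹ * (1 / Real.sqrt N) = 1 / (N * t) := by
      rw [hy]; field_simp; rw [sq, hss]
    rw [coe_glAct (det_int_pos hdet), coe_axis ht, this, coe_axis (by positivity)]
    simp
    field_simp
    simp
  have h1 := h y hy0
  simp only [imaginaryAxis, e1] at h1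
  rw [intSlash_apply, e2, coe_axis ht, Pi.smul_apply, smul_eq_mul, h1]
  have e3 : (((0 * 0 - (-1) * N : ℤ)) : ℂ) ^ (k / 2) *
      (((N : ℤ) : ℂ) * (t * Complex.I) + ((0 : ℤ) : ℂ)) ^ (-k) =
        (-1) ^ (k / 2) * (y : ℂ) ^ (-k) := by
    obtain ⟨j, rfl⟩ := hk
    have hj : (j + j) / 2 = j := by omega
    have hj2 : -(j + j) = 2 * (-j) := by ring
    have hyc : (y : ℂ) ^ 2 = t ^ 2 * N := by
      have : y ^ 2 = t ^ 2 * N := by rw [← hss, hy]; ring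
      exact_mod_cast this
    rw [hj, hj2, _root_.zpow_mul, _root_.zpow_mul]
    have hNc : (N : ℂ) ≠ 0 := by exact_mod_cast hN.ne'
    have : (((N : ℤ) : ℂ) * (t * Complex.I) + ((0 : ℤ) : ℂ)) ^ (2 : ℤ) =
        (-1) * N * (y : ℂ) ^ (2 : ℤ) := by
      rw [show (y : ℂ) ^ (2 : ℤ) = (y : ℂ) ^ 2 by norm_cast, hyc, zpow_ofNat, Int.cast_natCast,
        Int.cast_zero, add_zero, mul_pow, mul_pow, Complex.I_sq]
      ring
    rw [this, mul_zpow, mul_zpow]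
    have h3 : ((-1 : ℂ)) ^ (-j) = (-1) ^ j := by
      rw [_root_.zpow_neg, ← _root_.inv_zpow]; norm_num
    rw [h3]
    have h4 : (((0 * 0 - (-1) * N : ℤ)) : ℂ) = N := by push_cast; ring
    rw [h4, _root_.zpow_neg (N : ℂ)]
    field_simp
  rw [e3]
  linear_combination (-(-1 : ℂ) ^ (k / 2) * (y : ℂ) ^ (-k) *
    f (ofComplex ((y⁻¹ * (1 / Real.sqrt N) : ℝ) * Complex.I))) * hε

end FrickeInvolution

section EulerProduct

/-- The power series coefficients of `(1 - c₁ x + c₂ x ^ 2)⁻¹`. -/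
noncomputable def quadCoeff (c₁ c₂ : ℂ) : ℕ → ℂ
  | 0 => 1
  | 1 => c₁
  | e + 2 => c₁ * quadCoeff c₁ c₂ (e + 1) - c₂ * quadCoeff c₁ c₂ e

lemma norm_quadCoeff_le {c₁ c₂ : ℂ} {R : ℝ} (hR : 0 ≤ R) (h₁ : ‖c₁‖ ≤ R / 2)
    (h₂ : ‖c₂‖ ≤ R ^ 2 / 2) (e : ℕ) : ‖quadCoeff c₁ c₂ e‖ ≤ R ^ e := by
  induction e using Nat.strong_induction_on with
  | _ e ih =>
    match e with
    | 0 => simp [quadCoeff]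
    | 1 => simp only [quadCoeff, pow_one]; linarith
    | e + 2 =>
      rw [quadCoeff]
      calc _ ≤ ‖c₁‖ * ‖quadCoeff c₁ c₂ (e + 1)‖ + ‖c₂‖ * ‖quadCoeff c₁ c₂ e‖ := by
            rw [← norm_mul, ← norm_mul]; exact norm_sub_le _ _
        _ ≤ R / 2 * R ^ (e + 1) + R ^ 2 / 2 * R ^ e := by
            gcongr
            · exact ih _ (by omega)
            · exact ih _ (by omega)
        _ = R ^ (e + 2) := by ring

lemma tsum_quadCoeff {c₁ c₂ x : ℂ} {R : ℝ} (hR : 0 ≤ R) (h₁ : ‖c₁‖ ≤ R / 2)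
    (h₂ : ‖c₂‖ ≤ R ^ 2 / 2) (hx : R * ‖x‖ < 1) :
    ∑' e, quadCoeff c₁ c₂ e * x ^ e = (1 - c₁ * x + c₂ * x ^ 2)⁻¹ := by
  have hs : Summable fun e => quadCoeff c₁ c₂ e * x ^ e := by
    refine Summable.of_norm_bounded (summable_geometric_of_lt_one (by positivity) hx) fun e => ?_
    rw [norm_mul, norm_pow, mul_pow]
    gcongr
    exact norm_quadCoeff_le hR h₁ h₂ e
  have hs1 := (summable_nat_add_iff 1).2 hs
  have hs2 := (summable_nat_add_iff 2).2 hs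
  set S := ∑' e, quadCoeff c₁ c₂ e * x ^ e with hS
  have e1 : S = 1 + ∑' e, quadCoeff c₁ c₂ (e + 1) * x ^ (e + 1) := by
    rw [hS, hs.tsum_eq_zero_add]; simp [quadCoeff]
  have e2 : ∑' e, quadCoeff c₁ c₂ (e + 1) * x ^ (e + 1) =
      c₁ * x + ∑' e, quadCoeff c₁ c₂ (e + 2) * x ^ (e + 2) := by
    rw [hs1.tsum_eq_zero_add]; simp [quadCoeff]
  have e3 : ∑' e, quadCoeff c₁ c₂ (e + 2) * x ^ (e + 2) =
      c₁ * x * (∑' e, quadCoeff c₁ c₂ (e + 1) * x ^ (e + 1)) - c₂ * x ^ 2 * S := by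
    rw [hS, ← tsum_mul_left, ← tsum_mul_left,
      ← (hs1.mul_left (c₁ * x)).tsum_sub (hs.mul_left (c₂ * x ^ 2))]
    refine tsum_congr fun e => ?_
    rw [quadCoeff]; ring
  refine eq_inv_of_mul_eq_one_right ?_
  linear_combination (1 - c₁ * x) * e1 + e2 + e3

/-- The Dirichlet series coefficients of the Euler product
`∏ (1 - c₁(p) p⁻ˢ + c₂(p) p⁻²ˢ)⁻¹`. -/
noncomputable def eulerCoeff (c₁ c₂ : ℕ → ℂ) (m : ℕ) : ℂ :=
  if m = 0 then 0 else m.factorization.prod fun p e => quadCoeff (c₁ p) (c₂ p) e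

variable {c₁ c₂ : ℕ → ℂ}

lemma eulerCoeff_one : eulerCoeff c₁ c₂ 1 = 1 := by simp [eulerCoeff]

lemma eulerCoeff_mul {m n : ℕ} (h : Nat.Coprime m n) :
    eulerCoeff c₁ c₂ (m * n) = eulerCoeff c₁ c₂ m * eulerCoeff c₁ c₂ n := by
  rcases eq_or_ne m 0 with rfl | hm
  · simp [eulerCoeff]
  rcases eq_or_ne n 0 with rfl | hn
  · simp [eulerCoeff]
  rw [eulerCoeff, eulerCoeff, eulerCoeff, if_neg hm, if_neg hn, if_neg (mul_ne_zero hm hn),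
    Nat.factorization_mul hm hn, Finsupp.prod_add_index_of_disjoint]
  exact h.disjoint_primeFactors

lemma eulerCoeff_prime_pow {p : ℕ} (hp : p.Prime) (e : ℕ) :
    eulerCoeff c₁ c₂ (p ^ e) = quadCoeff (c₁ p) (c₂ p) e := by
  rw [eulerCoeff, if_neg (pow_ne_zero _ hp.ne_zero), hp.factorization_pow,
    Finsupp.prod_single_index (by simp [quadCoeff])]

lemma eulerCoeff_prime_mul {p : ℕ} (hp : p.Prime) {m : ℕ} (hm : m ≠ 0) :
    eulerCoeff c₁ c₂ (p * m) = c₁ p * eulerCoeff c₁ c₂ m -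
      c₂ p * (if p ∣ m then eulerCoeff c₁ c₂ (m / p) else 0) := by
  obtain ⟨e, n, hn, rfl⟩ := Nat.exists_eq_pow_mul_and_not_dvd hm p hp.ne_one
  have hcop (i : ℕ) : Nat.Coprime (p ^ i) n :=
    Nat.Coprime.pow_left i ((hp.coprime_iff_not_dvd).2 hn)
  have hval (i : ℕ) : eulerCoeff c₁ c₂ (p ^ i * n) =
      quadCoeff (c₁ p) (c₂ p) i * eulerCoeff c₁ c₂ n := by
    rw [eulerCoeff_mul (hcop i), eulerCoeff_prime_pow hp]
  rw [← mul_assoc, ← pow_succ', hval, hval]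
  cases e with
  | zero => simp [hn, quadCoeff]
  | succ e =>
    rw [if_pos (Dvd.dvd.mul_right (dvd_pow_self p e.succ_ne_zero) n),
      show p ^ (e + 1) * n / p = p ^ e * n by
        rw [pow_succ', mul_assoc, Nat.mul_div_cancel_left _ hp.pos], hval, quadCoeff]
    ring

lemma norm_eulerCoeff_le {A : ℕ} (h₁ : ∀ p, p.Prime → ‖c₁ p‖ ≤ (p : ℝ) ^ A / 2)
    (h₂ : ∀ p, p.Prime → ‖c₂ p‖ ≤ ((p : ℝ) ^ A) ^ 2 / 2) (m : ℕ) :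
    ‖eulerCoeff c₁ c₂ m‖ ≤ (m : ℝ) ^ A := by
  rcases eq_or_ne m 0 with rfl | hm
  · simp [eulerCoeff]
  rw [eulerCoeff, if_neg hm, Finsupp.prod, norm_prod]
  calc _ ≤ ∏ p ∈ m.factorization.support, ((p : ℝ) ^ A) ^ m.factorization p := by
        refine Finset.prod_le_prod (fun _ _ => norm_nonneg _) fun p hp => ?_
        have hp' := Nat.prime_of_mem_primeFactors hp
        exact norm_quadCoeff_le (by positivity) (h₁ p hp') (h₂ p hp') _
    _ = (∏ p ∈ m.factorization.support, (p : ℝ) ^ m.factorization p) ^ A := by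
        rw [← Finset.prod_pow]
        exact Finset.prod_congr rfl fun p _ => by rw [← pow_mul, ← pow_mul, mul_comm]
    _ = _ := by
        congr 1
        have := Nat.prod_factorization_pow_eq_self hm
        rw [Finsupp.prod] at this
        exact_mod_cast this

lemma LSeriesSummable_eulerCoeff {A : ℕ} (h₁ : ∀ p, p.Prime → ‖c₁ p‖ ≤ (p : ℝ) ^ A / 2)
    (h₂ : ∀ p, p.Prime → ‖c₂ p‖ ≤ ((p : ℝ) ^ A) ^ 2 / 2) {s : ℂ} (hs : A + 1 < s.re) :
    LSeriesSummable (eulerCoeff c₁ c₂) s :=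
  LSeriesSummable_of_le_const_mul_rpow hs ⟨1, fun n _ => by
    simpa using norm_eulerCoeff_le h₁ h₂ n⟩

lemma LSeries_eulerCoeff {A : ℕ} (h₁ : ∀ p, p.Prime → ‖c₁ p‖ ≤ (p : ℝ) ^ A / 2)
    (h₂ : ∀ p, p.Prime → ‖c₂ p‖ ≤ ((p : ℝ) ^ A) ^ 2 / 2) {s : ℂ} (hs : A + 1 < s.re) :
    LSeries (eulerCoeff c₁ c₂) s = ∏' p : Nat.Primes,
      (1 - c₁ p * (p : ℂ) ^ (-s) + c₂ p * ((p : ℂ) ^ (-s)) ^ 2)⁻¹ := by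
  have hterm (n : ℕ) (hn : n ≠ 0) : LSeries.term (eulerCoeff c₁ c₂) s n =
      eulerCoeff c₁ c₂ n * (n : ℂ) ^ (-s) := by
    rw [LSeries.term_of_ne_zero hn, Complex.cpow_neg, div_eq_mul_inv]
  have h := EulerProduct.eulerProduct_hasProd (f := LSeries.term (eulerCoeff c₁ c₂) s)
    (by rw [hterm 1 one_ne_zero]; simp [eulerCoeff_one]) (fun {m n} hmn => ?_)
    (LSeriesSummable_eulerCoeff h₁ h₂ hs).norm (LSeries.term_zero _ _)
  · rw [LSeries, ← h.tprod_eq]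
    refine tprod_congr fun p => ?_
    have hp := p.prop
    have hp0 : (0 : ℝ) < p := by exact_mod_cast hp.pos
    rw [← tsum_quadCoeff (R := (p : ℝ) ^ A) (by positivity) (h₁ p hp) (h₂ p hp)]
    · refine tsum_congr fun e => ?_
      rw [hterm _ (pow_ne_zero _ hp.ne_zero), eulerCoeff_prime_pow hp, Nat.cast_pow,
        ← Complex.natCast_cpow_natCast_mul, mul_comm (e : ℂ), Complex.cpow_mul_nat]
    · have : ‖((p : ℕ) : ℂ) ^ (-s)‖ = (p : ℝ) ^ (-s.re) := by
        simpa using Complex.norm_cpow_eq_rpow_re_of_pos hp0 (-s)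
      rw [this, ← Real.rpow_natCast, ← Real.rpow_add hp0]
      exact Real.rpow_lt_one_of_one_lt_of_neg (by exact_mod_cast hp.one_lt) (by linarith)
  · rcases eq_or_ne m 0 with rfl | hm
    · simp
    rcases eq_or_ne n 0 with rfl | hn
    · simp
    rw [hterm _ hm, hterm _ hn, hterm _ (mul_ne_zero hm hn), eulerCoeff_mul hmn, Nat.cast_mul,
      Complex.natCast_mul_natCast_cpow]
    ring

end EulerProduct

section EulerCoefficients

variable {a : ℕ → ℂ} {C : ℝ} {N : ℕ} {k : ℤ}

/-- The linear coefficient of the reciprocal of the local factor at `p`. -/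
noncomputable def eulerTrace (a : ℕ → ℂ) (N : ℕ) (k : ℤ) (p : ℕ) : ℂ :=
  if p ∣ N then (if p ^ 2 ∣ N then 0 else (p : ℂ) ^ (k / 2 - 1)) else a p

/-- The quadratic coefficient of the reciprocal of the local factor at `p`. -/
noncomputable def eulerNorm (N : ℕ) (k : ℤ) (p : ℕ) : ℂ :=
  if p ∣ N then 0 else (p : ℂ) ^ (k - 1)

lemma localFactor_eq (hk : Even k) {p : ℕ} (hp : p.Prime) (s : ℂ) :
    localFactor a N k p s = (1 - eulerTrace a N k p * (p : ℂ) ^ (-s) +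
      eulerNorm N k p * ((p : ℂ) ^ (-s)) ^ 2)⁻¹ := by
  have hp0 : (p : ℂ) ≠ 0 := by exact_mod_cast hp.ne_zero
  rw [localFactor, eulerTrace, eulerNorm]
  split_ifs
  · simp
  · obtain ⟨j, rfl⟩ := hk
    have h1 : (((j + j : ℤ) : ℂ) / 2 - 1 - s) = ((j - 1 : ℤ) : ℂ) + -s := by push_cast; ring
    rw [h1, Complex.cpow_add _ _ hp0, Complex.cpow_intCast, show (j + j) / 2 = j by omega]
    simp
  · have h1 : ((k : ℂ) - 1 - 2 * s) = ((k - 1 : ℤ) : ℂ) + (-s) * (2 : ℕ) := by push_cast; ring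
    rw [h1, Complex.cpow_add _ _ hp0, Complex.cpow_intCast, Complex.cpow_mul_nat]

lemma exists_euler_bound (h : (fun n : ℕ => a n) =O[atTop] fun n : ℕ => (n : ℝ) ^ C) (k : ℤ) :
    ∃ A : ℕ, (∀ p : ℕ, p.Prime → ‖eulerTrace a N k p‖ ≤ (p : ℝ) ^ A / 2) ∧
      ∀ p : ℕ, p.Prime → ‖eulerNorm N k p‖ ≤ ((p : ℝ) ^ A) ^ 2 / 2 := by
  obtain ⟨K, hK, hb⟩ := exists_coeff_bound h
  obtain ⟨B, hB⟩ := exists_nat_ge (|C| + |(k : ℝ)|)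
  obtain ⟨j, hj⟩ := pow_unbounded_of_one_lt (2 * (K + 1)) one_lt_two
  have hBC : C ≤ B := by linarith [le_abs_self C, abs_nonneg (k : ℝ)]
  have hBk' : |(k : ℝ)| ≤ B := by linarith [abs_nonneg C]
  have hBk : |k| ≤ B := by exact_mod_cast hBk'
  rw [abs_le] at hBk
  have hA (p : ℕ) (hp : p.Prime) : (K + 1) * (p : ℝ) ^ B ≤ (p : ℝ) ^ (B + j) / 2 := by
    have h2 : (2 : ℝ) ≤ p := by exact_mod_cast hp.two_le
    have h3 : (2 : ℝ) ^ j ≤ (p : ℝ) ^ j := by gcongr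
    rw [pow_add]
    have h4 : (0 : ℝ) < (p : ℝ) ^ B := by positivity
    nlinarith
  have hz (p : ℕ) (hp : p.Prime) (i : ℤ) (hi : i ≤ B) : ‖(p : ℂ) ^ i‖ ≤ (p : ℝ) ^ (B + j) / 2 := by
    have h1 : (1 : ℝ) ≤ p := by exact_mod_cast hp.one_lt.le
    have h4 : (0 : ℝ) < (p : ℝ) ^ B := by positivity
    rw [norm_zpow, Complex.norm_natCast]
    have : (p : ℝ) ^ i ≤ (p : ℝ) ^ (B : ℤ) := zpow_le_zpow_right₀ h1 hi
    rw [zpow_natCast] at this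
    nlinarith [hA p hp]
  refine ⟨B + j, fun p hp => ?_, fun p hp => ?_⟩
  · rw [eulerTrace]
    split_ifs
    · rw [norm_zero]; positivity
    · exact hz p hp _ (by omega)
    · have h1 : (1 : ℝ) ≤ p := by exact_mod_cast hp.one_lt.le
      have h2 := hb (p - 1)
      have h3 : ((p - 1 : ℕ) : ℝ) + 1 = p := by exact_mod_cast Nat.sub_add_cancel hp.one_lt.le
      rw [Nat.sub_add_cancel hp.one_lt.le, h3] at h2
      have h5 : (p : ℝ) ^ C ≤ (p : ℝ) ^ B := by
        rw [← Real.rpow_natCast]; exact Real.rpow_le_rpow_of_exponent_le h1 hBC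
      have h4 : (0 : ℝ) < (p : ℝ) ^ B := by positivity
      have h6 : K * (p : ℝ) ^ C ≤ K * (p : ℝ) ^ B := by gcongr
      linarith [hA p hp]
  · have h1 : (1 : ℝ) ≤ (p : ℝ) ^ (B + j) := one_le_pow₀ (by exact_mod_cast hp.one_lt.le)
    have h2 : (p : ℝ) ^ (B + j) / 2 ≤ ((p : ℝ) ^ (B + j)) ^ 2 / 2 := by nlinarith
    rw [eulerNorm]
    split_ifs
    · rw [norm_zero]; positivity
    · exact (hz p hp _ (by omega)).trans h2

lemma LSeriesSummable_of_growth (h : (fun n : ℕ => a n) =O[atTop] fun n : ℕ => (n : ℝ) ^ C)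
    {s : ℂ} (hs : C + 1 < s.re) : LSeriesSummable a s :=
  LSeriesSummable_of_isBigO_rpow hs (by simpa using h)

lemma LSeries_eq_dirichletSeries
    (h : (fun n : ℕ => a n) =O[atTop] fun n : ℕ => (n : ℝ) ^ C) {s : ℂ} (hs : C + 1 < s.re) :
    LSeries a s = dirichletSeries a s := by
  rw [LSeries, (LSeriesSummable_of_growth h hs).tsum_eq_zero_add, LSeries.term_zero, zero_add,
    dirichletSeries]
  refine tsum_congr fun n => ?_
  rw [LSeries.term_of_ne_zero n.succ_ne_zero]
  push_cast
  rfl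

lemma coeff_eq_eulerCoeff (hk : Even k)
    (h : (fun n : ℕ => a n) =O[atTop] fun n : ℕ => (n : ℝ) ^ C)
    (hEuler : ∀ s : ℂ, C + 2 < s.re →
      dirichletSeries a s = ∏' p : Nat.Primes, localFactor a N k (p : ℕ) s) {n : ℕ} (hn : n ≠ 0) :
    a n = eulerCoeff (eulerTrace a N k) (eulerNorm N k) n := by
  obtain ⟨A, h₁, h₂⟩ := exists_euler_bound (N := N) h k
  refine LSeries.eq_of_LSeries_eventually_eq ?_ ?_ ?_ hn
  · exact (LSeriesSummable_of_growth h (s := (C + 2 : ℝ)) (by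
      rw [ofReal_re]; linarith)).abscissaOfAbsConv_le.trans_lt (EReal.coe_lt_top _)
  · exact (LSeriesSummable_eulerCoeff h₁ h₂ (s := (A + 2 : ℝ)) (by
      rw [ofReal_re]; linarith)).abscissaOfAbsConv_le.trans_lt (EReal.coe_lt_top _)
  · filter_upwards [eventually_gt_atTop (C + 2), eventually_gt_atTop ((A : ℝ) + 1)] with x hx1 hx2
    rw [LSeries_eq_dirichletSeries h (by rw [ofReal_re]; linarith), hEuler _ (by simpa using hx1),
      LSeries_eulerCoeff h₁ h₂ (by simpa using hx2)]
    exact tprod_congr fun p => localFactor_eq hk p.prop _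

/-- The Hecke recursion for the coefficients of a Dirichlet series with an Euler product. -/
lemma coeff_prime_mul (hk : Even k)
    (h : (fun n : ℕ => a n) =O[atTop] fun n : ℕ => (n : ℝ) ^ C)
    (hEuler : ∀ s : ℂ, C + 2 < s.re →
      dirichletSeries a s = ∏' p : Nat.Primes, localFactor a N k (p : ℕ) s)
    {p : ℕ} (hp : p.Prime) {n : ℕ} (hn : n ≠ 0) :
    a (p * n) = eulerTrace a N k p * a n -
      eulerNorm N k p * (if p ∣ n then a (n / p) else 0) := by
  rw [coeff_eq_eulerCoeff hk h hEuler (mul_ne_zero hp.ne_zero hn), eulerCoeff_prime_mul hp hn,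
    ← coeff_eq_eulerCoeff hk h hEuler hn]
  congr 2
  split_ifs with hd
  · exact (coeff_eq_eulerCoeff hk h hEuler
      (Nat.div_pos (Nat.le_of_dvd (Nat.pos_of_ne_zero hn) hd) hp.pos).ne').symm
  · rfl

end EulerCoefficients

section HeckeOperators

variable {a : ℕ → ℂ} {C : ℝ} {k : ℤ}

lemma hasSum_iff_of_eq {f g : ℕ → ℂ} {s : ℂ} (h : ∀ n, f n = g n) : HasSum f s ↔ HasSum g s := by
  rw [funext h]

/-- The sequence `a` with its zeroth term replaced by `0`. -/
def dropZero (a : ℕ → ℂ) (n : ℕ) : ℂ := if n = 0 then 0 else a n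

/-- The additive character `z ↦ e ^ (2 π i n z)`. -/
noncomputable def fourierChar (n : ℕ) (z : ℂ) : ℂ :=
  Complex.exp (2 * (Real.pi : ℂ) * Complex.I * n * z)

lemma hasSum_fourierSeries (h : (fun n : ℕ => a n) =O[atTop] fun n : ℕ => (n : ℝ) ^ C) (z : ℍ) :
    HasSum (fun n : ℕ => dropZero a n * fourierChar n z) (fourierSeries a z) := by
  rw [← hasSum_nat_add_iff' 1]
  have h1 := (summable_norm_fourier h z.im_pos).of_norm.hasSum
  simpa [dropZero, fourierChar, fourierSeries] using h1

lemma fourierChar_add (n : ℕ) (z w : ℂ) :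
    fourierChar n (z + w) = fourierChar n z * fourierChar n w := by
  rw [fourierChar, mul_add, Complex.exp_add]; rfl

lemma sum_fourierChar {p : ℕ} (hp : p ≠ 0) (n : ℕ) :
    ∑ b ∈ Finset.range p, fourierChar n (b / p) = if p ∣ n then (p : ℂ) else 0 := by
  have hprim := Complex.isPrimitiveRoot_exp p hp
  set ζ := Complex.exp (2 * (Real.pi : ℂ) * Complex.I / p) with hζ
  have h1 (b : ℕ) : fourierChar n (b / p) = (ζ ^ n) ^ b := by
    rw [fourierChar, hζ, ← pow_mul, ← Complex.exp_nat_mul]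
    congr 1
    push_cast
    ring
  simp_rw [h1]
  split_ifs with hd
  · rw [(hprim.pow_eq_one_iff_dvd n).2 hd]; simp
  · have h2 : ζ ^ n ≠ 1 := fun h2 => hd ((hprim.pow_eq_one_iff_dvd n).1 h2)
    rw [geom_sum_eq h2, ← pow_mul, mul_comm n, pow_mul, hprim.pow_eq_one]
    simp

lemma hasSum_sum_intSlash (hk : Even k)
    (h : (fun n : ℕ => a n) =O[atTop] fun n : ℕ => (n : ℝ) ^ C) {p : ℕ} (hp : 0 < p) (z : ℍ) :
    HasSum (fun m : ℕ => (p : ℂ) ^ (1 - k / 2) * dropZero a (p * m) * fourierChar m z)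
      (∑ b ∈ Finset.range p, intSlash k 1 b 0 p (fourierSeries a) z) := by
  have hp0 : (p : ℂ) ≠ 0 := by exact_mod_cast hp.ne'
  have hinj : Function.Injective fun m : ℕ => p * m := fun x y hxy =>
    Nat.eq_of_mul_eq_mul_left hp hxy
  have h1 (b : ℕ) : HasSum (fun n : ℕ => (p : ℂ) ^ (-(k / 2)) *
      (dropZero a n * fourierChar n ((z + b) / p)))
      (intSlash k 1 b 0 p (fourierSeries a) z) := by
    have hdet : (0 : ℤ) < 1 * p - b * 0 := by simpa using hp
    have e0 : ((glAct !![((1 : ℤ) : ℝ), ((b : ℤ) : ℝ); ((0 : ℤ) : ℝ), ((p : ℤ) : ℝ)] z : ℍ) : ℂ) =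
        (z + b) / p := by
      rw [coe_glAct (det_int_pos hdet)]; simp
    have e1 : ((1 * p - b * 0 : ℤ) : ℂ) ^ (k / 2) * (((0 : ℤ) : ℂ) * z + ((p : ℤ) : ℂ)) ^ (-k) =
        (p : ℂ) ^ (-(k / 2)) := by
      have : k / 2 + -k = -(k / 2) := by
        obtain ⟨j, rfl⟩ := hk
        omega
      rw [← this, zpow_add₀ hp0]
      simp
    rw [intSlash_apply, e1, ← e0]
    exact (hasSum_fourierSeries h _).mul_left _
  have h2 (n : ℕ) : ∑ b ∈ Finset.range p, (p : ℂ) ^ (-(k / 2)) *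
      (dropZero a n * fourierChar n ((z + b) / p)) = (p : ℂ) ^ (-(k / 2)) *
        (dropZero a n * fourierChar n (z / p)) * (if p ∣ n then (p : ℂ) else 0) := by
    rw [← sum_fourierChar hp.ne', Finset.mul_sum]
    refine Finset.sum_congr rfl fun b _ => ?_
    rw [add_div, fourierChar_add]
    ring
  have h3 := hasSum_sum (s := Finset.range p) fun b _ => h1 b
  simp_rw [h2] at h3
  rw [← hinj.hasSum_iff] at h3
  · convert h3 using 2 with m
    have e1 : fourierChar (p * m) (z / p) = fourierChar m z := by
      rw [fourierChar, fourierChar]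
      congr 1
      push_cast
      field_simp
    rw [Function.comp_apply, if_pos (dvd_mul_right p m), e1, sub_eq_neg_add, zpow_add₀ hp0,
      zpow_one]
    ring
  · intro n hn
    rw [if_neg, mul_zero]
    rintro ⟨m, rfl⟩
    exact hn ⟨m, rfl⟩

lemma hasSum_intSlash_diag
    (h : (fun n : ℕ => a n) =O[atTop] fun n : ℕ => (n : ℝ) ^ C) {p : ℕ} (hp : 0 < p) (z : ℍ) :
    HasSum (fun m : ℕ => (p : ℂ) ^ (k / 2) * (if p ∣ m then dropZero a (m / p) else 0) *
      fourierChar m z) (intSlash k p 0 0 1 (fourierSeries a) z) := by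
  have hinj : Function.Injective fun m : ℕ => p * m := fun x y hxy =>
    Nat.eq_of_mul_eq_mul_left hp hxy
  have hdet : (0 : ℤ) < p * 1 - 0 * 0 := by simpa using hp
  rw [← hinj.hasSum_iff]
  · have e0 : ((glAct !![((p : ℤ) : ℝ), ((0 : ℤ) : ℝ); ((0 : ℤ) : ℝ), ((1 : ℤ) : ℝ)] z : ℍ) : ℂ) =
        p * z := by
      rw [coe_glAct (det_int_pos hdet)]; simp
    have e1 : ((p * 1 - 0 * 0 : ℤ) : ℂ) ^ (k / 2) * (((0 : ℤ) : ℂ) * z + ((1 : ℤ) : ℂ)) ^ (-k) =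
        (p : ℂ) ^ (k / 2) := by
      simp
    rw [intSlash_apply, e1]
    refine (hasSum_iff_of_eq fun m => ?_).2 ((hasSum_fourierSeries h _).mul_left _)
    rw [Function.comp_apply, if_pos (dvd_mul_right p m), Nat.mul_div_cancel_left m hp, e0,
      mul_assoc, fourierChar, fourierChar]
    congr 3
    push_cast
    ring
  · intro n hn
    rw [if_neg]
    · simp
    · rintro ⟨m, rfl⟩
      exact hn ⟨m, rfl⟩

/-- A recursion for the coefficients makes `f` an eigenfunction of the Hecke operator at `p`. -/
lemma hecke_of_recursion (hk : Even k)
    (h : (fun n : ℕ => a n) =O[atTop] fun n : ℕ => (n : ℝ) ^ C) {p : ℕ} (hp : 0 < p) {c : ℂ}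
    (hrec : ∀ n, n ≠ 0 → a (p * n) = c * a n -
      (p : ℂ) ^ (k - 1) * (if p ∣ n then a (n / p) else 0)) :
    intSlash k p 0 0 1 (fourierSeries a) +
      ∑ b ∈ Finset.range p, intSlash k 1 b 0 p (fourierSeries a) =
      ((p : ℂ) ^ (1 - k / 2) * c) • fourierSeries a := by
  funext z
  rw [Pi.add_apply, Finset.sum_apply, Pi.smul_apply, smul_eq_mul]
  refine HasSum.unique ((hasSum_intSlash_diag h hp z).add (hasSum_sum_intSlash hk h hp z)) ?_
  refine (hasSum_iff_of_eq fun m => ?_).2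
    ((hasSum_fourierSeries h z).mul_left ((p : ℂ) ^ (1 - k / 2) * c))
  have hp0 : (p : ℂ) ≠ 0 := by exact_mod_cast hp.ne'
  have e1 : (p : ℂ) ^ (k / 2) = (p : ℂ) ^ (1 - k / 2) * (p : ℂ) ^ (k - 1) := by
    rw [← zpow_add₀ hp0]
    congr 1
    obtain ⟨j, rfl⟩ := hk
    omega
  rcases eq_or_ne m 0 with rfl | hm
  · simp [dropZero]
  have e2 : (if p ∣ m then dropZero a (m / p) else 0) = if p ∣ m then a (m / p) else 0 := by
    split_ifs with hd
    · rw [dropZero, if_neg (Nat.div_pos (Nat.le_of_dvd (Nat.pos_of_ne_zero hm) hd) hp).ne']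
    · rfl
  rw [e2, e1, dropZero, dropZero, if_neg hm, if_neg (mul_ne_zero hp.ne' hm), hrec m hm]
  ring

lemma sum_intSlash_of_recursion (hk : Even k)
    (h : (fun n : ℕ => a n) =O[atTop] fun n : ℕ => (n : ℝ) ^ C) {p : ℕ} (hp : 0 < p)
    (hrec : ∀ n, n ≠ 0 → a (p * n) = (p : ℂ) ^ (k / 2 - 1) * a n) :
    ∑ b ∈ Finset.range p, intSlash k 1 b 0 p (fourierSeries a) = fourierSeries a := by
  funext z
  rw [Finset.sum_apply]
  refine HasSum.unique (hasSum_sum_intSlash hk h hp z) ?_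
  refine (hasSum_iff_of_eq fun m => ?_).2 (hasSum_fourierSeries h z)
  have hp0 : (p : ℂ) ≠ 0 := by exact_mod_cast hp.ne'
  rcases eq_or_ne m 0 with rfl | hm
  · simp [dropZero]
  rw [dropZero, dropZero, if_neg hm, if_neg (mul_ne_zero hp.ne' hm), hrec m hm, ← mul_assoc,
    ← zpow_add₀ hp0]
  simp

/-- If the coefficients of even index vanish, translation by `1 / 2` is multiplication by `-1`. -/
lemma intSlash_half_of_even_eq_zero (hk : Even k)
    (h : (fun n : ℕ => a n) =O[atTop] fun n : ℕ => (n : ℝ) ^ C)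
    (hrec : ∀ n, n ≠ 0 → a (2 * n) = 0) :
    intSlash k 2 1 0 2 (fourierSeries a) = -fourierSeries a := by
  funext z
  have hdet : (0 : ℤ) < 2 * 2 - 1 * 0 := by norm_num
  have e0 : ((glAct !![((2 : ℤ) : ℝ), ((1 : ℤ) : ℝ); ((0 : ℤ) : ℝ), ((2 : ℤ) : ℝ)] z : ℍ) : ℂ) =
      z + 1 / 2 := by
    rw [coe_glAct (det_int_pos hdet)]; simp; ring
  have e1 : ((2 * 2 - 1 * 0 : ℤ) : ℂ) ^ (k / 2) * (((0 : ℤ) : ℂ) * z + ((2 : ℤ) : ℂ)) ^ (-k) =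
      1 := by
    obtain ⟨j, rfl⟩ := hk
    rw [show (j + j) / 2 = j by omega, _root_.zpow_neg, zpow_add₀ (by norm_num)]
    push_cast
    rw [show (4 : ℂ) = 2 * 2 by norm_num, mul_zpow, zero_mul, zero_add]
    exact mul_inv_cancel₀ (by simp [zpow_ne_zero])
  rw [intSlash_apply, e1, one_mul, Pi.neg_apply]
  refine HasSum.unique (hasSum_fourierSeries h _) ?_
  refine (hasSum_iff_of_eq fun n => ?_).2 (hasSum_fourierSeries h z).neg
  rw [e0, fourierChar_add]
  rcases Nat.even_or_odd' n with ⟨m, rfl | rfl⟩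
  · have : dropZero a (2 * m) = 0 := by
      rw [dropZero]
      split_ifs with h0
      · rfl
      · exact hrec m (by omega)
    simp [this]
  · have : fourierChar (2 * m + 1) (1 / 2) = -1 := by
      rw [fourierChar, show (2 * (Real.pi : ℂ) * Complex.I * ((2 * m + 1 : ℕ) : ℂ) * (1 / 2)) =
        (m : ℂ) * (2 * (Real.pi : ℂ) * Complex.I) + Real.pi * Complex.I by push_cast; ring,
        Complex.exp_add, Complex.exp_nat_mul_two_pi_mul_I, Complex.exp_pi_mul_I]
      simp
    rw [this]
    ring

end HeckeOperators

section CuspForm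

open FrickeInvariant

variable {a : ℕ → ℂ} {C : ℝ} {k : ℤ} {N : ℕ}

lemma heckeTwo_fourierSeries (hk : Even k)
    (h : (fun n : ℕ => a n) =O[atTop] fun n : ℕ => (n : ℝ) ^ C) {c : ℂ}
    (hrec : ∀ n, n ≠ 0 → a (2 * n) = c * a n -
      (2 : ℂ) ^ (k - 1) * (if 2 ∣ n then a (n / 2) else 0)) :
    HeckeTwo k (fourierSeries a) := by
  refine ⟨(2 : ℂ) ^ (1 - k / 2) * c, ?_⟩
  simpa [Finset.sum_range_succ, add_assoc] using
    hecke_of_recursion hk h (p := 2) two_pos (by simpa using hrec)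

lemma heckeThree_fourierSeries (hk : Even k)
    (h : (fun n : ℕ => a n) =O[atTop] fun n : ℕ => (n : ℝ) ^ C) {c : ℂ}
    (hrec : ∀ n, n ≠ 0 → a (3 * n) = c * a n -
      (3 : ℂ) ^ (k - 1) * (if 3 ∣ n then a (n / 3) else 0)) :
    HeckeThree k (fourierSeries a) := by
  refine ⟨(3 : ℂ) ^ (1 - k / 2) * c, ?_⟩
  simpa [Finset.sum_range_succ, add_assoc] using
    hecke_of_recursion hk h (p := 3) three_pos (by simpa using hrec)

lemma uTwo_fourierSeries (hk : Even k)
    (h : (fun n : ℕ => a n) =O[atTop] fun n : ℕ => (n : ℝ) ^ C)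
    (hrec : ∀ n, n ≠ 0 → a (2 * n) = (2 : ℂ) ^ (k / 2 - 1) * a n) :
    UTwo k (fourierSeries a) := by
  simpa [Finset.sum_range_succ, UTwo] using
    sum_intSlash_of_recursion hk h (p := 2) two_pos (by simpa using hrec)

lemma uThree_fourierSeries (hk : Even k)
    (h : (fun n : ℕ => a n) =O[atTop] fun n : ℕ => (n : ℝ) ^ C)
    (hrec : ∀ n, n ≠ 0 → a (3 * n) = (3 : ℂ) ^ (k / 2 - 1) * a n) :
    UThree k (fourierSeries a) := by
  simpa [Finset.sum_range_succ, UThree] using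
    sum_intSlash_of_recursion hk h (p := 3) three_pos (by simpa using hrec)

lemma frickeInvariant_fourierSeries (hk : Even k) (hk0 : 0 < k) (hN : 0 < N) (hC : 0 < C)
    (h : (fun n : ℕ => a n) =O[atTop] fun n : ℕ => (n : ℝ) ^ C)
    {ε : ℝ} (hε : ε = 1 ∨ ε = -1) {Φ : ℂ → ℂ} (hΦ : Differentiable ℂ Φ)
    (hΦeq : ∀ s : ℂ, C + 2 < s.re →
      Φ s = ((Real.sqrt N : ℂ) / (2 * (Real.pi : ℂ))) ^ s * Complex.Gamma s *
        dirichletSeries a s)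
    (hbdd : ∀ σ₁ σ₂ : ℝ, ∃ M : ℝ, ∀ s : ℂ, σ₁ ≤ s.re → s.re ≤ σ₂ → ‖Φ s‖ ≤ M)
    (hfe : ∀ s : ℂ, Φ s = (ε : ℂ) * (-1 : ℂ) ^ (k / 2) * Φ ((k : ℂ) - s)) :
    FrickeInvariant k N (fourierSeries a) := by
  have hε2 : (ε : ℂ) ^ 2 = 1 := by rcases hε with rfl | rfl <;> simp
  have hs : 0 < Real.sqrt N := Real.sqrt_pos.2 (by exact_mod_cast hN)
  refine ⟨hk, hk0, by exact_mod_cast hN, holoUHP_fourierSeries h, fourierSeries_translate k,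
    ε, hε2, intSlash_fricke_eq hk hN (holoUHP_fourierSeries h) hε2 fun y hy => ?_⟩
  have key := imaginaryAxis_eq_inv h (r := 1 / Real.sqrt N) (by positivity) hC hΦ hbdd
    (κ := (k : ℝ)) (by simpa using hfe) (fun s hs' => ?_) hy
  · rw [key, ← Complex.cpow_intCast (y : ℂ)]
    push_cast
    rfl
  · have e1 : (Real.sqrt N : ℂ) / (2 * (Real.pi : ℂ)) =
        ((Real.sqrt N / (2 * Real.pi) : ℝ) : ℂ) := by
      push_cast; rfl
    have e2 : 2 * (Real.pi : ℂ) * ((1 / Real.sqrt N : ℝ) : ℂ) =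
        (((Real.sqrt N / (2 * Real.pi))⁻¹ : ℝ) : ℂ) := by
      push_cast
      rw [inv_div]
      ring
    rw [hΦeq s hs', e1, e2, Complex.cpow_neg, Complex.ofReal_inv, Complex.inv_cpow, inv_inv]
    rw [Complex.arg_ofReal_of_nonneg (by positivity)]
    exact Real.pi_pos.ne

end CuspForm

/-- **Corollary 1.** For `N ∈ {5,6,7,8,10,11,12,14,15,17,23}`: a functional
equation together with an Euler product of degree 2, level `N`, and weight `k`
for `F(s) = Σ a_n n^{-s}` forces `f(z) = Σ a_n e^{2πinz}` to be a cusp form of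
weight `k` for `Γ₀(N)`: holomorphic, invariant under `Γ₀(N)`, and vanishing
at all cusps. -/
theorem corollary_one_cusp_form
    (N : ℕ) (hN : N ∈ ({5, 6, 7, 8, 10, 11, 12, 14, 15, 17, 23} : Set ℕ))
    (k : ℤ) (hkpos : 0 < k) (hkeven : Even k)
    (a : ℕ → ℂ) (ha1 : a 1 = 1) (C : ℝ) (hC : 0 < C)
    (hgrowth : (fun n : ℕ => a n) =O[atTop] fun n : ℕ => (n : ℝ) ^ C)
    (ε : ℝ) (hε : ε = 1 ∨ ε = -1)
    (Φ : ℂ → ℂ)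
    (hΦentire : Differentiable ℂ Φ)
    (hΦeq : ∀ s : ℂ, C + 2 < s.re →
      Φ s = ((Real.sqrt N : ℂ) / (2 * (Real.pi : ℂ))) ^ s * Complex.Gamma s *
        dirichletSeries a s)
    (hΦbdd : ∀ σ₁ σ₂ : ℝ, ∃ M : ℝ, ∀ s : ℂ, σ₁ ≤ s.re → s.re ≤ σ₂ → ‖Φ s‖ ≤ M)
    (hΦfe : ∀ s : ℂ, Φ s = (ε : ℂ) * (-1 : ℂ) ^ (k / 2) * Φ ((k : ℂ) - s))
    (hEuler : ∀ s : ℂ, C + 2 < s.re →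
      Multipliable (fun p : Nat.Primes => localFactor a N k (p : ℕ) s) ∧
      dirichletSeries a s = ∏' p : Nat.Primes, localFactor a N k (p : ℕ) s) :
    MDifferentiable 𝓘(ℂ) 𝓘(ℂ) (fourierSeries a) ∧
    (∀ γ ∈ CongruenceSubgroup.Gamma0 N,
      slash k (sl2ToReal γ) (fourierSeries a) = fourierSeries a) ∧
    (∀ σ : Matrix.SpecialLinearGroup (Fin 2) ℤ,
      Tendsto (slash k (sl2ToReal σ) (fourierSeries a)) atImInfty (𝓝 0)) := by
  refine ⟨UpperHalfPlane.mdifferentiable_iff.2 (holoUHP_fourierSeries hgrowth), ?_⟩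
  have hN0 : 0 < N := Nat.pos_of_ne_zero (by rintro rfl; simp at hN)
  have hrec {p : ℕ} (hp : p.Prime) (n : ℕ) (hn : n ≠ 0) :=
    coeff_prime_mul hkeven hgrowth (fun s hs => (hEuler s hs).2) hp hn
  have hgood {p : ℕ} (hp : p.Prime) (hd : ¬ p ∣ N) (n : ℕ) (hn : n ≠ 0) :
      a (p * n) = a p * a n - (p : ℂ) ^ (k - 1) * (if p ∣ n then a (n / p) else 0) := by
    rw [hrec hp n hn, eulerTrace, eulerNorm, if_neg hd, if_neg hd]
  have hbad {p : ℕ} (hp : p.Prime) (hd : p ∣ N) (hd2 : ¬ p ^ 2 ∣ N) (n : ℕ) (hn : n ≠ 0) :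
      a (p * n) = (p : ℂ) ^ (k / 2 - 1) * a n := by
    rw [hrec hp n hn, eulerTrace, eulerNorm, if_pos hd, if_pos hd, if_neg hd2, zero_mul, sub_zero]
  refine (frickeInvariant_fourierSeries hkeven hkpos hN0 hC hgrowth hε hΦentire hΦeq hΦbdd
    hΦfe).cuspForm hN (fun hd => ?_) (fun hd => ?_) (fun hd hd2 => ?_) (fun hd hd2 => ?_)
    (fun hd => ?_) (tendsto_fourierSeries hgrowth)
  · exact heckeTwo_fourierSeries hkeven hgrowth (by simpa using hgood Nat.prime_two hd)
  · exact heckeThree_fourierSeries hkeven hgrowth (by simpa using hgood Nat.prime_three hd)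
  · exact uTwo_fourierSeries hkeven hgrowth (by simpa using hbad Nat.prime_two hd hd2)
  · exact uThree_fourierSeries hkeven hgrowth (by simpa using hbad Nat.prime_three hd hd2)
  · refine intSlash_half_of_even_eq_zero hkeven hgrowth fun n hn => ?_
    have hd' : 2 ∣ N := (Dvd.intro _ rfl : 2 ∣ 2 ^ 2).trans hd
    rw [hrec Nat.prime_two n hn, eulerTrace, eulerNorm, if_pos hd', if_pos hd', if_pos hd]
    simp
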